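/- arXiv:2004.01284 — 7 statements merged into one kernel-verified Lean document; each statement's English description precedes it below -/
import Mathlib

section
/- (One-dimensional version of Corollary A, Dirichlet case.) Let L > 0, q ∈ (0,1), and let a : [0,L] → ℝ be continuous and change sign, and assume that the set Ω₊ := {x ∈ (0,L) : a(x) > 0} is nonempty and connected (i.e. an open subinterval). Then the Dirichlet problem (P_D) has exactly one nontrivial solution: there exists a nontrivial solution u, and any two nontrivial solutions coincide. -/
open Real Set

/-- `u` (with first and second derivatives `u'`, `u''`) is a solution of the
one-dimensional Dirichlet problem `(P_D)` on `[0, L]` with weight `a` and exponent `q`: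
`u` is twice continuously differentiable on `[0, L]`, nonnegative, vanishes at the
endpoints, and satisfies `-u'' = a(x) u^q` on `[0, L]`. -/
def DirichletSolution (L q : ℝ) (a u u' u'' : ℝ → ℝ) : Prop :=
  (∀ x ∈ Set.Icc (0 : ℝ) L, HasDerivWithinAt u (u' x) (Set.Icc 0 L) x) ∧
  (∀ x ∈ Set.Icc (0 : ℝ) L, HasDerivWithinAt u' (u'' x) (Set.Icc 0 L) x) ∧
  ContinuousOn u'' (Set.Icc 0 L) ∧
  (∀ x ∈ Set.Icc (0 : ℝ) L, 0 ≤ u x) ∧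
  u 0 = 0 ∧ u L = 0 ∧
  (∀ x ∈ Set.Icc (0 : ℝ) L, -u'' x = a x * u x ^ q)

/-- The weight `a` changes sign on `[0, L]`: it attains both positive and negative
values. -/
def ChangesSign (L : ℝ) (a : ℝ → ℝ) : Prop :=
  (∃ x ∈ Set.Icc (0 : ℝ) L, 0 < a x) ∧ (∃ x ∈ Set.Icc (0 : ℝ) L, a x < 0)

/-! ### Monotonicity on intervals -/

lemma monotoneOn_Icc_of_hasDerivAt {f f' : ℝ → ℝ} {s t : ℝ} (hf : ContinuousOn f (Icc s t))
    (hd : ∀ x ∈ Ioo s t, HasDerivAt f (f' x) x) (h : ∀ x ∈ Ioo s t, 0 ≤ f' x) :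
    MonotoneOn f (Icc s t) := by
  refine monotoneOn_of_hasDerivWithinAt_nonneg (f' := f') (convex_Icc s t) hf ?_ ?_ <;>
    rw [interior_Icc]
  · exact fun x hx => (hd x hx).hasDerivWithinAt
  · exact h

lemma antitoneOn_Icc_of_hasDerivAt {f f' : ℝ → ℝ} {s t : ℝ} (hf : ContinuousOn f (Icc s t))
    (hd : ∀ x ∈ Ioo s t, HasDerivAt f (f' x) x) (h : ∀ x ∈ Ioo s t, f' x ≤ 0) :
    AntitoneOn f (Icc s t) := by
  refine antitoneOn_of_hasDerivWithinAt_nonpos (f' := f') (convex_Icc s t) hf ?_ ?_ <;>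
    rw [interior_Icc]
  · exact fun x hx => (hd x hx).hasDerivWithinAt
  · exact h

lemma eqOn_const_Icc_of_hasDerivAt_zero {f : ℝ → ℝ} {s t : ℝ} (hf : ContinuousOn f (Icc s t))
    (hd : ∀ x ∈ Ioo s t, HasDerivAt f 0 x) : ∀ x ∈ Icc s t, f x = f s := by
  intro x hx
  have hs : s ∈ Icc s t := ⟨le_rfl, hx.1.trans hx.2⟩
  have h1 := monotoneOn_Icc_of_hasDerivAt hf (f' := fun _ => 0) hd (fun _ _ => le_rfl) hs hx hx.1
  have h2 := antitoneOn_Icc_of_hasDerivAt hf (f' := fun _ => 0) hd (fun _ _ => le_rfl) hs hx hx.1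
  exact le_antisymm h2 h1

/-! ### The Picone flux of two positive solutions -/

/-- The boundary term of the Picone-type identity for two solutions `u`, `v`. -/
noncomputable def piconeFlux (q : ℝ) (u u' v v' : ℝ → ℝ) (x : ℝ) : ℝ :=
  (v x ^ (q + 1) - u x ^ (q + 1)) * (u' x / u x ^ q - v' x / v x ^ q)

lemma piconeFlux_swap (q : ℝ) (u u' v v' : ℝ → ℝ) (x : ℝ) :
    piconeFlux q v v' u u' x = piconeFlux q u u' v v' x := by
  unfold piconeFlux; ring

lemma rpow_ratio_sq_lt {q u v : ℝ} (hq : q ∈ Ioo (0 : ℝ) 1) (hu : 0 < u) (hv : 0 < v)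
    (huv : u ≠ v) :
    (q + 1) / 2 * (v ^ q / u ^ q) ^ 2 < q * (v / u) * (v ^ q / u ^ q) + (1 - q) / 2 := by
  obtain ⟨h0, h1⟩ := hq
  rw [← div_rpow hv.le hu.le]
  set s := v / u with hs
  have hs0 : 0 < s := div_pos hv hu
  have hs1 : s ≠ 1 := by
    intro h
    rw [hs, div_eq_one_iff_eq hu.ne'] at h
    exact huv h.symm
  have hx0 : 0 < s ^ (q + 1) := rpow_pos_of_pos hs0 _
  have hx1 : s ^ (q + 1) ≠ 1 := by
    intro h
    rcases lt_or_gt_of_ne hs1 with h' | h'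
    · exact (rpow_lt_one hs0.le h' (by linarith)).ne h
    · exact (one_lt_rpow h' (by linarith)).ne' h
  have hB := rpow_one_add_lt_one_add_mul_self (s := s ^ (q + 1) - 1) (by linarith)
    (sub_ne_zero.2 hx1) (p := 2 * q / (q + 1)) (by positivity)
    (by rw [div_lt_one (by linarith)]; linarith)
  have e1 : (1 + (s ^ (q + 1) - 1)) ^ (2 * q / (q + 1)) = (s ^ q) ^ 2 := by
    rw [add_sub_cancel, ← rpow_mul hs0.le, ← rpow_natCast, ← rpow_mul hs0.le]
    congr 1
    field_simp
    norm_num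
  have e2 : s * s ^ q = s ^ (q + 1) := by rw [rpow_add_one hs0.ne']; ring
  rw [e1] at hB
  have h3 : (q + 1) / 2 * (s ^ q) ^ 2
      < (q + 1) / 2 * (1 + 2 * q / (q + 1) * (s ^ (q + 1) - 1)) :=
    mul_lt_mul_of_pos_left hB (by linarith)
  have h4 : (q + 1) / 2 * (1 + 2 * q / (q + 1) * (s ^ (q + 1) - 1))
      = q * s ^ (q + 1) + (1 - q) / 2 := by
    field_simp
    ring
  rw [mul_assoc, e2]
  linarith

/-- First-order convexity of the squared derivative of `w ^ (1 / (q + 1))`, in terms of `u ^ (q + 1)` and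
`v ^ (q + 1)`. -/
lemma picone_form_nonneg {q u v p r : ℝ} (hq : q ∈ Ioo (0 : ℝ) 1) (hu : 0 < u) (hv : 0 < v) :
    0 ≤ (q + 1) / 2 * r ^ 2 - (q + 1) * (v ^ q / u ^ q) * p * r
      + (q * (v / u) * (v ^ q / u ^ q) + (1 - q) / 2) * p ^ 2 ∧
    ((q + 1) / 2 * r ^ 2 - (q + 1) * (v ^ q / u ^ q) * p * r
      + (q * (v / u) * (v ^ q / u ^ q) + (1 - q) / 2) * p ^ 2 = 0 → u = v ∨ p = 0) := by
  have h0 := hq.1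
  set σ := v ^ q / u ^ q with hσ
  have e : (q + 1) / 2 * r ^ 2 - (q + 1) * σ * p * r + (q * (v / u) * σ + (1 - q) / 2) * p ^ 2
      = (q + 1) / 2 * (r - σ * p) ^ 2
        + (q * (v / u) * σ + (1 - q) / 2 - (q + 1) / 2 * σ ^ 2) * p ^ 2 := by ring
  rw [e]
  have hsq : 0 ≤ (q + 1) / 2 * (r - σ * p) ^ 2 := by positivity
  by_cases huv : u = v
  · refine ⟨?_, fun _ => Or.inl huv⟩
    have : σ = 1 := by rw [hσ, huv, div_self (rpow_pos_of_pos hv q).ne']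
    have hk : q * (v / u) * σ + (1 - q) / 2 - (q + 1) / 2 * σ ^ 2 = 0 := by
      rw [this, huv, div_self hv.ne']
      ring
    rw [hk, zero_mul, add_zero]
    exact hsq
  · have hl := rpow_ratio_sq_lt hq hu hv huv
    rw [← hσ] at hl
    have hl' : 0 < q * (v / u) * σ + (1 - q) / 2 - (q + 1) / 2 * σ ^ 2 := by linarith
    refine ⟨add_nonneg hsq (mul_nonneg hl'.le (sq_nonneg p)), fun h => Or.inr ?_⟩
    by_contra hp
    have : 0 < (q * (v / u) * σ + (1 - q) / 2 - (q + 1) / 2 * σ ^ 2) * p ^ 2 :=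
      mul_pos hl' (by positivity)
    linarith

lemma hasDerivAt_piconeFlux {q A x : ℝ} {u u' v v' : ℝ → ℝ} {u2 v2 : ℝ}
    (hq : q ∈ Ioo (0 : ℝ) 1) (hu : 0 < u x) (hv : 0 < v x)
    (du : HasDerivAt u (u' x) x) (du' : HasDerivAt u' u2 x)
    (dv : HasDerivAt v (v' x) x) (dv' : HasDerivAt v' v2 x)
    (eu : -u2 = A * u x ^ q) (ev : -v2 = A * v x ^ q) :
    ∃ D, HasDerivAt (piconeFlux q u u' v v') D x ∧ D ≤ 0 ∧
      (D = 0 → u x = v x ∨ (u' x = 0 ∧ v' x = 0)) := by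
  have hU : 0 < u x ^ q := rpow_pos_of_pos hu q
  have hV : 0 < v x ^ q := rpow_pos_of_pos hv q
  have d1 := ((dv.rpow_const (p := q + 1) (Or.inl hv.ne')).sub
      (du.rpow_const (p := q + 1) (Or.inl hu.ne'))).mul
    ((du'.div (du.rpow_const (p := q) (Or.inl hu.ne')) hU.ne').sub
      (dv'.div (dv.rpow_const (p := q) (Or.inl hv.ne')) hV.ne'))
  obtain ⟨n1, z1⟩ := picone_form_nonneg (p := u' x) (r := v' x) hq hu hv
  obtain ⟨n2, z2⟩ := picone_form_nonneg (p := v' x) (r := u' x) hq hv hu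
  set X1 := (q + 1) / 2 * v' x ^ 2 - (q + 1) * (v x ^ q / u x ^ q) * u' x * v' x
      + (q * (v x / u x) * (v x ^ q / u x ^ q) + (1 - q) / 2) * u' x ^ 2 with hX1
  set X2 := (q + 1) / 2 * u' x ^ 2 - (q + 1) * (u x ^ q / v x ^ q) * v' x * u' x
      + (q * (u x / v x) * (u x ^ q / v x ^ q) + (1 - q) / 2) * v' x ^ 2 with hX2
  refine ⟨-X1 - X2, ?_, by linarith, fun h => ?_⟩
  · refine HasDerivAt.congr_deriv d1 ?_
    simp only [Pi.sub_apply, Pi.div_apply, add_sub_cancel_right, rpow_add_one hu.ne',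
      rpow_add_one hv.ne', rpow_sub_one hu.ne', rpow_sub_one hv.ne']
    rw [show u2 = -(A * u x ^ q) by linarith, show v2 = -(A * v x ^ q) by linarith, hX1, hX2]
    field_simp
    ring
  · have h1 : X1 = 0 := by linarith
    have h2 : X2 = 0 := by linarith
    rcases z1 h1 with h | h
    · exact Or.inl h
    · rcases z2 h2 with h' | h'
      · exact Or.inl h'.symm
      · exact Or.inr ⟨h, h'⟩

/-! ### Elementary properties of solutions -/

namespace DirichletSolution

variable {L q : ℝ} {a u u' u'' v v' v'' : ℝ → ℝ}

lemma nonneg (h : DirichletSolution L q a u u' u'') {x : ℝ} (hx : x ∈ Icc 0 L) : 0 ≤ u x :=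
  h.2.2.2.1 x hx

lemma continuousOn (h : DirichletSolution L q a u u' u'') : ContinuousOn u (Icc 0 L) :=
  fun x hx => (h.1 x hx).continuousWithinAt

lemma continuousOn_deriv (h : DirichletSolution L q a u u' u'') : ContinuousOn u' (Icc 0 L) :=
  fun x hx => (h.2.1 x hx).continuousWithinAt

lemma hasDerivAt (h : DirichletSolution L q a u u' u'') {x : ℝ} (hx : x ∈ Ioo 0 L) :
    HasDerivAt u (u' x) x :=
  (h.1 x (Ioo_subset_Icc_self hx)).hasDerivAt (Icc_mem_nhds hx.1 hx.2)

lemma hasDerivAt_deriv (h : DirichletSolution L q a u u' u'') {x : ℝ} (hx : x ∈ Ioo 0 L) :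
    HasDerivAt u' (-(a x * u x ^ q)) x := by
  have h1 := (h.2.1 x (Ioo_subset_Icc_self hx)).hasDerivAt (Icc_mem_nhds hx.1 hx.2)
  have h2 := h.2.2.2.2.2.2 x (Ioo_subset_Icc_self hx)
  exact h1.congr_deriv (by linarith)

lemma monotoneOn_deriv (h : DirichletSolution L q a u u' u'') {s t : ℝ} (hs : 0 ≤ s) (ht : t ≤ L)
    (ha : ∀ x ∈ Ioo s t, a x ≤ 0) : MonotoneOn u' (Icc s t) := by
  refine monotoneOn_Icc_of_hasDerivAt (h.continuousOn_deriv.mono (Icc_subset_Icc hs ht))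
    (fun x hx => h.hasDerivAt_deriv (Ioo_subset_Ioo hs ht hx)) fun x hx => ?_
  have := rpow_nonneg (h.nonneg (Ioo_subset_Icc_self (Ioo_subset_Ioo hs ht hx))) q
  have := mul_nonneg (neg_nonneg.2 (ha x hx)) this
  linarith

lemma antitoneOn_deriv (h : DirichletSolution L q a u u' u'') {s t : ℝ} (hs : 0 ≤ s) (ht : t ≤ L)
    (ha : ∀ x ∈ Ioo s t, 0 ≤ a x) : AntitoneOn u' (Icc s t) := by
  refine antitoneOn_Icc_of_hasDerivAt (h.continuousOn_deriv.mono (Icc_subset_Icc hs ht))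
    (fun x hx => h.hasDerivAt_deriv (Ioo_subset_Ioo hs ht hx)) fun x hx => ?_
  have := rpow_nonneg (h.nonneg (Ioo_subset_Icc_self (Ioo_subset_Ioo hs ht hx))) q
  have := mul_nonneg (ha x hx) this
  linarith

lemma monotoneOn_of_nonneg (h : DirichletSolution L q a u u' u'') {s t : ℝ} (hs : 0 ≤ s)
    (ht : t ≤ L) (hd : ∀ x ∈ Ioo s t, 0 ≤ u' x) : MonotoneOn u (Icc s t) :=
  monotoneOn_Icc_of_hasDerivAt (h.continuousOn.mono (Icc_subset_Icc hs ht))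
    (fun _ hx => h.hasDerivAt (Ioo_subset_Ioo hs ht hx)) hd

lemma antitoneOn_of_nonpos (h : DirichletSolution L q a u u' u'') {s t : ℝ} (hs : 0 ≤ s)
    (ht : t ≤ L) (hd : ∀ x ∈ Ioo s t, u' x ≤ 0) : AntitoneOn u (Icc s t) :=
  antitoneOn_Icc_of_hasDerivAt (h.continuousOn.mono (Icc_subset_Icc hs ht))
    (fun _ hx => h.hasDerivAt (Ioo_subset_Ioo hs ht hx)) hd

lemma deriv_eq_zero (h : DirichletSolution L q a u u' u'') {x : ℝ} (hx : x ∈ Ioo 0 L)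
    (hux : u x = 0) : u' x = 0 := by
  refine IsLocalMin.hasDerivAt_eq_zero (f := u) (a := x) ?_ (h.hasDerivAt hx)
  filter_upwards [Icc_mem_nhds hx.1 hx.2] with y hy
  rw [hux]
  exact h.nonneg hy

lemma reflect (h : DirichletSolution L q a u u' u'') :
    DirichletSolution L q (fun x => a (L - x)) (fun x => u (L - x)) (fun x => -u' (L - x))
      (fun x => u'' (L - x)) := by
  have hm : MapsTo (fun x : ℝ => L - x) (Icc 0 L) (Icc 0 L) := fun x hx =>
    ⟨by linarith [hx.2], by linarith [hx.1]⟩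
  have hd : ∀ x, HasDerivWithinAt (fun x : ℝ => L - x) (-1) (Icc 0 L) x := fun x =>
    ((hasDerivAt_id x).const_sub L).hasDerivWithinAt
  obtain ⟨h1, h2, h3, h4, h5, h6, h7⟩ := h
  refine ⟨fun x hx => ?_, fun x hx => ?_, ?_, fun x hx => h4 _ (hm hx), ?_, ?_,
    fun x hx => h7 _ (hm hx)⟩
  · have := (h1 (L - x) (hm hx)).comp x (hd x) hm
    exact this.congr_deriv (by ring)
  · have := ((h2 (L - x) (hm hx)).comp x (hd x) hm).neg
    exact this.congr_deriv (by ring)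
  · exact h3.comp (by fun_prop) hm
  · simpa using h6
  · simpa using h5

end DirichletSolution

/-- The part of `(0, L)` where the weight is positive. -/
def positivitySet (L : ℝ) (a : ℝ → ℝ) : Set ℝ := {x : ℝ | x ∈ Ioo (0 : ℝ) L ∧ 0 < a x}

lemma positivitySet_reflect {L : ℝ} {a : ℝ → ℝ} (hS : (positivitySet L a).OrdConnected) :
    (positivitySet L (fun x => a (L - x))).OrdConnected := by
  refine ⟨fun x hx y hy z hz => ?_⟩
  have hx' : L - x ∈ positivitySet L a := ⟨⟨by linarith [hx.1.2], by linarith [hx.1.1]⟩, hx.2⟩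
  have hy' : L - y ∈ positivitySet L a := ⟨⟨by linarith [hy.1.2], by linarith [hy.1.1]⟩, hy.2⟩
  have hz' := hS.out hy' hx' (⟨by linarith [hz.2], by linarith [hz.1]⟩ : L - z ∈ Icc (L - y) (L - x))
  exact ⟨⟨by linarith [hz'.1.2], by linarith [hz'.1.1]⟩, hz'.2⟩

lemma mem_positivitySet_reflect {L x : ℝ} {a : ℝ → ℝ} (hx : x ∈ positivitySet L a) :
    L - x ∈ positivitySet L (fun x => a (L - x)) :=
  ⟨⟨by linarith [hx.1.2], by linarith [hx.1.1]⟩, by simpa using hx.2⟩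

lemma nonpos_of_lt_nonpos {L x₀ y z : ℝ} {a : ℝ → ℝ} (hS : (positivitySet L a).OrdConnected)
    (hx₀ : x₀ ∈ positivitySet L a) (hy : y ≤ x₀) (hay : a y ≤ 0) (hz : z ∈ Ioo 0 y) : a z ≤ 0 := by
  by_contra! hc
  have hzS : z ∈ positivitySet L a := ⟨⟨hz.1, hz.2.trans (hy.trans_lt hx₀.1.2)⟩, hc⟩
  exact absurd (hS.out hzS hx₀ ⟨hz.2.le, hy⟩).2 hay.not_gt

namespace DirichletSolution

variable {L q : ℝ} {a u u' u'' v v' v'' : ℝ → ℝ}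

lemma eq_zero_left (h : DirichletSolution L q a u u' u'') (hS : (positivitySet L a).OrdConnected)
    {x₀ : ℝ} (hx₀ : x₀ ∈ positivitySet L a) (hu : u x₀ = 0) : ∀ y ∈ Icc 0 x₀, u y = 0 := by
  have hsub : Icc 0 x₀ ⊆ Icc 0 L := Icc_subset_Icc_right hx₀.1.2.le
  obtain ⟨y, hy, hmax⟩ := isCompact_Icc.exists_isMaxOn ⟨x₀, hx₀.1.1.le, le_rfl⟩
    (h.continuousOn.mono hsub)
  have hu0 : u 0 = 0 := h.2.2.2.2.1
  suffices hyle : u y ≤ 0 from fun z hz => le_antisymm ((hmax hz).trans hyle) (h.nonneg (hsub hz))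
  by_contra! hpos
  have hy0 : 0 < y := lt_of_le_of_ne hy.1 (by rintro rfl; exact hpos.ne' hu0)
  have hyx : y < x₀ := lt_of_le_of_ne hy.2 (by rintro rfl; exact hpos.ne' hu)
  have hyL : y ∈ Ioo 0 L := ⟨hy0, hyx.trans hx₀.1.2⟩
  have hd0 : u' y = 0 :=
    (hmax.isLocalMax (Icc_mem_nhds hy0 hyx)).hasDerivAt_eq_zero (h.hasDerivAt hyL)
  rcases lt_or_ge 0 (a y) with hay | hay
  · have hyS : y ∈ positivitySet L a := ⟨hyL, hay⟩
    have hanti := h.antitoneOn_deriv hy0.le hx₀.1.2.le (t := x₀) fun x hx =>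
      (hS.out hyS hx₀ (Ioo_subset_Icc_self hx)).2.le
    have hmono := h.monotoneOn_of_nonneg hy0.le hx₀.1.2.le (t := x₀) fun x hx => by
      rw [← h.deriv_eq_zero hx₀.1 hu]
      exact hanti (Ioo_subset_Icc_self hx) ⟨hyx.le, le_rfl⟩ hx.2.le
    have := hmono ⟨le_rfl, hyx.le⟩ ⟨hyx.le, le_rfl⟩ hyx.le
    linarith
  · have hmono := h.monotoneOn_deriv le_rfl hyL.2.le fun x hx =>
      nonpos_of_lt_nonpos hS hx₀ hyx.le hay hx
    have hanti := h.antitoneOn_of_nonpos le_rfl hyL.2.le (t := y) fun x hx => by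
      rw [← hd0]
      exact hmono (Ioo_subset_Icc_self hx) ⟨hy0.le, le_rfl⟩ hx.2.le
    have := hanti ⟨le_rfl, hy0.le⟩ ⟨hy0.le, le_rfl⟩ hy0.le
    linarith

lemma pos_of_mem_positivitySet (h : DirichletSolution L q a u u' u'')
    (hS : (positivitySet L a).OrdConnected) (hne : ∃ x ∈ Icc (0 : ℝ) L, u x ≠ 0)
    {x₀ : ℝ} (hx₀ : x₀ ∈ positivitySet L a) : 0 < u x₀ := by
  refine lt_of_le_of_ne (h.nonneg (Ioo_subset_Icc_self hx₀.1)) fun h0 => ?_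
  obtain ⟨x, hx, hux⟩ := hne
  rcases le_total x x₀ with hle | hle
  · exact hux (h.eq_zero_left hS hx₀ h0.symm x ⟨hx.1, hle⟩)
  · have := h.reflect.eq_zero_left (positivitySet_reflect hS) (mem_positivitySet_reflect hx₀)
      (by simpa using h0.symm) (L - x) ⟨by linarith [hx.2], by linarith⟩
    exact hux (by simpa using this)

/-- To the left of the positivity set the weight is nonpositive as soon as a solution has a
degenerate zero there. -/
lemma exists_nonpos_of_deriv_eq_zero (h : DirichletSolution L q a u u' u'') {c x₀ : ℝ}
    (hc : 0 ≤ c) (hcx : c < x₀) (hx₀ : x₀ ∈ positivitySet L a) (huc : u c = 0) (huc' : u' c = 0)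
    (hu : 0 < u x₀) : ∃ y ∈ Ioo c x₀, a y ≤ 0 := by
  by_contra! hpos
  have hanti := h.antitoneOn_deriv hc hx₀.1.2.le (t := x₀) fun x hx => (hpos x hx).le
  have hanti' := h.antitoneOn_of_nonpos hc hx₀.1.2.le (t := x₀) fun x hx => by
    rw [← huc']
    exact hanti ⟨le_rfl, hcx.le⟩ (Ioo_subset_Icc_self hx) hx.1.le
  have := hanti' ⟨le_rfl, hcx.le⟩ ⟨hcx.le, le_rfl⟩ hcx.le
  linarith

end DirichletSolution

namespace DirichletSolution

open Filter Topology

variable {L q : ℝ} {a u u' u'' v v' v'' : ℝ → ℝ}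

lemma deriv_le_of_degenerate (h : DirichletSolution L q a u u' u'') (hq : q ∈ Ioo (0 : ℝ) 1)
    {M c y : ℝ} (hM : ∀ x ∈ Icc 0 L, |a x| ≤ M) (hc : 0 ≤ c) (hy : y ≤ L) (huc' : u' c = 0)
    (ha : ∀ x ∈ Ioo c y, a x ≤ 0) {x : ℝ} (hx : x ∈ Ioo c y) :
    0 ≤ u' x ∧ u' x ≤ M * u x ^ q * (x - c) := by
  have hmono' := h.monotoneOn_deriv hc hy ha
  have hcy : c ≤ y := (hx.1.trans hx.2).le
  have hd : ∀ z ∈ Icc c y, 0 ≤ u' z := fun z hz => by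
    rw [← huc']
    exact hmono' ⟨le_rfl, hcy⟩ hz hz.1
  have hmono := h.monotoneOn_of_nonneg hc hy fun z hz => hd z (Ioo_subset_Icc_self hz)
  refine ⟨hd x (Ioo_subset_Icc_self hx), ?_⟩
  have hsub : Icc c x ⊆ Icc 0 L := Icc_subset_Icc hc (hx.2.le.trans hy)
  have hg : MonotoneOn (fun t => M * u x ^ q * (t - c) - u' t) (Icc c x) := by
    refine monotoneOn_Icc_of_hasDerivAt (f' := fun t => M * u x ^ q + a t * u t ^ q)
      (ContinuousOn.sub (by fun_prop) (h.continuousOn_deriv.mono hsub)) (fun t ht => ?_)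
      fun t ht => ?_
    · have := (((hasDerivAt_id t).sub_const c).const_mul (M * u x ^ q)).sub
        (h.hasDerivAt_deriv (Ioo_subset_Ioo hc (hx.2.le.trans hy) ht))
      exact this.congr_deriv (by ring)
    · have htL := hsub (Ioo_subset_Icc_self ht)
      have h1 : u t ^ q ≤ u x ^ q := rpow_le_rpow (h.nonneg htL)
        (hmono ⟨ht.1.le, ht.2.le.trans hx.2.le⟩ (Ioo_subset_Icc_self hx) ht.2.le) hq.1.le
      have h0 : 0 ≤ u t ^ q := rpow_nonneg (h.nonneg htL) q
      have h2 := hM t htL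
      have h3 := neg_abs_le (a t)
      nlinarith [abs_nonneg (a t)]
  have := hg ⟨le_rfl, hx.1.le⟩ ⟨hx.1.le, le_rfl⟩ hx.1.le
  simp only [sub_self, mul_zero, huc'] at this
  linarith

lemma tendsto_right (h : DirichletSolution L q a u u' u'') {c : ℝ} (hc : 0 ≤ c) (hcL : c < L) :
    Tendsto u (𝓝[>] c) (𝓝 (u c)) ∧ Tendsto u' (𝓝[>] c) (𝓝 (u' c)) := by
  have hle : 𝓝[>] c ≤ 𝓝[Icc 0 L] c := by
    rw [← nhdsWithin_Ioo_eq_nhdsGT hcL]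
    exact nhdsWithin_mono c fun x hx => ⟨hc.trans hx.1.le, hx.2.le⟩
  exact ⟨(h.continuousOn c ⟨hc, hcL.le⟩).tendsto.mono_left hle,
    (h.continuousOn_deriv c ⟨hc, hcL.le⟩).tendsto.mono_left hle⟩

lemma tendsto_div_zero (h : DirichletSolution L q a u u' u'') (hL : 0 < L) :
    Tendsto (fun x => u x / x) (𝓝[>] 0) (𝓝 (u' 0)) := by
  have h1 : HasDerivWithinAt u (u' 0) (Ioi 0) 0 :=
    ((h.1 0 ⟨le_rfl, hL.le⟩).mono Ioo_subset_Icc_self).mono_of_mem_nhdsWithin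
      (Ioo_mem_nhdsGT hL)
  rw [hasDerivWithinAt_iff_tendsto_slope' (by simp)] at h1
  refine h1.congr fun x => ?_
  rw [slope_def_field, h.2.2.2.2.1, sub_zero, sub_zero]

/-- At a zero `c` of `u`, the term `v ^ (q + 1) * u' / u ^ q` of the Picone flux vanishes. -/
lemma tendsto_flux_term (h : DirichletSolution L q a u u' u'')
    (k : DirichletSolution L q a v v' v'') (hq : q ∈ Ioo (0 : ℝ) 1)
    (ha : ContinuousOn a (Icc 0 L)) (hS : (positivitySet L a).OrdConnected)
    {c x₀ : ℝ} (hc : 0 ≤ c) (hcx : c < x₀) (hx₀ : x₀ ∈ positivitySet L a) (huc : u c = 0)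
    (hu : ∀ x ∈ Ioc c x₀, 0 < u x) :
    Tendsto (fun x => v x ^ (q + 1) * (u' x / u x ^ q)) (𝓝[>] c) (𝓝 0) := by
  have hcL : c < L := hcx.trans hx₀.1.2
  obtain ⟨tu, tu'⟩ := h.tendsto_right hc hcL
  obtain ⟨tv, -⟩ := k.tendsto_right hc hcL
  by_cases huc' : u' c = 0
  · obtain ⟨y, hy, hay⟩ := h.exists_nonpos_of_deriv_eq_zero hc hcx hx₀ huc huc'
      (hu x₀ ⟨hcx, le_rfl⟩)
    obtain ⟨M, hM⟩ := isCompact_Icc.exists_bound_of_continuousOn ha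
    have hyL : y ≤ L := (hy.2.trans hx₀.1.2).le
    have hbd := fun x (hx : x ∈ Ioo c y) => h.deriv_le_of_degenerate hq hM hc hyL huc'
      (fun z hz => nonpos_of_lt_nonpos hS hx₀ hy.2.le hay ⟨hc.trans_lt hz.1, hz.2⟩) hx
    have hlim : Tendsto (fun x => v x ^ (q + 1) * (M * (x - c))) (𝓝[>] c) (𝓝 0) := by
      have h1 : Tendsto (fun x => v x ^ (q + 1)) (𝓝[>] c) (𝓝 (v c ^ (q + 1))) :=
        tv.rpow_const (Or.inr (by linarith [hq.1]))
      have h2 : Tendsto (fun x => M * (x - c)) (𝓝[>] c) (𝓝 (M * (c - c))) :=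
        Tendsto.mono_left (Continuous.tendsto (by fun_prop) c) nhdsWithin_le_nhds
      simpa using h1.mul h2
    refine squeeze_zero' ?_ ?_ hlim <;>
      filter_upwards [Ioo_mem_nhdsGT hy.1] with x hx
    all_goals
      obtain ⟨b1, b2⟩ := hbd x hx
      have hux : 0 < u x ^ q := rpow_pos_of_pos (hu x ⟨hx.1, (hx.2.trans hy.2).le⟩) q
      have hvx : 0 ≤ v x ^ (q + 1) :=
        rpow_nonneg (k.nonneg ⟨hc.trans hx.1.le, hx.2.le.trans hyL⟩) _
    · positivity
    · refine mul_le_mul_of_nonneg_left ?_ hvx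
      rw [div_le_iff₀ hux]
      linarith
  · have hc0 : c = 0 := by
      by_contra hne
      exact huc' (h.deriv_eq_zero ⟨lt_of_le_of_ne hc (Ne.symm hne), hcL⟩ huc)
    subst hc0
    have hv0 : v 0 = 0 := k.2.2.2.2.1
    have hr : Tendsto (fun x => v x / u x) (𝓝[>] 0) (𝓝 (v' 0 / u' 0)) := by
      refine ((k.tendsto_div_zero hcL).div (h.tendsto_div_zero hcL) huc').congr' ?_
      filter_upwards [self_mem_nhdsWithin] with x hx
      exact div_div_div_cancel_right₀ (ne_of_gt hx) _ _
    have hlim := ((hr.rpow_const (p := q) (Or.inr hq.1.le)).mul tv).mul tu'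
    rw [hv0, mul_zero, zero_mul] at hlim
    refine hlim.congr' ?_
    filter_upwards [Ioo_mem_nhdsGT hcx] with x hx
    have hux := hu x (Ioo_subset_Ioc_self hx)
    have hvx : 0 ≤ v x := k.nonneg ⟨hx.1.le, (hx.2.trans hx₀.1.2).le⟩
    rw [div_rpow hvx hux.le, rpow_add_one' hvx (by linarith [hq.1])]
    ring

lemma mul_deriv_nonneg (h : DirichletSolution L q a u u' u'')
    (k : DirichletSolution L q a v v' v'') (hS : (positivitySet L a).OrdConnected)
    {c x₀ : ℝ} (hc : 0 ≤ c) (hcx : c < x₀) (hx₀ : x₀ ∈ positivitySet L a) (huc : u c = 0)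
    (hu : 0 < u x₀) : 0 ≤ v c * v' c := by
  have hcL : c < L := hcx.trans hx₀.1.2
  rcases hc.eq_or_lt with rfl | hc0
  · simp [k.2.2.2.2.1]
  have hvc := k.nonneg ⟨hc, hcL.le⟩
  by_contra! hneg
  have hvpos : 0 < v c := lt_of_le_of_ne hvc (by rintro h0; rw [← h0] at hneg; simp at hneg)
  have hd : v' c < 0 := by by_contra! hh; exact absurd (mul_nonneg hvc hh) hneg.not_ge
  obtain ⟨y, hy, hay⟩ := h.exists_nonpos_of_deriv_eq_zero hc hcx hx₀ huc
    (h.deriv_eq_zero ⟨hc0, hcL⟩ huc) hu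
  have hmono := k.monotoneOn_deriv le_rfl hcL.le fun x hx =>
    nonpos_of_lt_nonpos hS hx₀ hy.2.le hay ⟨hx.1, hx.2.trans hy.1⟩
  have hanti := k.antitoneOn_of_nonpos le_rfl hcL.le (t := c) fun x hx =>
    (hmono (Ioo_subset_Icc_self hx) ⟨hc, le_rfl⟩ hx.2.le).trans hd.le
  have := hanti ⟨le_rfl, hc⟩ ⟨hc, le_rfl⟩ hc
  rw [k.2.2.2.2.1] at this
  linarith

lemma tendsto_piconeFlux (h : DirichletSolution L q a u u' u'')
    (k : DirichletSolution L q a v v' v'') (hq : q ∈ Ioo (0 : ℝ) 1)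
    (ha : ContinuousOn a (Icc 0 L)) (hS : (positivitySet L a).OrdConnected)
    {c x₀ : ℝ} (hc : 0 ≤ c) (hcx : c < x₀) (hx₀ : x₀ ∈ positivitySet L a) (huc : u c = 0)
    (hu : ∀ x ∈ Ioc c x₀, 0 < u x) (hv : ∀ x ∈ Ioc c x₀, 0 < v x) :
    Tendsto (piconeFlux q u u' v v') (𝓝[>] c) (𝓝 (-(v c * v' c))) := by
  have hcL : c < L := hcx.trans hx₀.1.2
  obtain ⟨tu, tu'⟩ := h.tendsto_right hc hcL
  obtain ⟨tv, tv'⟩ := k.tendsto_right hc hcL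
  have t1 := h.tendsto_flux_term k hq ha hS hc hcx hx₀ huc hu
  have t2 : Tendsto (fun x => u x ^ (q + 1) * (v' x / v x ^ q)) (𝓝[>] c) (𝓝 0) := by
    by_cases hvc : v c = 0
    · exact k.tendsto_flux_term h hq ha hS hc hcx hx₀ hvc hv
    · have := (tu.rpow_const (p := q + 1) (Or.inr (by linarith [hq.1]))).mul
        (tv'.div (tv.rpow_const (p := q) (Or.inr hq.1.le))
          (by rw [Ne, rpow_eq_zero (k.nonneg ⟨hc, hcL.le⟩) hq.1.ne']; exact hvc))
      rwa [huc, zero_rpow (by linarith [hq.1]), zero_mul] at this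
  have t := ((t1.add t2).sub (tu.mul tu')).sub (tv.mul tv')
  rw [huc, zero_mul, add_zero, sub_zero, zero_sub] at t
  refine t.congr' ?_
  filter_upwards [Ioo_mem_nhdsGT hcx] with x hx
  have hux := hu x (Ioo_subset_Ioc_self hx)
  have hvx := hv x (Ioo_subset_Ioc_self hx)
  have := (rpow_pos_of_pos hux q).ne'
  have := (rpow_pos_of_pos hvx q).ne'
  unfold piconeFlux
  rw [rpow_add_one hux.ne', rpow_add_one hvx.ne']
  field_simp
  ring

lemma piconeFlux_nonpos_of_eq_zero (h : DirichletSolution L q a u u' u'')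
    (k : DirichletSolution L q a v v' v'') (hq : q ∈ Ioo (0 : ℝ) 1)
    (ha : ContinuousOn a (Icc 0 L)) (hS : (positivitySet L a).OrdConnected)
    {c x₀ : ℝ} (hc : 0 ≤ c) (hcx : c < x₀) (hx₀ : x₀ ∈ positivitySet L a) (huc : u c = 0)
    (hu : ∀ x ∈ Ioc c x₀, 0 < u x) (hv : ∀ x ∈ Ioc c x₀, 0 < v x) :
    piconeFlux q u u' v v' x₀ ≤ 0 ∧
      (piconeFlux q u u' v v' x₀ = 0 → ∀ x ∈ Icc 0 x₀, u x = v x) := by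
  have hcL : c < L := hcx.trans hx₀.1.2
  set F := piconeFlux q u u' v v' with hF
  have hmem : ∀ x ∈ Ioc c x₀, x ∈ Ioo 0 L := fun x hx =>
    ⟨hc.trans_lt hx.1, hx.2.trans_lt hx₀.1.2⟩
  have hder : ∀ x ∈ Ioc c x₀, ∃ D, HasDerivAt F D x ∧ D ≤ 0 ∧
      (D = 0 → u x = v x ∨ (u' x = 0 ∧ v' x = 0)) := fun x hx =>
    hasDerivAt_piconeFlux hq (hu x hx) (hv x hx) (h.hasDerivAt (hmem x hx))
      (h.hasDerivAt_deriv (hmem x hx)) (k.hasDerivAt (hmem x hx))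
      (k.hasDerivAt_deriv (hmem x hx)) (neg_neg _) (neg_neg _)
  choose! D hD hD0 hDeq using hder
  have hanti : ∀ s ∈ Ioc c x₀, AntitoneOn F (Icc s x₀) := fun s hs =>
    antitoneOn_Icc_of_hasDerivAt
      (fun x hx => (hD x ⟨hs.1.trans_le hx.1, hx.2⟩).continuousAt.continuousWithinAt)
      (fun x hx => hD x ⟨hs.1.trans hx.1, hx.2.le⟩)
      fun x hx => hD0 x ⟨hs.1.trans hx.1, hx.2.le⟩
  have hlim := h.tendsto_piconeFlux k hq ha hS hc hcx hx₀ huc hu hv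
  have hle : ∀ z ∈ Ioc c x₀, F z ≤ 0 := by
    intro z hz
    have h1 : F z ≤ -(v c * v' c) := by
      refine ge_of_tendsto hlim ?_
      filter_upwards [Ioo_mem_nhdsGT hz.1] with x hx
      exact hanti x ⟨hx.1, hx.2.le.trans hz.2⟩ ⟨le_rfl, hx.2.le.trans hz.2⟩ ⟨hx.2.le, hz.2⟩ hx.2.le
    have := h.mul_deriv_nonneg k hS hc hcx hx₀ huc (hu x₀ ⟨hcx, le_rfl⟩)
    linarith
  refine ⟨hle x₀ ⟨hcx, le_rfl⟩, fun h0 => ?_⟩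
  have hzero : ∀ z ∈ Ioc c x₀, F z = 0 := fun z hz =>
    le_antisymm (hle z hz) (h0 ▸ hanti z hz ⟨le_rfl, hz.2⟩ ⟨hz.2, le_rfl⟩ hz.2)
  have halt : ∀ z ∈ Ioo c x₀, u z = v z ∨ (u' z = 0 ∧ v' z = 0) := by
    intro z hz
    refine hDeq z (Ioo_subset_Ioc_self hz) ((hD z (Ioo_subset_Ioc_self hz)).unique ?_)
    refine (hasDerivAt_const z (0 : ℝ)).congr_of_eventuallyEq ?_
    filter_upwards [Ioo_mem_nhds hz.1 hz.2] with t ht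
    exact hzero t (Ioo_subset_Ioc_self ht)
  have hsub : Icc c x₀ ⊆ Icc 0 L := Icc_subset_Icc hc hx₀.1.2.le
  have cu := h.continuousOn.mono hsub
  have cv := k.continuousOn.mono hsub
  have hsq := eqOn_const_Icc_of_hasDerivAt_zero (f := fun x => (u x - v x) ^ 2)
    ((cu.sub cv).pow 2) fun z hz => by
      have hz' := hmem z (Ioo_subset_Ioc_self hz)
      refine (((h.hasDerivAt hz').sub (k.hasDerivAt hz')).pow 2).congr_deriv ?_
      rcases halt z hz with e | ⟨e1, e2⟩
      · simp [e]
      · simp [e1, e2]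
  have huv : ∀ x ∈ Icc c x₀, u x = v x := by
    by_contra! hne
    obtain ⟨w, hw, hwne⟩ := hne
    have hall : ∀ z ∈ Icc c x₀, u z ≠ v z := fun z hz e => by
      have h1 := hsq z hz
      have h2 := hsq w hw
      simp only [e, sub_self] at h1
      rw [← h1] at h2
      apply hwne
      have : u w - v w = 0 := by simpa using h2
      linarith
    have hconst := eqOn_const_Icc_of_hasDerivAt_zero cu fun z hz => by
      have hd := h.hasDerivAt (hmem z (Ioo_subset_Ioc_self hz))
      rcases halt z hz with e | ⟨e1, -⟩
      · exact absurd e (hall z (Ioo_subset_Icc_self hz))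
      · rwa [e1] at hd
    have := hconst x₀ ⟨hcx.le, le_rfl⟩
    have := hu x₀ ⟨hcx, le_rfl⟩
    linarith
  intro x hx
  rcases le_total c x with hcx' | hxc
  · exact huv x ⟨hcx', hx.2⟩
  rcases hc.eq_or_lt with rfl | hc0
  · exact huv x ⟨hx.1, hx.2⟩
  have hvc : v c = 0 := (huv c ⟨le_rfl, hcx.le⟩) ▸ huc
  have hleft : ∀ {w w' w'' : ℝ → ℝ}, DirichletSolution L q a w w' w'' → w c = 0 → 0 < w x₀ →
      w x = 0 := by
    intro w w' w'' hw hwc hwx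
    have hwd := hw.deriv_eq_zero ⟨hc0, hcL⟩ hwc
    obtain ⟨y, hy, hay⟩ := hw.exists_nonpos_of_deriv_eq_zero hc hcx hx₀ hwc hwd hwx
    have hmono := hw.monotoneOn_deriv le_rfl hcL.le fun z hz =>
      nonpos_of_lt_nonpos hS hx₀ hy.2.le hay ⟨hz.1, hz.2.trans hy.1⟩
    have hanti := hw.antitoneOn_of_nonpos le_rfl hcL.le (t := c) fun z hz =>
      (hmono (Ioo_subset_Icc_self hz) ⟨hc, le_rfl⟩ hz.2.le).trans hwd.le
    have := hanti ⟨le_rfl, hc⟩ ⟨hx.1, hxc⟩ hx.1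
    rw [hw.2.2.2.2.1] at this
    exact le_antisymm this (hw.nonneg ⟨hx.1, hxc.trans hcL.le⟩)
  rw [hleft h huc (hu x₀ ⟨hcx, le_rfl⟩), hleft k hvc (hv x₀ ⟨hcx, le_rfl⟩)]

lemma piconeFlux_nonpos (h : DirichletSolution L q a u u' u'')
    (k : DirichletSolution L q a v v' v'') (hq : q ∈ Ioo (0 : ℝ) 1)
    (ha : ContinuousOn a (Icc 0 L)) (hS : (positivitySet L a).OrdConnected)
    {x₀ : ℝ} (hx₀ : x₀ ∈ positivitySet L a) (hu : 0 < u x₀) (hv : 0 < v x₀) :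
    piconeFlux q u u' v v' x₀ ≤ 0 ∧
      (piconeFlux q u u' v v' x₀ = 0 → ∀ x ∈ Icc 0 x₀, u x = v x) := by
  have hsub : Icc 0 x₀ ⊆ Icc 0 L := Icc_subset_Icc_right hx₀.1.2.le
  have hcont : ContinuousOn (fun x => u x * v x) (Icc 0 x₀) :=
    (h.continuousOn.mono hsub).mul (k.continuousOn.mono hsub)
  have hclosed : IsCompact (Icc 0 x₀ ∩ (fun x => u x * v x) ⁻¹' {0}) :=
    isCompact_Icc.of_isClosed_subset (hcont.preimage_isClosed_of_isClosed isClosed_Icc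
      isClosed_singleton) inter_subset_left
  obtain ⟨c, ⟨⟨hc0, hcx⟩, hcz⟩, hmax⟩ := hclosed.exists_isGreatest
    ⟨0, ⟨le_rfl, hx₀.1.1.le⟩, by simp [h.2.2.2.2.1]⟩
  have hcz' : u c * v c = 0 := hcz
  have hne : ∀ x ∈ Ioc c x₀, u x * v x ≠ 0 := fun x hx hz =>
    absurd (hmax ⟨⟨hc0.trans hx.1.le, hx.2⟩, hz⟩) hx.1.not_ge
  have hu' : ∀ x ∈ Ioc c x₀, 0 < u x := fun x hx =>
    lt_of_le_of_ne (h.nonneg (hsub ⟨hc0.trans hx.1.le, hx.2⟩)) (left_ne_zero_of_mul (hne x hx)).symm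
  have hv' : ∀ x ∈ Ioc c x₀, 0 < v x := fun x hx =>
    lt_of_le_of_ne (k.nonneg (hsub ⟨hc0.trans hx.1.le, hx.2⟩)) (right_ne_zero_of_mul (hne x hx)).symm
  have hlt : c < x₀ := lt_of_le_of_ne hcx (by rintro rfl; exact (mul_pos hu hv).ne' hcz')
  rcases mul_eq_zero.1 hcz' with huc | hvc
  · exact h.piconeFlux_nonpos_of_eq_zero k hq ha hS hc0 hlt hx₀ huc hu' hv'
  · have := k.piconeFlux_nonpos_of_eq_zero h hq ha hS hc0 hlt hx₀ hvc hv' hu'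
    rw [piconeFlux_swap] at this
    exact ⟨this.1, fun e x hx => (this.2 e x hx).symm⟩

theorem eqOn (h : DirichletSolution L q a u u' u'')
    (k : DirichletSolution L q a v v' v'') (hq : q ∈ Ioo (0 : ℝ) 1)
    (ha : ContinuousOn a (Icc 0 L)) (hS : (positivitySet L a).OrdConnected)
    (hne : (positivitySet L a).Nonempty) (hu : ∃ x ∈ Icc (0 : ℝ) L, u x ≠ 0)
    (hv : ∃ x ∈ Icc (0 : ℝ) L, v x ≠ 0) : EqOn u v (Icc 0 L) := by
  obtain ⟨x₀, hx₀⟩ := hne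
  have pu := h.pos_of_mem_positivitySet hS hu hx₀
  have pv := k.pos_of_mem_positivitySet hS hv hx₀
  obtain ⟨l1, l2⟩ := h.piconeFlux_nonpos k hq ha hS hx₀ pu pv
  have ha' : ContinuousOn (fun x => a (L - x)) (Icc 0 L) := ha.comp (by fun_prop)
    fun x hx => ⟨by linarith [hx.2], by linarith [hx.1]⟩
  obtain ⟨r1, r2⟩ := h.reflect.piconeFlux_nonpos k.reflect hq ha' (positivitySet_reflect hS)
    (mem_positivitySet_reflect hx₀) (by simpa using pu) (by simpa using pv)
  have e : piconeFlux q (fun x => u (L - x)) (fun x => -u' (L - x)) (fun x => v (L - x))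
      (fun x => -v' (L - x)) (L - x₀) = -piconeFlux q u u' v v' x₀ := by
    simp only [piconeFlux, sub_sub_cancel]
    ring
  rw [e] at r1 r2
  have h0 : piconeFlux q u u' v v' x₀ = 0 := by linarith
  intro x hx
  rcases le_total x x₀ with hle | hle
  · exact l2 h0 x ⟨hx.1, hle⟩
  · simpa using r2 (by rw [h0, neg_zero]) (L - x) ⟨by linarith [hx.2], by linarith⟩

end DirichletSolution

/-! ### Linear boundary value problems -/

section Existence

open Filter Topology MeasureTheory

lemma nonneg_of_hasDerivAt_of_boundary_nonneg {K c d : ℝ} (hK : 0 < K) {w w' h : ℝ → ℝ}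
    (hw : ContinuousOn w (Icc c d))
    (d1 : ∀ x ∈ Ioo c d, HasDerivAt w (w' x) x)
    (d2 : ∀ x ∈ Ioo c d, HasDerivAt w' (K * w x - h x) x)
    (hh : ∀ x ∈ Ioo c d, 0 ≤ h x) (hc : 0 ≤ w c) (hd : 0 ≤ w d) : ∀ x ∈ Icc c d, 0 ≤ w x := by
  rintro y hy
  obtain ⟨x₀, hx₀, hmin⟩ := isCompact_Icc.exists_isMinOn ⟨y, hy⟩ hw
  refine le_trans ?_ (hmin hy)
  by_contra! hneg
  have hxo : x₀ ∈ Ioo c d :=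
    ⟨lt_of_le_of_ne hx₀.1 (by rintro rfl; exact hc.not_gt hneg),
      lt_of_le_of_ne hx₀.2 (by rintro rfl; exact hd.not_gt hneg)⟩
  have hw0 : w' x₀ = 0 :=
    (hmin.isLocalMin (Icc_mem_nhds hxo.1 hxo.2)).hasDerivAt_eq_zero (d1 x₀ hxo)
  have hs := hasDerivAt_iff_tendsto_slope.1 (d2 x₀ hxo)
  have hlt : K * w x₀ - h x₀ < 0 := by
    have := mul_neg_of_pos_of_neg hK hneg
    linarith [hh x₀ hxo]
  have hev : ∀ᶠ x in 𝓝[>] x₀, slope w' x₀ x < 0 :=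
    (hs.eventually_lt_const hlt).filter_mono (nhdsWithin_mono _ fun x hx => ne_of_gt hx)
  obtain ⟨t, ht, hsub⟩ := mem_nhdsGT_iff_exists_Ioo_subset.1
    (hev.and (Ioo_mem_nhdsGT hxo.2))
  rw [mem_Ioi] at ht
  obtain ⟨z, hz⟩ := exists_between ht
  have hzd := (hsub hz).2
  obtain ⟨ξ, hξ, heq⟩ := exists_hasDerivAt_eq_slope w w' hz.1
    (hw.mono (Icc_subset_Icc hx₀.1 hzd.2.le))
    fun x hx => d1 x ⟨hxo.1.trans hx.1, hx.2.trans hzd.2⟩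
  have h1 : 0 ≤ w' ξ := by
    rw [heq]
    exact div_nonneg (sub_nonneg.2 (hmin ⟨hx₀.1.trans hz.1.le, hzd.2.le⟩)) (by linarith [hz.1])
  have h2 := (hsub ⟨hξ.1, hξ.2.trans hz.2⟩).1
  rw [slope_def_field, hw0, sub_zero] at h2
  exact h2.not_ge (div_nonneg h1 (by linarith [hξ.1]))

lemma hasDerivAt_integral_zero {h : ℝ → ℝ} (hh : Continuous h) (x : ℝ) :
    HasDerivAt (fun x => ∫ y in (0 : ℝ)..x, h y) (h x) x :=
  intervalIntegral.integral_hasDerivAt_right (hh.intervalIntegrable _ _)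
    (hh.stronglyMeasurableAtFilter _ _) hh.continuousAt

lemma exists_solution_linear {L K : ℝ} (hL : 0 < L) (hK : 0 < K) {h : ℝ → ℝ} (hh : Continuous h) :
    ∃ w w' : ℝ → ℝ, (∀ x, HasDerivAt w (w' x) x) ∧ (∀ x, HasDerivAt w' (K * w x - h x) x) ∧
      w 0 = 0 ∧ w L = 0 := by
  obtain ⟨k, hk, rfl⟩ : ∃ k : ℝ, 0 < k ∧ K = k ^ 2 := ⟨√K, sqrt_pos.2 hK, (sq_sqrt hK.le).symm⟩
  set P : ℝ → ℝ := fun x => ∫ y in (0 : ℝ)..x, cosh (k * y) * h y with hP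
  set Q : ℝ → ℝ := fun x => ∫ y in (0 : ℝ)..x, sinh (k * y) * h y with hQ
  have dP : ∀ x, HasDerivAt P (cosh (k * x) * h x) x :=
    hasDerivAt_integral_zero (h := fun y => cosh (k * y) * h y) (by fun_prop)
  have dQ : ∀ x, HasDerivAt Q (sinh (k * x) * h x) x :=
    hasDerivAt_integral_zero (h := fun y => sinh (k * y) * h y) (by fun_prop)
  have dk : ∀ x, HasDerivAt (fun x : ℝ => k * x) k x := fun x => by
    simpa using (hasDerivAt_id x).const_mul k
  have ds : ∀ x, HasDerivAt (fun x : ℝ => sinh (k * x)) (cosh (k * x) * k) x := fun x =>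
    (dk x).sinh
  have dc : ∀ x, HasDerivAt (fun x : ℝ => cosh (k * x)) (sinh (k * x) * k) x := fun x =>
    (dk x).cosh
  have hs : 0 < sinh (k * L) := sinh_pos_iff.2 (mul_pos hk hL)
  set A : ℝ := (sinh (k * L) * P L - cosh (k * L) * Q L) / (k * sinh (k * L)) with hA
  refine ⟨fun x => A * sinh (k * x) - (sinh (k * x) * P x - cosh (k * x) * Q x) / k,
    fun x => A * k * cosh (k * x) - (cosh (k * x) * P x - sinh (k * x) * Q x),
    fun x => ?_, fun x => ?_, ?_, ?_⟩
  · refine (((ds x).const_mul A).sub ((((ds x).mul (dP x)).sub ((dc x).mul (dQ x))).div_const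
      k)).congr_deriv ?_
    field_simp
    ring
  · refine (((dc x).const_mul (A * k)).sub (((dc x).mul (dP x)).sub
      ((ds x).mul (dQ x)))).congr_deriv ?_
    have := cosh_sq (k * x)
    field_simp
    linear_combination (-h x) * this
  · simp [hP, hQ]
  · simp only [hA]
    field_simp
    ring

/-- The solution operator of `-w'' = h`, `w 0 = w L = 0`. -/
noncomputable def greenOp (L : ℝ) (h : ℝ → ℝ) (x : ℝ) : ℝ :=
  x * ((L * (∫ y in (0 : ℝ)..L, h y) - ∫ y in (0 : ℝ)..L, y * h y) / L)
    - (x * (∫ y in (0 : ℝ)..x, h y) - ∫ y in (0 : ℝ)..x, y * h y)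

lemma greenOp_zero (L : ℝ) (h : ℝ → ℝ) : greenOp L h 0 = 0 := by simp [greenOp]

lemma greenOp_self {L : ℝ} (hL : 0 < L) (h : ℝ → ℝ) : greenOp L h L = 0 := by
  unfold greenOp
  field_simp
  ring

lemma exists_hasDerivAt_greenOp {L : ℝ} {h : ℝ → ℝ} (hh : Continuous h) :
    ∃ w' : ℝ → ℝ, (∀ x, HasDerivAt (greenOp L h) (w' x) x) ∧ ∀ x, HasDerivAt w' (-h x) x := by
  have dP := hasDerivAt_integral_zero hh
  have dQ := hasDerivAt_integral_zero (h := fun y => y * h y) (by fun_prop)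
  set A := (L * (∫ y in (0 : ℝ)..L, h y) - ∫ y in (0 : ℝ)..L, y * h y) / L with hA
  refine ⟨fun x => A - ∫ y in (0 : ℝ)..x, h y, fun x => ?_, fun x => ?_⟩
  · refine (((hasDerivAt_id x).mul_const A).sub
      (((hasDerivAt_id x).mul (dP x)).sub (dQ x))).congr_deriv ?_
    simp
  · simpa using (dP x).const_sub A

lemma eq_greenOp {L : ℝ} (hL : 0 < L) {h w w' : ℝ → ℝ} (hh : Continuous h)
    (d1 : ∀ x, HasDerivAt w (w' x) x) (d2 : ∀ x, HasDerivAt w' (-h x) x)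
    (h0 : w 0 = 0) (h1 : w L = 0) (x : ℝ) : w x = greenOp L h x := by
  obtain ⟨g', e1, e2⟩ := exists_hasDerivAt_greenOp (L := L) hh
  have hd' : ∀ x y, w' x - g' x = w' y - g' y := by
    refine is_const_of_deriv_eq_zero (f := fun x => w' x - g' x)
      (fun x => ((d2 x).sub (e2 x)).differentiableAt) fun x => ?_
    exact ((d2 x).sub (e2 x)).deriv.trans (sub_self _)
  set m := w' 0 - g' 0 with hm
  have hd : ∀ x y, w x - greenOp L h x - m * x = w y - greenOp L h y - m * y := by
    have hder : ∀ x, HasDerivAt (fun x => w x - greenOp L h x - m * x) 0 x := fun x => by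
      refine (((d1 x).sub (e1 x)).sub ((hasDerivAt_id x).const_mul m)).congr_deriv ?_
      rw [hd' x 0]
      simp [hm]
    exact is_const_of_deriv_eq_zero (fun x => (hder x).differentiableAt) fun x => (hder x).deriv
  have hL0 := hd L 0
  rw [h0, h1, greenOp_self hL, greenOp_zero] at hL0
  have hm0 : m = 0 := by
    have : m * L = 0 := by linarith
    rcases mul_eq_zero.1 this with h | h
    · exact h
    · exact absurd h hL.ne'
  have := hd x 0
  rw [h0, greenOp_zero, hm0] at this
  linarith

lemma greenOp_congr {L x : ℝ} {f h : ℝ → ℝ} (hfh : EqOn f h (Icc 0 L)) (hx : x ∈ Icc 0 L) :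
    greenOp L f x = greenOp L h x := by
  have key : ∀ z ∈ Icc 0 L, (∫ y in (0 : ℝ)..z, f y) = (∫ y in (0 : ℝ)..z, h y) ∧
      (∫ y in (0 : ℝ)..z, y * f y) = ∫ y in (0 : ℝ)..z, y * h y := by
    intro z hz
    have hsub : uIcc 0 z ⊆ Icc 0 L := by rw [uIcc_of_le hz.1]; exact Icc_subset_Icc_right hz.2
    exact ⟨intervalIntegral.integral_congr fun y hy => hfh (hsub hy),
      intervalIntegral.integral_congr fun y hy => by simp only [hfh (hsub hy)]⟩
  obtain ⟨k1, k2⟩ := key x hx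
  obtain ⟨k3, k4⟩ := key L ⟨hx.1.trans hx.2, le_rfl⟩
  unfold greenOp
  rw [k1, k2, k3, k4]

lemma tendsto_greenOp {L B x : ℝ} {F : ℕ → ℝ → ℝ} {f : ℝ → ℝ} (hF : ∀ k, Continuous (F k))
    (hB : ∀ k, ∀ x ∈ Icc 0 L, |F k x| ≤ B)
    (hlim : ∀ x ∈ Icc 0 L, Tendsto (fun k => F k x) atTop (𝓝 (f x))) (hx : x ∈ Icc 0 L) :
    Tendsto (fun k => greenOp L (F k) x) atTop (𝓝 (greenOp L f x)) := by
  have key : ∀ z ∈ Icc 0 L, ∀ p : ℝ → ℝ, Continuous p →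
      Tendsto (fun k => ∫ y in (0 : ℝ)..z, p y * F k y) atTop
        (𝓝 (∫ y in (0 : ℝ)..z, p y * f y)) := by
    intro z hz p hp
    have hsub : uIoc 0 z ⊆ Icc 0 L := by
      rw [uIoc_of_le hz.1]
      exact fun y hy => ⟨hy.1.le, hy.2.trans hz.2⟩
    refine intervalIntegral.tendsto_integral_filter_of_dominated_convergence (fun y => |p y| * B)
      (Eventually.of_forall fun k => (hp.mul (hF k)).aestronglyMeasurable) ?_
      (Continuous.intervalIntegrable (by fun_prop) _ _) ?_
    · refine Eventually.of_forall fun k => Eventually.of_forall fun y hy => ?_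
      rw [norm_mul, norm_eq_abs, norm_eq_abs]
      exact mul_le_mul_of_nonneg_left (hB k y (hsub hy)) (abs_nonneg _)
    · exact Eventually.of_forall fun y hy => (hlim y (hsub hy)).const_mul (p y)
  have hLm : L ∈ Icc 0 L := ⟨hx.1.trans hx.2, le_rfl⟩
  have one : ∀ z ∈ Icc 0 L, Tendsto (fun k => ∫ y in (0 : ℝ)..z, F k y) atTop
        (𝓝 (∫ y in (0 : ℝ)..z, f y)) := fun z hz => by
    simpa using key z hz (fun _ => 1) continuous_const
  have id' : ∀ z ∈ Icc 0 L, Tendsto (fun k => ∫ y in (0 : ℝ)..z, y * F k y) atTop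
        (𝓝 (∫ y in (0 : ℝ)..z, y * f y)) := fun z hz => key z hz (fun y => y) continuous_id
  exact (((((one L hLm).const_mul L).sub (id' L hLm)).div_const L).const_mul x).sub
    (((one x hx).const_mul x).sub (id' x hx))

lemma continuousOn_greenOp {L B : ℝ} (hL : 0 < L) {F : ℕ → ℝ → ℝ} {f : ℝ → ℝ}
    (hF : ∀ k, Continuous (F k)) (hB : ∀ k, ∀ x ∈ Icc 0 L, |F k x| ≤ B)
    (hlim : ∀ x ∈ Icc 0 L, Tendsto (fun k => F k x) atTop (𝓝 (f x))) :
    ContinuousOn (greenOp L f) (Icc 0 L) := by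
  have hmeas : AEStronglyMeasurable f (volume.restrict (Icc 0 L)) :=
    aestronglyMeasurable_of_tendsto_ae atTop (fun k => (hF k).aestronglyMeasurable)
      ((ae_restrict_mem measurableSet_Icc).mono hlim)
  have hfB : ∀ x ∈ Icc 0 L, |f x| ≤ B := fun x hx =>
    le_of_tendsto (hlim x hx).abs (Eventually.of_forall fun k => hB k x hx)
  have hfin : volume (Icc 0 L) < ⊤ := by simp
  have hfint : IntegrableOn f (Icc 0 L) :=
    IntegrableOn.of_bound hfin hmeas B ((ae_restrict_mem measurableSet_Icc).mono hfB)
  have hfint' : IntegrableOn (fun y => y * f y) (Icc 0 L) :=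
    hfint.continuousOn_mul continuousOn_id isCompact_Icc
  have c1 : ContinuousOn (fun x => ∫ y in (0 : ℝ)..x, f y) (Icc 0 L) := by
    rw [← uIcc_of_le hL.le] at hfint ⊢
    exact intervalIntegral.continuousOn_primitive_interval hfint
  have c2 : ContinuousOn (fun x => ∫ y in (0 : ℝ)..x, y * f y) (Icc 0 L) := by
    rw [← uIcc_of_le hL.le] at hfint' ⊢
    exact intervalIntegral.continuousOn_primitive_interval hfint'
  exact (continuousOn_id.mul continuousOn_const).sub ((continuousOn_id.mul c1).sub c2)

/-- `u` is a classical solution of `-u'' = g(x, u)` on `[0, L]`, `u 0 = u L = 0`, extended as a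
twice continuously differentiable function to the whole line. -/
def IsBVPSolution (L : ℝ) (g : ℝ → ℝ → ℝ) (u : ℝ → ℝ) : Prop :=
  ∃ u' h : ℝ → ℝ, Continuous h ∧ (∀ x, HasDerivAt u (u' x) x) ∧ (∀ x, HasDerivAt u' (-h x) x) ∧
    u 0 = 0 ∧ u L = 0 ∧ ∀ x ∈ Icc 0 L, h x = g x (u x)

lemma exists_isBVPSolution_of_tendsto {L B : ℝ} (hL : 0 < L) {g : ℝ → ℝ → ℝ}
    (hg : Continuous fun p : ℝ × ℝ => g p.1 p.2) {U U' F : ℕ → ℝ → ℝ} {w : ℝ → ℝ}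
    (hF : ∀ k, Continuous (F k)) (d1 : ∀ k x, HasDerivAt (U k) (U' k x) x)
    (d2 : ∀ k x, HasDerivAt (U' k) (-F k x) x) (b0 : ∀ k, U k 0 = 0) (b1 : ∀ k, U k L = 0)
    (hB : ∀ k, ∀ x ∈ Icc 0 L, |F k x| ≤ B)
    (hU : ∀ x ∈ Icc 0 L, Tendsto (fun k => U k x) atTop (𝓝 (w x)))
    (hlim : ∀ x ∈ Icc 0 L, Tendsto (fun k => F k x) atTop (𝓝 (g x (w x)))) :
    ∃ v, IsBVPSolution L g v ∧ EqOn v w (Icc 0 L) := by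
  have hw : ∀ x ∈ Icc 0 L, w x = greenOp L (fun x => g x (w x)) x := fun x hx => by
    refine tendsto_nhds_unique (hU x hx) ?_
    refine (tendsto_greenOp hF hB hlim hx).congr fun k => ?_
    exact (eq_greenOp hL (hF k) (d1 k) (d2 k) (b0 k) (b1 k) x).symm
  have hwc : ContinuousOn w (Icc 0 L) := (continuousOn_greenOp hL hF hB hlim).congr hw
  have hfc : ContinuousOn (fun x => g x (w x)) (Icc 0 L) :=
    hg.comp_continuousOn (continuousOn_id.prodMk hwc)
  set h : ℝ → ℝ := IccExtend hL.le ((Icc 0 L).domRestrict fun x => g x (w x)) with hh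
  have hc : Continuous h := (continuousOn_iff_continuous_domRestrict.1 hfc).Icc_extend'
  have heq : EqOn (fun x => g x (w x)) h (Icc 0 L) := fun x hx => by
    rw [hh, IccExtend_of_mem hL.le _ hx, domRestrict_apply]
  have hvw : EqOn (greenOp L h) w (Icc 0 L) := fun x hx => by
    rw [hw x hx, greenOp_congr heq hx]
  obtain ⟨v', e1, e2⟩ := exists_hasDerivAt_greenOp (L := L) hc
  refine ⟨greenOp L h, ⟨v', h, hc, e1, e2, greenOp_zero L h, greenOp_self hL h, fun x hx => ?_⟩,
    hvw⟩
  rw [hvw hx]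
  exact (heq hx).symm

end Existence

/-! ### Monotone iteration -/

section MonotoneIteration

open Filter Topology

/-- Monotone iteration between `0` and the supersolution `C * x * (L - x)`; the solution obtained
dominates every nonnegative subsolution below that supersolution. -/
lemma exists_maximal_isBVPSolution {L K C B : ℝ} (hL : 0 < L) (hK : 0 < K) (hC : 0 < C)
    {g : ℝ → ℝ → ℝ} (hg : Continuous fun p : ℝ × ℝ => g p.1 p.2)
    (hg0 : ∀ x ∈ Icc 0 L, g x 0 = 0)
    (hmono : ∀ x ∈ Icc 0 L, ∀ s t, 0 ≤ s → s ≤ t → g x s + K * s ≤ g x t + K * t)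
    (hsup : ∀ x ∈ Icc 0 L, g x (C * x * (L - x)) ≤ 2 * C)
    (hbd : ∀ x ∈ Icc 0 L, ∀ t, 0 ≤ t → t ≤ C * x * (L - x) → |g x t| ≤ B) :
    ∃ v, IsBVPSolution L g v ∧ (∀ x ∈ Icc 0 L, 0 ≤ v x ∧ v x ≤ C * x * (L - x)) ∧
      ∀ (c d : ℝ) (ψ ψ' ψ'' : ℝ → ℝ), 0 ≤ c → d ≤ L → ContinuousOn ψ (Icc c d) →
        (∀ x ∈ Ioo c d, HasDerivAt ψ (ψ' x) x) → (∀ x ∈ Ioo c d, HasDerivAt ψ' (-ψ'' x) x) →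
        (∀ x ∈ Ioo c d, ψ'' x ≤ g x (ψ x)) →
        (∀ x ∈ Icc c d, 0 ≤ ψ x ∧ ψ x ≤ C * x * (L - x)) → ψ c = 0 → ψ d = 0 →
        ∀ x ∈ Icc c d, ψ x ≤ v x := by
  have hstep : ∀ u : ℝ → ℝ, Continuous u → ∃ w w' : ℝ → ℝ, (∀ x, HasDerivAt w (w' x) x) ∧
      (∀ x, HasDerivAt w' (K * w x - (g x (u x) + K * u x)) x) ∧ w 0 = 0 ∧ w L = 0 :=
    fun u hu => exists_solution_linear hL hK
      ((hg.comp (continuous_id.prodMk hu)).add (continuous_const.mul hu))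
  choose! T T' hT1 hT2 hT3 hT4 using hstep
  set U₀ : ℝ → ℝ := fun x => C * x * (L - x) with hU₀
  set U : ℕ → ℝ → ℝ := fun k => T^[k] U₀ with hU
  have hsucc : ∀ k, U (k + 1) = T (U k) := fun k => Function.iterate_succ_apply' T k U₀
  have hUc : ∀ k, Continuous (U k) := by
    intro k
    induction k with
    | zero => simp only [hU, hU₀, Function.iterate_zero, id]; fun_prop
    | succ k ih =>
      rw [hsucc]
      exact continuous_iff_continuousAt.2 fun x => (hT1 _ ih x).continuousAt
  have d1 : ∀ k x, HasDerivAt (U (k + 1)) (T' (U k) x) x := fun k x => by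
    rw [hsucc]; exact hT1 _ (hUc k) x
  have d2 : ∀ k x, HasDerivAt (T' (U k)) (K * U (k + 1) x - (g x (U k x) + K * U k x)) x :=
    fun k x => by rw [hsucc]; exact hT2 _ (hUc k) x
  have b0 : ∀ k, U (k + 1) 0 = 0 := fun k => by rw [hsucc]; exact hT3 _ (hUc k)
  have b1 : ∀ k, U (k + 1) L = 0 := fun k => by rw [hsucc]; exact hT4 _ (hUc k)
  have hU₀nn : ∀ x ∈ Icc 0 L, 0 ≤ U₀ x := fun x hx =>
    mul_nonneg (mul_nonneg hC.le hx.1) (sub_nonneg.2 hx.2)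
  have e0 : ∀ x, HasDerivAt U₀ (C * L - 2 * C * x) x := fun x => by
    refine (((hasDerivAt_id x).const_mul C).mul ((hasDerivAt_id x).const_sub L)).congr_deriv ?_
    simp only [id]
    ring
  have e1 : ∀ x, HasDerivAt (fun x => C * L - 2 * C * x) (-(2 * C)) x := fun x => by
    simpa using ((hasDerivAt_id x).const_mul (2 * C)).const_sub (C * L)
  have hnn : ∀ k, ∀ x ∈ Icc 0 L, 0 ≤ U k x := by
    intro k
    induction k with
    | zero => exact hU₀nn
    | succ k ih =>
      refine nonneg_of_hasDerivAt_of_boundary_nonneg hK (hUc _).continuousOn (fun x _ => d1 k x)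
        (fun x _ => d2 k x) (fun x hx => ?_) (b0 k).ge (b1 k).ge
      have hx' := Ioo_subset_Icc_self hx
      have := hmono x hx' 0 _ le_rfl (ih x hx')
      rwa [hg0 x hx', mul_zero, add_zero] at this
  have hdec : ∀ k, ∀ x ∈ Icc 0 L, U (k + 1) x ≤ U k x := by
    intro k
    induction k with
    | zero =>
      intro x hx
      refine sub_nonneg.1 (nonneg_of_hasDerivAt_of_boundary_nonneg hK
        (w := fun x => U 0 x - U 1 x) (h := fun x => 2 * C - g x (U₀ x))
        ((hUc 0).sub (hUc 1)).continuousOn (fun x _ => (e0 x).sub (d1 0 x)) (fun x _ => ?_)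
        (fun x hx => ?_) ?_ ?_ x hx)
      · refine ((e1 x).sub (d2 0 x)).congr_deriv ?_
        simp only [hU, Function.iterate_zero, id]
        ring
      · exact sub_nonneg.2 (hsup x (Ioo_subset_Icc_self hx))
      · rw [show U 1 0 = 0 from b0 0, sub_zero]
        exact hnn 0 0 ⟨le_rfl, hL.le⟩
      · rw [show U 1 L = 0 from b1 0, sub_zero]
        exact hnn 0 L ⟨hL.le, le_rfl⟩
    | succ k ih =>
      intro x hx
      refine sub_nonneg.1 (nonneg_of_hasDerivAt_of_boundary_nonneg hK
        (w := fun x => U (k + 1) x - U (k + 1 + 1) x)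
        (h := fun x => (g x (U k x) + K * U k x) - (g x (U (k + 1) x) + K * U (k + 1) x))
        ((hUc _).sub (hUc _)).continuousOn (fun x _ => (d1 k x).sub (d1 (k + 1) x)) (fun x _ => ?_)
        (fun x hx => ?_) ?_ ?_ x hx)
      · exact ((d2 k x).sub (d2 (k + 1) x)).congr_deriv (by ring)
      · have hx' := Ioo_subset_Icc_self hx
        exact sub_nonneg.2 (hmono x hx' _ _ (hnn _ x hx') (ih x hx'))
      · simp [b0]
      · simp [b1]
  have hanti : ∀ x ∈ Icc 0 L, Antitone fun k => U k x := fun x hx =>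
    antitone_nat_of_succ_le fun k => hdec k x hx
  have hle : ∀ k, ∀ x ∈ Icc 0 L, U k x ≤ U₀ x := fun k x hx => hanti x hx (Nat.zero_le k)
  set w : ℝ → ℝ := fun x => ⨅ k, U k x with hw
  have hlim : ∀ x ∈ Icc 0 L, Tendsto (fun k => U k x) atTop (𝓝 (w x)) := fun x hx =>
    tendsto_atTop_ciInf (hanti x hx) ⟨0, by rintro _ ⟨k, rfl⟩; exact hnn k x hx⟩
  have hU₀B : ∀ x ∈ Icc 0 L, U₀ x ≤ C * L * L := fun x hx => by
    have h1 : C * x ≤ C * L := mul_le_mul_of_nonneg_left hx.2 hC.le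
    exact mul_le_mul h1 (by linarith [hx.1]) (by linarith [hx.2]) (by positivity)
  obtain ⟨v, hv, hvw⟩ := exists_isBVPSolution_of_tendsto (B := B + K * (C * L * L)) hL hg
    (U := fun k => U (k + 1)) (U' := fun k => T' (U k))
    (F := fun k x => g x (U k x) + K * (U k x - U (k + 1) x)) (w := w)
    (fun k => (hg.comp (continuous_id.prodMk (hUc k))).add
      (continuous_const.mul ((hUc k).sub (hUc (k + 1)))))
    d1 (fun k x => (d2 k x).congr_deriv (by ring)) b0 b1
    (fun k x hx => by
      refine (abs_add_le _ _).trans (add_le_add (hbd x hx _ (hnn k x hx) (hle k x hx)) ?_)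
      rw [abs_mul, abs_of_pos hK, abs_of_nonneg (sub_nonneg.2 (hdec k x hx))]
      refine mul_le_mul_of_nonneg_left ?_ hK.le
      linarith [hnn (k + 1) x hx, hle k x hx, hU₀B x hx])
    (fun x hx => (tendsto_add_atTop_iff_nat 1).2 (hlim x hx))
    (fun x hx => by
      have hgx : Continuous (g x) := hg.comp (continuous_const.prodMk continuous_id)
      have := ((hgx.tendsto _).comp (hlim x hx)).add
        (((hlim x hx).sub ((tendsto_add_atTop_iff_nat 1).2 (hlim x hx))).const_mul K)
      simpa using this)
  refine ⟨v, hv, fun x hx => ?_, ?_⟩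
  · rw [hvw hx]
    exact ⟨ge_of_tendsto (hlim x hx) (Eventually.of_forall fun k => hnn k x hx),
      le_of_tendsto (hlim x hx) (Eventually.of_forall fun k => hle k x hx)⟩
  · intro c d ψ ψ' ψ'' hc hd hψc p1 p2 hsub hψ hψ0 hψ1
    have hcd : Icc c d ⊆ Icc 0 L := Icc_subset_Icc hc hd
    have hψU : ∀ k, ∀ x ∈ Icc c d, ψ x ≤ U k x := by
      intro k
      induction k with
      | zero => exact fun x hx => (hψ x hx).2
      | succ k ih =>
        intro x hx
        have hne : c ≤ d := hx.1.trans hx.2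
        refine sub_nonneg.1 (nonneg_of_hasDerivAt_of_boundary_nonneg hK
          (w := fun x => U (k + 1) x - ψ x)
          (h := fun x => (g x (U k x) + K * U k x) - K * ψ x - ψ'' x)
          ((hUc _).continuousOn.sub hψc) (fun x hx => (d1 k x).sub (p1 x hx))
          (fun x hx => ((d2 k x).sub (p2 x hx)).congr_deriv (by ring)) (fun x hx => ?_) ?_ ?_ x hx)
        · have hx' := Ioo_subset_Icc_self hx
          have := hmono x (hcd hx') _ _ (hψ x hx').1 (ih x hx')
          linarith [hsub x hx]
        · rw [hψ0, sub_zero]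
          exact hnn _ c (hcd ⟨le_rfl, hne⟩)
        · rw [hψ1, sub_zero]
          exact hnn _ d (hcd ⟨hne, le_rfl⟩)
    intro x hx
    rw [hvw (hcd hx)]
    exact ge_of_tendsto (hlim x (hcd hx)) (Eventually.of_forall fun k => hψU k x hx)

end MonotoneIteration

/-! ### Existence of a nontrivial solution -/

section Truncation

open Filter Topology

/-- A truncation of `t ^ q` from below that is Lipschitz at `0`. -/
noncomputable def truncPow (q : ℝ) (n : ℕ) (t : ℝ) : ℝ := min (t ^ q) ((n + 1) * t)

lemma truncPow_nonneg {q t : ℝ} (n : ℕ) (ht : 0 ≤ t) : 0 ≤ truncPow q n t :=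
  le_min (rpow_nonneg ht q) (by positivity)

lemma truncPow_le_rpow (q : ℝ) (n : ℕ) (t : ℝ) : truncPow q n t ≤ t ^ q := min_le_left _ _

lemma truncPow_le_truncPow_succ (q : ℝ) (n : ℕ) {t : ℝ} (ht : 0 ≤ t) :
    truncPow q n t ≤ truncPow q (n + 1) t := by
  refine min_le_min le_rfl (mul_le_mul_of_nonneg_right ?_ ht)
  push_cast
  linarith

lemma continuous_truncPow {q : ℝ} (hq : 0 ≤ q) (n : ℕ) : Continuous (truncPow q n) :=
  (continuous_rpow_const hq).min (continuous_const.mul continuous_id)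

lemma mul_sub_truncPow_le {q s t : ℝ} (hq : q ≤ 1) (n : ℕ) (hs : 0 ≤ s) (hst : s ≤ t) :
    (n + 1) * s - truncPow q n s ≤ (n + 1) * t - truncPow q n t := by
  have hright : truncPow q n t ≤ (n + 1) * t := min_le_right _ _
  rcases le_or_gt ((n + 1) * s) (s ^ q) with h | h
  · rw [truncPow, min_eq_right h]
    linarith
  · rcases hs.eq_or_lt with rfl | hs
    · rw [mul_zero] at h
      exact absurd h (rpow_nonneg le_rfl q).not_gt
    have hr : 1 ≤ t / s := (one_le_div hs).2 hst
    have ht : t = s * (t / s) := by field_simp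
    have hpow : t ^ q ≤ s ^ q * (t / s) := by
      conv_lhs => rw [ht, mul_rpow hs.le (by linarith)]
      refine mul_le_mul_of_nonneg_left ?_ (rpow_nonneg hs.le q)
      simpa using rpow_le_rpow_of_exponent_le hr hq
    have h1 : ((n + 1) * s - s ^ q) * 1 ≤ ((n + 1) * s - s ^ q) * (t / s) :=
      mul_le_mul_of_nonneg_left hr (sub_nonneg.2 h.le)
    have h2 : ((n : ℝ) + 1) * s * (t / s) = (n + 1) * t := by field_simp
    have h3 : truncPow q n s = s ^ q := min_eq_left h.le
    have h4 := truncPow_le_rpow q n t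
    rw [h3]
    nlinarith

lemma tendsto_truncPow {q w : ℝ} (hq : 0 < q) {v : ℕ → ℝ} (hw : 0 ≤ w) (hwv : ∀ n, w ≤ v n)
    (hv : Tendsto v atTop (𝓝 w)) : Tendsto (fun n => truncPow q n (v n)) atTop (𝓝 (w ^ q)) := by
  have hpow : Tendsto (fun n => v n ^ q) atTop (𝓝 (w ^ q)) :=
    ((continuous_rpow_const hq.le).tendsto w).comp hv
  rcases hw.eq_or_lt with rfl | hw
  · rw [zero_rpow hq.ne'] at hpow ⊢
    exact squeeze_zero (fun n => truncPow_nonneg n (hwv n)) (fun n => truncPow_le_rpow q n _) hpow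
  · refine hpow.congr' ?_
    have hN : Tendsto (fun n : ℕ => ((n : ℝ) + 1) * w) atTop atTop :=
      (tendsto_atTop_add_const_right _ _ tendsto_natCast_atTop_atTop).atTop_mul_const hw
    filter_upwards [hpow.eventually_lt_const (lt_add_one (w ^ q)),
      hN.eventually_ge_atTop (w ^ q + 1)] with n h1 h2
    refine (min_eq_left ?_).symm
    have : ((n : ℝ) + 1) * w ≤ (n + 1) * v n := mul_le_mul_of_nonneg_left (hwv n) (by positivity)
    linarith

/-- The reaction term `α(x) t ^ q` with the power in its negative part truncated. -/
noncomputable def truncReaction (q : ℝ) (α : ℝ → ℝ) (n : ℕ) (x t : ℝ) : ℝ :=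
  max (α x) 0 * t ^ q - max (-α x) 0 * truncPow q n t

lemma max_sub_max_neg (y : ℝ) : max y 0 - max (-y) 0 = y := by
  rcases le_total y 0 with h | h
  · rw [max_eq_right h, max_eq_left (by linarith)]; ring
  · rw [max_eq_left h, max_eq_right (by linarith)]; ring

lemma exists_subsolution {L q C x₀ : ℝ} (hq : q ∈ Ioo (0 : ℝ) 1) (hC : 0 < C) {α : ℝ → ℝ}
    (hα : Continuous α) (hx₀ : x₀ ∈ Ioo 0 L) (hpos : 0 < α x₀) :
    ∃ (c d : ℝ) (ψ ψ' ψ'' : ℝ → ℝ), 0 ≤ c ∧ d ≤ L ∧ x₀ ∈ Icc c d ∧ 0 < ψ x₀ ∧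
      (∀ x, HasDerivAt ψ (ψ' x) x) ∧ (∀ x, HasDerivAt ψ' (-ψ'' x) x) ∧
      (∀ x ∈ Icc c d, 0 ≤ α x ∧ ψ'' x ≤ α x * ψ x ^ q) ∧
      (∀ x ∈ Icc c d, 0 ≤ ψ x ∧ ψ x ≤ C * x * (L - x)) ∧ ψ c = 0 ∧ ψ d = 0 := by
  obtain ⟨ε, hε, hball⟩ := Metric.nhds_basis_closedBall.mem_iff.1 (inter_mem
    (Ioo_mem_nhds hx₀.1 hx₀.2) (hα.continuousAt.eventually (lt_mem_nhds (half_lt_self hpos))))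
  rw [closedBall_eq_Icc] at hball
  set m := α x₀ / 2 with hm
  have hm0 : 0 < m := half_pos hpos
  have hc : 0 < x₀ - ε := (hball ⟨le_rfl, by linarith⟩).1.1
  have hd : x₀ + ε < L := (hball ⟨by linarith, le_rfl⟩).1.2
  set ω := π / (2 * ε) with hω
  have hω0 : 0 < ω := by positivity
  have hωε : ω * (2 * ε) = π := by rw [hω]; field_simp
  have h1q : 0 < 1 - q := sub_pos.2 hq.2
  set A := min ((m / ω ^ 2) ^ (1 / (1 - q))) (C * (x₀ - ε) * (L - (x₀ + ε))) with hA
  have hA0 : 0 < A := lt_min (by positivity) (mul_pos (mul_pos hC hc) (sub_pos.2 hd))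
  have hAω : A * ω ^ 2 ≤ m * A ^ q := by
    have h1 : A ^ (1 - q) ≤ m / ω ^ 2 := by
      refine (rpow_le_rpow hA0.le (min_le_left _ _) h1q.le).trans_eq ?_
      rw [← rpow_mul (by positivity), one_div_mul_cancel h1q.ne', rpow_one]
    have h2 : A = A ^ (1 - q) * A ^ q := by
      rw [← rpow_add hA0, sub_add_cancel, rpow_one]
    rw [le_div_iff₀ (by positivity)] at h1
    have := mul_le_mul_of_nonneg_right h1 (rpow_nonneg hA0.le q)
    calc A * ω ^ 2 = A ^ (1 - q) * ω ^ 2 * A ^ q := by linear_combination ω ^ 2 * h2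
      _ ≤ _ := this
  have dl : ∀ x, HasDerivAt (fun x => ω * (x - (x₀ - ε))) ω x := fun x => by
    simpa using ((hasDerivAt_id x).sub_const (x₀ - ε)).const_mul ω
  have hsin : ∀ x ∈ Icc (x₀ - ε) (x₀ + ε), 0 ≤ sin (ω * (x - (x₀ - ε))) := fun x hx => by
    refine sin_nonneg_of_nonneg_of_le_pi (mul_nonneg hω0.le (by linarith [hx.1])) ?_
    rw [← hωε]
    exact mul_le_mul_of_nonneg_left (by linarith [hx.2]) hω0.le
  refine ⟨x₀ - ε, x₀ + ε, fun x => A * sin (ω * (x - (x₀ - ε))),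
    fun x => A * (cos (ω * (x - (x₀ - ε))) * ω), fun x => A * ω ^ 2 * sin (ω * (x - (x₀ - ε))),
    hc.le, hd.le, ⟨by linarith, by linarith⟩, ?_, fun x => (dl x).sin.const_mul A,
    fun x => (((dl x).cos.mul_const ω).const_mul A).congr_deriv (by ring), fun x hx => ?_,
    fun x hx => ?_, by simp, ?_⟩
  · beta_reduce
    rw [show ω * (x₀ - (x₀ - ε)) = π / 2 by linear_combination hωε / 2, sin_pi_div_two]
    simpa using hA0
  · have hαx : m < α x := (hball hx).2
    refine ⟨(hm0.trans hαx).le, ?_⟩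
    set s := sin (ω * (x - (x₀ - ε))) with hs
    have hs0 : 0 ≤ s := hsin x hx
    have hsq : s ≤ s ^ q := by
      simpa using rpow_le_rpow_of_exponent_ge_of_imp hs0 (sin_le_one _) hq.2.le
        fun _ h => absurd h one_ne_zero
    have hsq0 : 0 ≤ s ^ q := rpow_nonneg hs0 q
    have hAq : 0 ≤ A ^ q := rpow_nonneg hA0.le q
    calc A * ω ^ 2 * s ≤ A * ω ^ 2 * s ^ q := mul_le_mul_of_nonneg_left hsq (by positivity)
      _ ≤ m * A ^ q * s ^ q := mul_le_mul_of_nonneg_right hAω hsq0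
      _ ≤ α x * A ^ q * s ^ q := by gcongr
      _ = α x * (A * s) ^ q := by rw [mul_rpow hA0.le hs0, mul_assoc]
  · refine ⟨mul_nonneg hA0.le (hsin x hx), ?_⟩
    calc A * sin (ω * (x - (x₀ - ε))) ≤ A := mul_le_of_le_one_right hA0.le (sin_le_one _)
      _ ≤ C * (x₀ - ε) * (L - (x₀ + ε)) := min_le_right _ _
      _ ≤ C * x * (L - x) := by
        refine mul_le_mul (mul_le_mul_of_nonneg_left hx.1 hC.le) (by linarith [hx.2])
          (by linarith) (mul_nonneg hC.le (hc.le.trans hx.1))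
  · beta_reduce
    rw [show ω * (x₀ + ε - (x₀ - ε)) = π by linear_combination hωε, sin_pi, mul_zero]

lemma exists_nontrivial_isBVPSolution {L q x₀ : ℝ} (hL : 0 < L) (hq : q ∈ Ioo (0 : ℝ) 1)
    {α : ℝ → ℝ} (hα : Continuous α) (hx₀ : x₀ ∈ Ioo 0 L) (hpos : 0 < α x₀) :
    ∃ v, IsBVPSolution L (fun x t => α x * t ^ q) v ∧ (∀ x ∈ Icc 0 L, 0 ≤ v x) ∧ 0 < v x₀ := by
  obtain ⟨M, hM⟩ := isCompact_Icc.exists_bound_of_continuousOn (s := Icc 0 L) hα.continuousOn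
  have hM0 : 0 < M := hpos.trans_le ((le_abs_self _).trans (hM x₀ (Ioo_subset_Icc_self hx₀)))
  have h1q : 0 < 1 - q := sub_pos.2 hq.2
  have hmax : ∀ x ∈ Icc 0 L, max (α x) 0 ≤ M ∧ max (-α x) 0 ≤ M := fun x hx =>
    ⟨max_le ((le_abs_self _).trans (hM x hx)) hM0.le,
      max_le ((neg_le_abs _).trans (hM x hx)) hM0.le⟩
  set C := (M * (L * L) ^ q) ^ (1 / (1 - q)) with hC
  have hC0 : 0 < C := by positivity
  have hCM : M * (C * (L * L)) ^ q = C := by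
    have h1 : C ^ (1 - q) = M * (L * L) ^ q := by
      rw [hC, ← rpow_mul (by positivity), one_div_mul_cancel h1q.ne', rpow_one]
    have h2 : C = C ^ (1 - q) * C ^ q := by rw [← rpow_add hC0, sub_add_cancel, rpow_one]
    rw [mul_rpow hC0.le (by positivity)]
    linear_combination (-C ^ q) * h1 - h2
  have hpowle : ∀ x ∈ Icc 0 L, ∀ t, 0 ≤ t → t ≤ C * x * (L - x) → M * t ^ q ≤ C := by
    intro x hx t ht0 ht
    refine le_trans (mul_le_mul_of_nonneg_left (rpow_le_rpow ht0 ?_ hq.1.le) hM0.le) hCM.le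
    refine ht.trans ?_
    rw [mul_assoc]
    exact mul_le_mul_of_nonneg_left
      (mul_le_mul hx.2 (by linarith [hx.1]) (by linarith [hx.2]) hL.le) hC0.le
  have hbd : ∀ n, ∀ x ∈ Icc 0 L, ∀ t, 0 ≤ t → t ≤ C * x * (L - x) →
      |truncReaction q α n x t| ≤ C := by
    intro n x hx t ht0 ht
    have h1 := mul_le_mul_of_nonneg_right (hmax x hx).1 (rpow_nonneg ht0 q)
    have h2 := mul_le_mul (hmax x hx).2 (truncPow_le_rpow q n t) (truncPow_nonneg n ht0) hM0.le
    have h3 := hpowle x hx t ht0 ht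
    have h4 : 0 ≤ max (α x) 0 * t ^ q := mul_nonneg (le_max_right _ _) (rpow_nonneg ht0 q)
    have h5 : 0 ≤ max (-α x) 0 * truncPow q n t :=
      mul_nonneg (le_max_right _ _) (truncPow_nonneg n ht0)
    rw [truncReaction, abs_le]
    constructor <;> linarith
  have hsol : ∀ n : ℕ, _ := fun n => exists_maximal_isBVPSolution (K := (n + 1) * M) (B := C)
    (g := truncReaction q α n) hL (by positivity) hC0
    (((hα.comp continuous_fst).max continuous_const).mul
        ((continuous_rpow_const hq.1.le).comp continuous_snd) |>.sub
      (((hα.comp continuous_fst).neg.max continuous_const).mul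
        ((continuous_truncPow hq.1.le n).comp continuous_snd)))
    (fun x hx => by simp [truncReaction, truncPow, zero_rpow hq.1.ne'])
    (fun x hx s t hs hst => by
      have h1 := mul_le_mul_of_nonneg_left (rpow_le_rpow hs hst hq.1.le)
        (le_max_right (α x) 0)
      have h2 := mul_le_mul_of_nonneg_left (mul_sub_truncPow_le hq.2.le n hs hst)
        (le_max_right (-α x) 0)
      have h3 : 0 ≤ (M - max (-α x) 0) * ((n + 1) * (t - s)) :=
        mul_nonneg (sub_nonneg.2 (hmax x hx).2) (mul_nonneg (by positivity) (sub_nonneg.2 hst))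
      simp only [truncReaction]
      linarith)
    (fun x hx => by
      have := (le_abs_self _).trans (hbd n x hx (C * x * (L - x))
        (mul_nonneg (mul_nonneg hC0.le hx.1) (sub_nonneg.2 hx.2)) le_rfl)
      linarith)
    (hbd n)
  choose v hv hvC hvmax using hsol
  choose v' h hh hd1 hd2 hv0 hvL hhv using hv
  have hanti : ∀ x ∈ Icc 0 L, Antitone fun n => v n x := fun x hx =>
    antitone_nat_of_succ_le fun n => by
      refine hvmax n 0 L (v (n + 1)) (v' (n + 1)) (h (n + 1)) le_rfl le_rfl
        (fun x _ => (hd1 (n + 1) x).continuousAt.continuousWithinAt) (fun x _ => hd1 (n + 1) x)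
        (fun x _ => hd2 (n + 1) x) (fun x hx => ?_) (hvC (n + 1)) (hv0 _) (hvL _) x hx
      have hx' := Ioo_subset_Icc_self hx
      rw [hhv (n + 1) x hx']
      exact sub_le_sub_left (mul_le_mul_of_nonneg_left
        (truncPow_le_truncPow_succ q n (hvC (n + 1) x hx').1) (le_max_right _ _)) _
  have hbdd : ∀ x ∈ Icc 0 L, BddBelow (range fun n => v n x) := fun x hx =>
    ⟨0, by rintro _ ⟨n, rfl⟩; exact (hvC n x hx).1⟩
  set w : ℝ → ℝ := fun x => ⨅ n, v n x with hw
  have hlim : ∀ x ∈ Icc 0 L, Tendsto (fun n => v n x) atTop (𝓝 (w x)) := fun x hx =>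
    tendsto_atTop_ciInf (hanti x hx) (hbdd x hx)
  have hw0 : ∀ x ∈ Icc 0 L, 0 ≤ w x := fun x hx => le_ciInf fun n => (hvC n x hx).1
  obtain ⟨z, hz, hzw⟩ := exists_isBVPSolution_of_tendsto (B := C) hL
    (g := fun x t => α x * t ^ q) (w := w)
    ((hα.comp continuous_fst).mul ((continuous_rpow_const hq.1.le).comp continuous_snd))
    hh hd1 hd2 hv0 hvL
    (fun n x hx => by
      rw [hhv n x hx]
      exact hbd n x hx _ (hvC n x hx).1 (hvC n x hx).2)
    hlim
    (fun x hx => by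
      have h1 : Tendsto (fun n => v n x ^ q) atTop (𝓝 (w x ^ q)) :=
        ((continuous_rpow_const hq.1.le).tendsto _).comp (hlim x hx)
      have h2 := tendsto_truncPow hq.1 (hw0 x hx) (fun n => ciInf_le (hbdd x hx) n) (hlim x hx)
      have h3 := (h1.const_mul (max (α x) 0)).sub (h2.const_mul (max (-α x) 0))
      rw [← sub_mul, max_sub_max_neg] at h3
      exact h3.congr fun n => (hhv n x hx).symm)
  refine ⟨z, hz, fun x hx => by rw [hzw hx]; exact hw0 x hx, ?_⟩
  obtain ⟨c, d, ψ, ψ', ψ'', hc, hd, hx₀cd, hψpos, p1, p2, hψ, hψC, hψc, hψd⟩ :=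
    exists_subsolution hq hC0 hα hx₀ hpos
  rw [hzw (Ioo_subset_Icc_self hx₀)]
  refine hψpos.trans_le (le_ciInf fun n => hvmax n c d ψ ψ' ψ'' hc hd
    (fun x _ => (p1 x).continuousAt.continuousWithinAt) (fun x _ => p1 x) (fun x _ => p2 x)
    (fun x hx => ?_) hψC hψc hψd x₀ hx₀cd)
  obtain ⟨h1, h2⟩ := hψ x (Ioo_subset_Icc_self hx)
  rw [truncReaction, max_eq_left h1, max_eq_right (neg_nonpos.2 h1), zero_mul, sub_zero]
  exact h2

end Truncation

lemma DirichletSolution.exists_nontrivial {L q : ℝ} {a : ℝ → ℝ} (hL : 0 < L)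
    (hq : q ∈ Ioo (0 : ℝ) 1) (ha : ContinuousOn a (Icc 0 L)) (hne : (positivitySet L a).Nonempty) :
    ∃ u u' u'' : ℝ → ℝ, DirichletSolution L q a u u' u'' ∧ ∃ x ∈ Icc (0 : ℝ) L, u x ≠ 0 := by
  obtain ⟨x₀, hx₀, hpos⟩ := hne
  set α : ℝ → ℝ := IccExtend hL.le ((Icc 0 L).domRestrict a) with hα
  have hαc : Continuous α := (continuousOn_iff_continuous_domRestrict.1 ha).Icc_extend'
  have hαa : ∀ x ∈ Icc 0 L, α x = a x := fun x hx => by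
    rw [hα, IccExtend_of_mem hL.le _ hx, domRestrict_apply]
  have hx₀' := Ioo_subset_Icc_self hx₀
  obtain ⟨v, ⟨v', h, hc, d1, d2, b0, b1, heq⟩, hv, hvx₀⟩ :=
    exists_nontrivial_isBVPSolution hL hq hαc hx₀ (by rwa [hαa x₀ hx₀'])
  refine ⟨v, v', fun x => -h x, ⟨fun x _ => (d1 x).hasDerivWithinAt,
    fun x _ => (d2 x).hasDerivWithinAt, hc.neg.continuousOn, hv, b0, b1, fun x hx => ?_⟩,
    x₀, hx₀', hvx₀.ne'⟩
  rw [neg_neg, heq x hx, ← hαa x hx]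

/-- One-dimensional Corollary A (Dirichlet case): if the sign-changing continuous weight
`a` is such that `Ω₊ = {x ∈ (0,L) : a(x) > 0}` is nonempty and connected, then the
Dirichlet problem has exactly one nontrivial solution. -/
theorem stmt_8 (L q : ℝ) (hL : 0 < L) (hq : q ∈ Set.Ioo (0 : ℝ) 1)
    (a : ℝ → ℝ) (ha : ContinuousOn a (Set.Icc 0 L)) (hsign : ChangesSign L a)
    (hconn : IsConnected {x : ℝ | x ∈ Set.Ioo (0 : ℝ) L ∧ 0 < a x}) :
    (∃ u u' u'' : ℝ → ℝ,
      DirichletSolution L q a u u' u'' ∧ ∃ x ∈ Set.Icc (0 : ℝ) L, u x ≠ 0) ∧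
    (∀ u u' u'' v v' v'' : ℝ → ℝ,
      DirichletSolution L q a u u' u'' → (∃ x ∈ Set.Icc (0 : ℝ) L, u x ≠ 0) →
      DirichletSolution L q a v v' v'' → (∃ x ∈ Set.Icc (0 : ℝ) L, v x ≠ 0) →
      Set.EqOn u v (Set.Icc 0 L)) := by
  have hne : (positivitySet L a).Nonempty := hconn.nonempty
  have hS : (positivitySet L a).OrdConnected := hconn.isPreconnected.ordConnected
  exact ⟨DirichletSolution.exists_nontrivial hL hq ha hne,
    fun u u' u'' v v' v'' hu hu0 hv hv0 => hu.eqOn hv hq ha hS hne hu0 hv0⟩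
end

section
/- (One-dimensional version of Proposition on I_N \ A_N.) For every L > 0 and every q ∈ (0,1) there exists a continuous function a : [0,L] → ℝ that changes sign such that the Neumann problem (P_N) with weight a and exponent q admits a strongly positive solution (u > 0 on all of [0,L]) and also admits a nontrivial solution that is not strongly positive (i.e. a nontrivial solution vanishing at some point of [0,L]). -/
open Real Set

/-- `u` (with first and second derivatives `u'`, `u''`) is a solution of the
one-dimensional Neumann problem `(P_N)` on `[0, L]` with weight `a` and exponent `q`:
`u` is twice continuously differentiable on `[0, L]`, nonnegative, has vanishing
derivative at the endpoints, and satisfies `-u'' = a(x) u^q` on `[0, L]`. -/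
def NeumannSolution (L q : ℝ) (a u u' u'' : ℝ → ℝ) : Prop :=
  (∀ x ∈ Set.Icc (0 : ℝ) L, HasDerivWithinAt u (u' x) (Set.Icc 0 L) x) ∧
  (∀ x ∈ Set.Icc (0 : ℝ) L, HasDerivWithinAt u' (u'' x) (Set.Icc 0 L) x) ∧
  ContinuousOn u'' (Set.Icc 0 L) ∧
  (∀ x ∈ Set.Icc (0 : ℝ) L, 0 ≤ u x) ∧
  u' 0 = 0 ∧ u' L = 0 ∧
  (∀ x ∈ Set.Icc (0 : ℝ) L, -u'' x = a x * u x ^ q)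

open Metric
open scoped NNReal

lemma hasDerivAt_posPart_pow (n : ℕ) (x : ℝ) :
    HasDerivAt (fun t : ℝ => max t 0 ^ (n + 2)) ((n + 2) * max x 0 ^ (n + 1)) x := by
  have key : ∀ y : ℝ, y ≠ 0 →
      HasDerivAt (fun t : ℝ => max t 0 ^ (n + 2)) ((n + 2) * max y 0 ^ (n + 1)) y := by
    intro y hy
    rcases lt_or_gt_of_ne hy with h | h
    · rw [max_eq_right h.le]
      have h0 : HasDerivAt (fun _ : ℝ => (0 : ℝ)) 0 y := hasDerivAt_const y 0
      refine (h0.congr_of_eventuallyEq ?_).congr_deriv (by simp)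
      filter_upwards [Iio_mem_nhds h] with t ht
      simp [le_of_lt (mem_Iio.1 ht)]
    · rw [max_eq_left h.le]
      refine ((hasDerivAt_pow (n + 2) y).congr_of_eventuallyEq ?_).congr_deriv (by simp)
      filter_upwards [Ioi_mem_nhds h] with t ht
      rw [max_eq_left (le_of_lt (mem_Ioi.1 ht))]
  by_cases hx : x = 0
  · subst hx
    exact hasDerivAt_of_hasDerivAt_of_ne key (by fun_prop) (by fun_prop)
  · exact key x hx

lemma abs_rpow_sub_rpow_le {q : ℝ} (hq : q ∈ Ioo (0 : ℝ) 1) {v w : ℝ} (hv : 1 ≤ v)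
    (hw : 1 ≤ w) : |v ^ q - w ^ q| ≤ |v - w| := by
  have h := Convex.norm_image_sub_le_of_norm_hasDerivWithin_le (𝕜 := ℝ) (s := Ici (1 : ℝ))
    (f := fun x => x ^ q) (f' := fun x => q * x ^ (q - 1)) (C := 1) (x := w) (y := v)
    (fun x hx => (Real.hasDerivAt_rpow_const
      (Or.inl (zero_lt_one.trans_le hx).ne')).hasDerivWithinAt)
    (fun x hx => by
      have hx1 : (1 : ℝ) ≤ x := hx
      have h1 : x ^ (q - 1) ≤ 1 := Real.rpow_le_one_of_one_le_of_nonpos hx1 (by linarith [hq.2])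
      have h0 : 0 ≤ x ^ (q - 1) := Real.rpow_nonneg (by linarith) _
      rw [Real.norm_of_nonneg (mul_nonneg hq.1.le h0)]
      nlinarith [hq.1, hq.2])
    (convex_Ici 1) hw hv
  simpa using h

/-- Solvability of `V'' = -c V ^ q`, `V' 0 = 0` on `[0, L]` with `V` staying in `[2, 4]`, for a
small coefficient `c`. -/
lemma exists_solution_of_small_weight {L q : ℝ} (hL : 0 < L) (hq : q ∈ Ioo (0 : ℝ) 1)
    {c : ℝ → ℝ} (hc : ContinuousOn c (Icc 0 L))
    (hcL : ∀ x ∈ Icc (0 : ℝ) L, |c x| ≤ 1 / (4 * L ^ 2)) :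
    ∃ V P : ℝ → ℝ, P 0 = 0 ∧
      (∀ x ∈ Icc (0 : ℝ) L, HasDerivWithinAt V (P x) (Icc 0 L) x) ∧
      (∀ x ∈ Icc (0 : ℝ) L, HasDerivWithinAt P (-(c x * V x ^ q)) (Icc 0 L) x) ∧
      (∀ x ∈ Icc (0 : ℝ) L, 2 ≤ V x) ∧ (∀ x ∈ Icc (0 : ℝ) L, |P x| ≤ 1 / L) := by
  let f : ℝ → ℝ × ℝ → ℝ × ℝ := fun t z => (z.2 / L, -(L * c t * z.1 ^ q))
  let t₀ : Icc (0 : ℝ) L := ⟨0, le_rfl, hL.le⟩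
  have hM : 0 ≤ 1 / L := by positivity
  let M : ℝ≥0 := ⟨1 / L, hM⟩
  have ball : ∀ z : ℝ × ℝ, z ∈ closedBall ((3, 0) : ℝ × ℝ) (1 : ℝ≥0) →
      2 ≤ z.1 ∧ z.1 ≤ 4 ∧ |z.2| ≤ 1 := by
    intro z hz
    rw [mem_closedBall, Prod.dist_eq, Real.dist_eq, Real.dist_eq, NNReal.coe_one] at hz
    have h1 := (le_max_left _ _).trans hz
    have h2 := (le_max_right _ _).trans hz
    rw [abs_le] at h1
    simp only [sub_zero] at h2
    exact ⟨by linarith, by linarith, h2⟩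
  have hLc : ∀ t ∈ Icc (0 : ℝ) L, |L * c t| * 4 ≤ 1 / L := by
    intro t ht
    rw [abs_mul, abs_of_pos hL]
    calc L * |c t| * 4 ≤ L * (1 / (4 * L ^ 2)) * 4 := by gcongr; exact hcL t ht
      _ = 1 / L := by field_simp
  have hf : IsPicardLindelof f t₀ ((3, 0) : ℝ × ℝ) 1 0 M M := by
    refine ⟨fun t ht => LipschitzOnWith.of_dist_le_mul fun z hz w hw => ?_, fun z hz => ?_,
      fun t ht z hz => ?_, ?_⟩
    · obtain ⟨hz1, -, -⟩ := ball z hz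
      obtain ⟨hw1, -, -⟩ := ball w hw
      have e1 : |z.1 - w.1| ≤ dist z w := le_max_left _ _
      have e2 : |z.2 - w.2| ≤ dist z w := le_max_right _ _
      change max (dist (z.2 / L) (w.2 / L)) (dist (-(L * c t * z.1 ^ q)) (-(L * c t * w.1 ^ q)))
        ≤ 1 / L * dist z w
      refine max_le ?_ ?_
      · rw [Real.dist_eq, ← sub_div, abs_div, abs_of_pos hL, div_eq_mul_one_div, mul_comm]
        gcongr
      · rw [dist_neg_neg, Real.dist_eq, ← mul_sub, abs_mul]
        have h1 := abs_rpow_sub_rpow_le hq (by linarith : 1 ≤ z.1) (by linarith : 1 ≤ w.1)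
        have h2 := hLc t ht
        refine mul_le_mul ?_ (h1.trans e1) (abs_nonneg _) hM
        linarith [abs_nonneg (L * c t)]
    · change ContinuousOn (fun t => (z.2 / L, -(L * c t * z.1 ^ q))) (Icc 0 L)
      fun_prop
    · obtain ⟨hz1, hz2, hz3⟩ := ball z hz
      change max |z.2 / L| |(-(L * c t * z.1 ^ q))| ≤ 1 / L
      refine max_le ?_ ?_
      · rw [abs_div, abs_of_pos hL]
        gcongr
      · have h0 : 0 ≤ z.1 ^ q := Real.rpow_nonneg (by linarith) _
        have h1 : z.1 ^ q ≤ 4 :=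
          (Real.rpow_le_self_of_one_le (by linarith) hq.2.le).trans hz2
        rw [abs_neg, abs_mul, abs_of_nonneg h0]
        exact (by gcongr : |L * c t| * z.1 ^ q ≤ |L * c t| * 4).trans (hLc t ht)
    · change 1 / L * max (L - 0) (0 - 0) ≤ ((1 : ℝ≥0) : ℝ) - ((0 : ℝ≥0) : ℝ)
      have : max (L - 0) (0 - 0) = L := by simp [hL.le]
      rw [this, one_div_mul_cancel hL.ne']
      simp
  obtain ⟨α, hα⟩ := ODE.FunSpace.exists_isFixedPt_next hf (mem_closedBall_self le_rfl)
  have hmem : ∀ t, α.compProj t ∈ closedBall ((3, 0) : ℝ × ℝ) (1 : ℝ≥0) := fun t =>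
    α.compProj_mem_closedBall hf.mul_max_le
  have h0 : α.compProj 0 = (3, 0) := by
    change α.compProj (t₀ : ℝ) = _
    rw [ODE.FunSpace.compProj_val, ← hα, ODE.FunSpace.next_apply₀]
  have hder : ∀ t ∈ Icc (0 : ℝ) L,
      HasDerivWithinAt α.compProj (f t (α.compProj t)) (Icc 0 L) t := by
    intro t ht
    refine (ODE.hasDerivWithinAt_picard_Icc t₀.2 hf.continuousOn_uncurry
      α.continuous_compProj.continuousOn (fun _ _ => hmem _) (3, 0) ht).congr_of_mem
      (fun t' ht' => ?_) ht
    nth_rw 1 [← hα]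
    rw [ODE.FunSpace.compProj_of_mem ht', ODE.FunSpace.next_apply]
  refine ⟨fun t => (α.compProj t).1, fun t => (α.compProj t).2 / L, ?_, fun t ht => ?_,
    fun t ht => ?_, fun t _ => (ball _ (hmem t)).1, fun t _ => ?_⟩
  · change (α.compProj 0).2 / L = 0
    rw [h0, zero_div]
  · exact (hder t ht).fst
  · have h2 : HasDerivWithinAt (fun t => (α.compProj t).2) (-(L * c t * (α.compProj t).1 ^ q))
        (Icc 0 L) t := (hder t ht).snd
    refine (h2.div_const L).congr_deriv ?_
    field_simp
  · rw [abs_div, abs_of_pos hL]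
    gcongr
    exact (ball _ (hmem t)).2.2

/-- The compactly supported profile `ε (b² - x²)₊ ^ (n + 3)` solves the equation for the weight
written on the right-hand side. -/
lemma neg_deriv_profile_eq {q b η ε : ℝ} (hε : 0 < ε) (hεη : ε = η * ε ^ q)
    (n : ℕ) (hn : 0 < n + 1 - (n + 3) * q) (x : ℝ) :
    -(ε * ((n + 3) * ((n + 2) * max (b ^ 2 - x ^ 2) 0 ^ (n + 1) * (4 * x ^ 2)
        - 2 * max (b ^ 2 - x ^ 2) 0 ^ (n + 2)))) =
      η * (2 * (n + 3) * max (b ^ 2 - x ^ 2) 0 ^ (n + 1 - (n + 3) * q : ℝ) *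
        (max (b ^ 2 - x ^ 2) 0 - 2 * (n + 2) * x ^ 2)) *
      (ε * max (b ^ 2 - x ^ 2) 0 ^ (n + 3)) ^ q := by
  have hy : 0 ≤ max (b ^ 2 - x ^ 2) 0 := le_max_right _ _
  generalize max (b ^ 2 - x ^ 2) 0 = y at hy ⊢
  rcases hy.eq_or_lt with rfl | hy
  · simp [Real.zero_rpow hn.ne']
  · have h1 : (ε * y ^ (n + 3)) ^ q = ε ^ q * y ^ ((n + 3) * q : ℝ) := by
      rw [Real.mul_rpow hε.le (by positivity), ← Real.rpow_natCast_mul hy.le]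
      push_cast
      rfl
    have h2 : y ^ (n + 1 - (n + 3) * q : ℝ) * y ^ ((n + 3) * q : ℝ) = y ^ (n + 1) := by
      rw [← Real.rpow_add hy, sub_add_cancel, ← Nat.cast_add_one, Real.rpow_natCast]
    rw [h1]
    calc _ = ε * (y ^ (n + 1) * (2 * (n + 3) * (y - 2 * (n + 2) * x ^ 2))) := by ring
      _ = (η * ε ^ q) * ((y ^ (n + 1 - (n + 3) * q : ℝ) * y ^ ((n + 3) * q : ℝ)) *
          (2 * (n + 3) * (y - 2 * (n + 2) * x ^ 2))) := by rw [← hεη, h2]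
      _ = _ := by ring

/-- For every `L > 0` and every `q ∈ (0,1)` there is a sign-changing continuous weight
`a` on `[0, L]` such that the Neumann problem admits a strongly positive solution and
also a nontrivial solution which vanishes somewhere in `[0, L]` (hence is not strongly
positive). -/
theorem stmt_9 (L q : ℝ) (hL : 0 < L) (hq : q ∈ Set.Ioo (0 : ℝ) 1) :
    ∃ a : ℝ → ℝ, ContinuousOn a (Set.Icc 0 L) ∧ ChangesSign L a ∧
      (∃ u u' u'' : ℝ → ℝ,
        NeumannSolution L q a u u' u'' ∧ ∀ x ∈ Set.Icc (0 : ℝ) L, 0 < u x) ∧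
      (∃ u u' u'' : ℝ → ℝ,
        NeumannSolution L q a u u' u'' ∧ (∃ x ∈ Set.Icc (0 : ℝ) L, u x ≠ 0) ∧
        (∃ x ∈ Set.Icc (0 : ℝ) L, u x = 0)) := by
  obtain ⟨n, hn⟩ := exists_nat_gt (3 / (1 - q))
  have hq1 : 0 < 1 - q := by linarith [hq.2]
  have he : (0 : ℝ) < n + 1 - (n + 3) * q := by
    rw [div_lt_iff₀ hq1] at hn
    nlinarith [hq.2]
  obtain ⟨b, hb⟩ : ∃ b, b = L / 2 := ⟨_, rfl⟩
  have hb0 : 0 < b := by linarith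
  let y : ℝ → ℝ := fun x => max (b ^ 2 - x ^ 2) 0
  have hy0 : ∀ x, 0 ≤ y x := fun x => le_max_right _ _
  have hyb : ∀ x, b ≤ x → y x = 0 := fun x hx => max_eq_right (by nlinarith)
  have hyc : Continuous y := by fun_prop
  let h : ℝ → ℝ := fun x =>
    2 * (n + 3) * y x ^ (n + 1 - (n + 3) * q : ℝ) * (y x - 2 * (n + 2) * x ^ 2)
  have hhc : Continuous h :=
    (continuous_const.mul (hyc.rpow_const fun _ => Or.inr he.le)).mul (by fun_prop)
  obtain ⟨B, hB⟩ := isCompact_Icc.exists_bound_of_continuousOn (s := Icc (0 : ℝ) L)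
    hhc.continuousOn
  have hB1 : 0 < |B| + 1 := by positivity
  obtain ⟨η, hη⟩ : ∃ η, η = 1 / (4 * L ^ 2 * (|B| + 1)) := ⟨_, rfl⟩
  have hη0 : 0 < η := by rw [hη]; positivity
  obtain ⟨ε, hε⟩ : ∃ ε, ε = η ^ (1 / (1 - q)) := ⟨_, rfl⟩
  have hε0 : 0 < ε := hε ▸ Real.rpow_pos_of_pos hη0 _
  have hεη : ε = η * ε ^ q := by
    have : η = ε ^ (1 - q) := by
      rw [hε, ← Real.rpow_mul hη0.le, one_div_mul_cancel hq1.ne', Real.rpow_one]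
    rw [this, ← Real.rpow_add hε0, sub_add_cancel, Real.rpow_one]
  let c : ℝ → ℝ := fun x => η * h x
  have hcc : Continuous c := continuous_const.mul hhc
  obtain ⟨V, P, hP0, hV, hP, hV2, hPL⟩ := exists_solution_of_small_weight hL hq
    hcc.continuousOn fun x hx => by
      have h1 : |h x| ≤ |B| + 1 := (hB x hx).trans (by linarith [le_abs_self B])
      calc |c x| = η * |h x| := by simp only [c]; rw [abs_mul, abs_of_pos hη0]
        _ ≤ η * (|B| + 1) := by gcongr
        _ = 1 / (4 * L ^ 2) := by rw [hη]; field_simp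
  let φ : ℝ → ℝ := fun x => max (x - b) 0 ^ 3 / (3 * (L - b) ^ 2)
  let φ' : ℝ → ℝ := fun x => max (x - b) 0 ^ 2 / (L - b) ^ 2
  let φ'' : ℝ → ℝ := fun x => 2 * max (x - b) 0 / (L - b) ^ 2
  have hLb : 0 < L - b := by linarith
  have hφ : ∀ x, HasDerivAt φ (φ' x) x := fun x => by
    refine (((hasDerivAt_posPart_pow 1 (x - b)).comp_sub_const x b).div_const
      (3 * (L - b) ^ 2)).congr_deriv ?_
    simp only [φ']
    field_simp
    norm_num
  have hφ' : ∀ x, HasDerivAt φ' (φ'' x) x := fun x => by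
    refine (((hasDerivAt_posPart_pow 0 (x - b)).comp_sub_const x b).div_const
      ((L - b) ^ 2)).congr_deriv ?_
    simp [φ'']
  have hφ''c : Continuous φ'' := by fun_prop
  have hφb : ∀ x, x ≤ b → φ x = 0 ∧ φ' x = 0 ∧ φ'' x = 0 := fun x hx => by
    have : max (x - b) 0 = 0 := max_eq_right (by linarith)
    simp [φ, φ', φ'', this]
  have hφL : φ' L = 1 := by
    simp only [φ']
    rw [max_eq_left hLb.le, div_self (by positivity)]
  have hφle : ∀ x ∈ Icc (0 : ℝ) L, |φ x| ≤ L := fun x hx => by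
    have h0 : 0 ≤ max (x - b) 0 := le_max_right _ _
    have h1 : max (x - b) 0 ≤ L - b := max_le (by linarith [hx.2]) hLb.le
    rw [abs_of_nonneg (by positivity), div_le_iff₀ (by positivity)]
    calc max (x - b) 0 ^ 3 ≤ (L - b) ^ 3 := by gcongr
      _ = (L - b) * (L - b) ^ 2 := by ring
      _ ≤ L * (3 * (L - b) ^ 2) := by
        refine mul_le_mul (by linarith) (by nlinarith [sq_nonneg (L - b)]) (by positivity) hL.le
  let v : ℝ → ℝ := fun x => V x - P L * φ x
  let v'' : ℝ → ℝ := fun x => -(c x * V x ^ q) - P L * φ'' x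
  have hVc : ContinuousOn V (Icc 0 L) := fun x hx => (hV x hx).continuousWithinAt
  have hφc : Continuous φ := by fun_prop
  have hvc : ContinuousOn v (Icc 0 L) := hVc.sub (continuous_const.mul hφc).continuousOn
  have hv''c : ContinuousOn v'' (Icc 0 L) :=
    ((hcc.continuousOn.mul (hVc.rpow_const fun x hx => Or.inr hq.1.le)).neg).sub
      (continuous_const.mul hφ''c).continuousOn
  have hvpos : ∀ x ∈ Icc (0 : ℝ) L, 0 < v x := fun x hx => by
    have h1 : |P L * φ x| ≤ 1 := by
      rw [abs_mul]
      calc |P L| * |φ x| ≤ 1 / L * L :=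
            mul_le_mul (hPL L ⟨hL.le, le_rfl⟩) (hφle x hx) (abs_nonneg _) (by positivity)
        _ = 1 := one_div_mul_cancel hL.ne'
    have := (abs_le.1 h1).2
    have := hV2 x hx
    simp only [v]
    linarith
  have hvq : ∀ x ∈ Icc (0 : ℝ) L, v x ^ q ≠ 0 := fun x hx =>
    (Real.rpow_pos_of_pos (hvpos x hx) q).ne'
  let a : ℝ → ℝ := fun x => -v'' x / v x ^ q
  have hac : ∀ x ∈ Icc (0 : ℝ) L, x ≤ b → a x = c x := fun x hx hxb => by
    obtain ⟨e0, -, e2⟩ := hφb x hxb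
    have ev : v x = V x := by simp [v, e0]
    have := hvq x hx
    simp only [a, v'', e2]
    rw [ev] at this ⊢
    field_simp
    ring
  refine ⟨a, hv''c.neg.div (hvc.rpow_const fun x hx => Or.inr hq.1.le) hvq, ⟨?_, ?_⟩, ?_, ?_⟩
  · refine ⟨0, ⟨le_rfl, hL.le⟩, ?_⟩
    rw [hac 0 ⟨le_rfl, hL.le⟩ hb0.le]
    have hy : y 0 = b ^ 2 := by
      simp only [y]
      rw [max_eq_left (by nlinarith)]
      ring
    simp only [c, h, hy]
    have := Real.rpow_pos_of_pos (pow_pos hb0 2) (n + 1 - (n + 3) * q : ℝ)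
    refine mul_pos hη0 (mul_pos (by positivity) ?_)
    simpa using pow_pos hb0 2
  · have hm : 3 / 4 * b ∈ Icc (0 : ℝ) L := ⟨by linarith, by linarith⟩
    refine ⟨3 / 4 * b, hm, ?_⟩
    rw [hac _ hm (by linarith)]
    have hy : y (3 / 4 * b) = 7 / 16 * b ^ 2 := by
      simp only [y]
      rw [max_eq_left (by nlinarith)]
      ring
    simp only [c, h, hy]
    have hb2 := pow_pos hb0 2
    have := Real.rpow_pos_of_pos (by positivity : 0 < 7 / 16 * b ^ 2) (n + 1 - (n + 3) * q : ℝ)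
    refine mul_neg_of_pos_of_neg hη0 (mul_neg_of_pos_of_neg (by positivity) ?_)
    nlinarith [mul_nonneg (Nat.cast_nonneg (α := ℝ) n) hb2.le]
  · refine ⟨v, fun x => P x - P L * φ' x, v'', ⟨fun x hx => ?_, fun x hx => ?_, hv''c,
      fun x hx => (hvpos x hx).le, ?_, ?_, fun x hx => ?_⟩, hvpos⟩
    · exact (hV x hx).sub ((hφ x).hasDerivWithinAt.const_mul _)
    · exact (hP x hx).sub ((hφ' x).hasDerivWithinAt.const_mul _)
    · simp [hP0, (hφb 0 hb0.le).2.1]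
    · simp [hφL]
    · simp only [a]
      rw [div_mul_cancel₀ _ (hvq x hx)]
  · have hyd : ∀ x, HasDerivAt (fun x : ℝ => b ^ 2 - x ^ 2) (-(2 * x)) x := fun x => by
      simpa using (hasDerivAt_pow 2 x).const_sub (b ^ 2)
    refine ⟨fun x => ε * y x ^ (n + 3), fun x => ε * ((n + 3) * (y x ^ (n + 2) * (-(2 * x)))),
      fun x => ε * ((n + 3) * ((n + 2) * y x ^ (n + 1) * (4 * x ^ 2) - 2 * y x ^ (n + 2))),
      ⟨fun x hx => ?_, fun x hx => ?_, by fun_prop, fun x hx => by positivity [hy0 x], by simp, ?_,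
        fun x hx => ?_⟩, ⟨0, ⟨le_rfl, hL.le⟩, ?_⟩, ⟨L, ⟨hL.le, le_rfl⟩, ?_⟩⟩
    · refine ((((hasDerivAt_posPart_pow (n + 1) (b ^ 2 - x ^ 2)).comp x
        (hyd x)).const_mul ε).congr_deriv ?_).hasDerivWithinAt
      push_cast
      ring
    · have hlin : HasDerivAt (fun x : ℝ => -(2 * x)) (-2) x := by
        simpa using ((hasDerivAt_id x).const_mul 2).fun_neg
      refine ((((((hasDerivAt_posPart_pow n (b ^ 2 - x ^ 2)).comp x
        (hyd x)).mul hlin).const_mul (n + 3 : ℝ)).const_mul ε).congr_deriv ?_).hasDerivWithinAt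
      simp only [y, Function.comp]
      ring
    · simp [hyb L (by linarith)]
    · rcases le_total x b with hxb | hxb
      · rw [hac x hx hxb]
        exact neg_deriv_profile_eq hε0 hεη n he x
      · simp [hyb x hxb, Real.zero_rpow hq.1.ne']
    · have : 0 < y 0 := lt_max_of_lt_left (by nlinarith)
      positivity
    · simp [hyb L (by linarith)]
end

section
/- (Subsolution built from the Poisson solution; key step in the proof that condition (A.3) yields positive solutions.) Let Ω ⊆ ℝ^N be open, q ∈ (0,1), a : Ω → ℝ, and let φ : Ω → ℝ be twice differentiable with φ > 0 in Ω and −Δφ(x) = a(x) for all x ∈ Ω. Then the function w := ((1−q)·φ)^{1/(1−q)} is twice differentiable in Ω and satisfies −Δw(x) ≤ a(x)·w(x)^q for all x ∈ Ω, i.e. w is a (positive) subsolution of the equation −Δu = a(x)u^q. -/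
open Real Set

/-- Chain rule for `y ↦ (c * f y) ^ r` at a point where the base is positive. -/
theorem HasFDerivAt.const_mul_rpow_of_pos {E : Type*} [NormedAddCommGroup E] [NormedSpace ℝ E]
    {f : E → ℝ} {f' : E →L[ℝ] ℝ} {x : E} {c : ℝ} (hf : HasFDerivAt f f' x) (hpos : 0 < c * f x)
    (r : ℝ) :
    HasFDerivAt (fun y => (c * f y) ^ r) ((r * (c * f x) ^ (r - 1) * c) • f') x := by
  have h := (hf.const_mul c).rpow_const (p := r) (Or.inl hpos.ne')
  rwa [smul_smul] at h

/-- Subsolution built from the Poisson solution: if `φ > 0` is twice differentiable in an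
open set `Ω ⊆ ℝ^N` with `-Δφ = a(x)` in `Ω`, then `w := ((1-q) φ)^(1/(1-q))` is twice
differentiable in `Ω` and satisfies `-Δw ≤ a(x) w^q` in `Ω`. -/
theorem stmt_10 {N : ℕ} (hN : 1 ≤ N) (Ω : Set (EuclideanSpace ℝ (Fin N))) (hΩ : IsOpen Ω)
    (q : ℝ) (hq : q ∈ Set.Ioo (0 : ℝ) 1)
    (a φ : EuclideanSpace ℝ (Fin N) → ℝ)
    (φ' : EuclideanSpace ℝ (Fin N) → (EuclideanSpace ℝ (Fin N) →L[ℝ] ℝ))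
    (φ'' : EuclideanSpace ℝ (Fin N) →
      (EuclideanSpace ℝ (Fin N) →L[ℝ] (EuclideanSpace ℝ (Fin N) →L[ℝ] ℝ)))
    (hφ' : ∀ x ∈ Ω, HasFDerivAt φ (φ' x) x)
    (hφ'' : ∀ x ∈ Ω, HasFDerivAt φ' (φ'' x) x)
    (hφpos : ∀ x ∈ Ω, 0 < φ x)
    (heq : ∀ x ∈ Ω,
      -(∑ i, φ'' x (EuclideanSpace.single i 1) (EuclideanSpace.single i 1)) = a x) :
    ∃ (w' : EuclideanSpace ℝ (Fin N) → (EuclideanSpace ℝ (Fin N) →L[ℝ] ℝ))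
      (w'' : EuclideanSpace ℝ (Fin N) →
        (EuclideanSpace ℝ (Fin N) →L[ℝ] (EuclideanSpace ℝ (Fin N) →L[ℝ] ℝ))),
      (∀ x ∈ Ω, HasFDerivAt (fun y => ((1 - q) * φ y) ^ (1 / (1 - q))) (w' x) x) ∧
      (∀ x ∈ Ω, HasFDerivAt w' (w'' x) x) ∧
      (∀ x ∈ Ω,
        -(∑ i, w'' x (EuclideanSpace.single i 1) (EuclideanSpace.single i 1))
          ≤ a x * (((1 - q) * φ x) ^ (1 / (1 - q))) ^ q) := by
  obtain ⟨hq0, hq1⟩ := hq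
  have hq' : 0 < 1 - q := sub_pos.2 hq1
  have hpos : ∀ x ∈ Ω, 0 < (1 - q) * φ x := fun x hx => mul_pos hq' (hφpos x hx)
  set p : ℝ := 1 / (1 - q) with hp
  have hpq : p - 1 = p * q := by rw [hp]; field_simp; ring
  have hp0 : 0 < p := by positivity
  have hp1 : p * (1 - q) = 1 := by rw [hp]; field_simp
  refine ⟨fun x => ((1 - q) * φ x) ^ (p * q) • φ' x,
    fun x => ((1 - q) * φ x) ^ (p * q) • φ'' x +
      ((p * q * ((1 - q) * φ x) ^ (p * q - 1) * (1 - q)) • φ' x).smulRight (φ' x),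
    fun x hx => ?_, fun x hx => ?_, fun x hx => ?_⟩
  · have h := (hφ' x hx).const_mul_rpow_of_pos (hpos x hx) p
    rwa [hpq, mul_right_comm, hp1, one_mul] at h
  · exact ((hφ' x hx).const_mul_rpow_of_pos (hpos x hx) (p * q)).smul (hφ'' x hx)
  · have hgrad : 0 ≤ ∑ i, p * q * ((1 - q) * φ x) ^ (p * q - 1) * (1 - q) *
        φ' x (EuclideanSpace.single i 1) * φ' x (EuclideanSpace.single i 1) := by
      refine Finset.sum_nonneg fun i _ => ?_
      rw [mul_assoc _ (φ' x _)]
      have := hpos x hx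
      exact mul_nonneg (by positivity) (mul_self_nonneg _)
    rw [← Real.rpow_mul (hpos x hx).le, ← heq x hx]
    simp only [add_apply, smul_apply, ContinuousLinearMap.smulRight_apply, smul_eq_mul,
      Finset.sum_add_distrib, ← Finset.mul_sum]
    linarith
end

section
/- (The explicit radial comparison function of the dead-core theorem.) Let N ≥ 1, q ∈ (0,1), m > 0, x₀ ∈ ℝ^N, and set C_{N,q} := (1−q)² / (2·(N·(1−q) + 2q)). Define w : ℝ^N → ℝ by w(x) := (C_{N,q}·m·‖x − x₀‖²)^{1/(1−q)}. Then w is twice differentiable on all of ℝ^N (including at x₀) and satisfies Δw(x) = m·w(x)^q for every x ∈ ℝ^N. -/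
open Real Set

open scoped Asymptotics

/-- The real inner product as a continuous bilinear map, linear (rather than conjugate-linear) in
the first argument. -/
noncomputable def realInnerCLM (E : Type*) [NormedAddCommGroup E] [InnerProductSpace ℝ E] :
    E →L[ℝ] E →L[ℝ] ℝ :=
  innerSL ℝ

@[simp]
theorem realInnerCLM_apply {E : Type*} [NormedAddCommGroup E] [InnerProductSpace ℝ E] (u v : E) :
    realInnerCLM E u v = inner ℝ u v :=
  rfl

/-- The derivative of `a ^ r * z` with `a = c ‖z‖²`, the scalar factor vanishing at the origin
fast enough for the product to be differentiable there. -/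
theorem hasFDerivAt_rpow_norm_sq_smul_realInnerCLM {E : Type*} [NormedAddCommGroup E]
    [InnerProductSpace ℝ E] {c r : ℝ} (hc : 0 < c) (hr : 0 < r) (x₀ x : E) :
    HasFDerivAt
      (fun y : E => (c * ‖y - x₀‖ ^ 2) ^ r • realInnerCLM E (y - x₀))
      ((c * ‖x - x₀‖ ^ 2) ^ r • realInnerCLM E
        + ((r * (c * ‖x - x₀‖ ^ 2) ^ (r - 1) * (2 * c)) • realInnerCLM E (x - x₀)).smulRight
            (realInnerCLM E (x - x₀))) x := by
  have hlin : HasFDerivAt (fun y : E => realInnerCLM E (y - x₀)) (realInnerCLM E) x :=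
    (realInnerCLM E).hasFDerivAt.comp x ((hasFDerivAt_id x).sub_const x₀)
  rcases eq_or_ne x x₀ with rfl | hx
  · have hcont : Filter.Tendsto (fun y : E => (c * ‖y - x‖ ^ 2) ^ r) (nhds x) (nhds 0) := by
      have h : Continuous fun y : E => (c * ‖y - x‖ ^ 2) ^ r :=
        (by fun_prop : Continuous fun y : E => c * ‖y - x‖ ^ 2).rpow_const fun _ => Or.inr hr.le
      simpa [Real.zero_rpow hr.ne'] using h.tendsto x
    have hO : (fun y : E => realInnerCLM E (y - x)) =O[nhds x] fun y => y - x :=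
      Asymptotics.IsBigO.of_bound ‖realInnerCLM E‖
        (.of_forall fun y => (realInnerCLM E).le_opNorm _)
    have := ((Asymptotics.isLittleO_one_iff ℝ).2 hcont).smul_isBigO hO
    rw [hasFDerivAt_iff_isLittleO]
    simpa [Real.zero_rpow hr.ne'] using this
  · have hpos : 0 < c * ‖x - x₀‖ ^ 2 := by
      have := norm_pos_iff.2 (sub_ne_zero.2 hx)
      positivity
    have hsq : HasFDerivAt (fun y : E => c * ‖y - x₀‖ ^ 2)
        (c • (2 • realInnerCLM E (x - x₀))) x := by
      simpa [realInnerCLM] using (((hasFDerivAt_id x).sub_const x₀).norm_sq).const_mul c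
    have := (hsq.rpow_const (p := r) (Or.inl hpos.ne')).smul hlin
    refine this.congr_fderiv ?_
    ext u v
    simp
    left
    ring

/-- The explicit radial comparison function of the dead-core theorem: with
`C_{N,q} = (1-q)²/(2(N(1-q)+2q))` and `m > 0`, the function
`w(x) = (C_{N,q} m ‖x - x₀‖²)^(1/(1-q))` is twice differentiable on all of `ℝ^N` and
satisfies `Δw = m w^q` everywhere. -/
theorem stmt_12 {N : ℕ} (hN : 1 ≤ N) (q m : ℝ) (hq : q ∈ Set.Ioo (0 : ℝ) 1) (hm : 0 < m)
    (x₀ : EuclideanSpace ℝ (Fin N)) :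
    ∃ (w' : EuclideanSpace ℝ (Fin N) → (EuclideanSpace ℝ (Fin N) →L[ℝ] ℝ))
      (w'' : EuclideanSpace ℝ (Fin N) →
        (EuclideanSpace ℝ (Fin N) →L[ℝ] (EuclideanSpace ℝ (Fin N) →L[ℝ] ℝ))),
      (∀ x : EuclideanSpace ℝ (Fin N),
        HasFDerivAt
          (fun y : EuclideanSpace ℝ (Fin N) =>
            ((1 - q) ^ 2 / (2 * (N * (1 - q) + 2 * q)) * m * ‖y - x₀‖ ^ 2)
              ^ (1 / (1 - q)))
          (w' x) x) ∧
      (∀ x : EuclideanSpace ℝ (Fin N), HasFDerivAt w' (w'' x) x) ∧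
      (∀ x : EuclideanSpace ℝ (Fin N),
        (∑ i, w'' x (EuclideanSpace.single i 1) (EuclideanSpace.single i 1))
          = m * (((1 - q) ^ 2 / (2 * (N * (1 - q) + 2 * q)) * m * ‖x - x₀‖ ^ 2)
              ^ (1 / (1 - q))) ^ q) := by
  obtain ⟨hq0, hq1⟩ := hq
  have h1q : 0 < 1 - q := sub_pos.2 hq1
  have hNpos : (0 : ℝ) < N := by exact_mod_cast hN
  have hden : 0 < N * (1 - q) + 2 * q := by positivity
  set c : ℝ := (1 - q) ^ 2 / (2 * (N * (1 - q) + 2 * q)) * m with hc_def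
  have hc : 0 < c := by positivity
  set p : ℝ := 1 / (1 - q) with hp_def
  have hpq : p - 1 = p * q := by rw [hp_def]; field_simp; ring
  have hp : 0 < p := by positivity
  have hr : 0 < p - 1 := by rw [hpq]; positivity
  refine ⟨fun x => (2 * c * p) • ((c * ‖x - x₀‖ ^ 2) ^ (p - 1) • realInnerCLM _ (x - x₀)), _,
    fun x => ?_,
    fun x => (hasFDerivAt_rpow_norm_sq_smul_realInnerCLM hc hr x₀ x).const_smul (2 * c * p),
    fun x => ?_⟩
  · have hsq : HasFDerivAt (fun y => c * ‖y - x₀‖ ^ 2)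
        (c • (2 • realInnerCLM _ (x - x₀))) x := by
      simpa [realInnerCLM] using (((hasFDerivAt_id x).sub_const x₀).norm_sq).const_mul c
    refine (hsq.rpow_const (p := p) (Or.inr (by linarith))).congr_fderiv ?_
    ext u
    simp
    ring
  · have hbase : 0 ≤ c * ‖x - x₀‖ ^ 2 := by positivity
    have hcoef : 2 * c * p * (N + 2 * (p - 1)) = m := by
      rw [hpq, hp_def, hc_def]
      field_simp
    have hstep : (c * ‖x - x₀‖ ^ 2) ^ (p - 1 - 1) * (c * ‖x - x₀‖ ^ 2)
        = (c * ‖x - x₀‖ ^ 2) ^ (p - 1) := by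
      rw [← Real.rpow_add_one' hbase (by linarith), sub_add_cancel]
    have hnorm : ∑ i, (x i - x₀ i) * (x i - x₀ i) = ‖x - x₀‖ ^ 2 := by
      simp [EuclideanSpace.real_norm_sq_eq (x - x₀), ← sq]
    rw [← Real.rpow_mul hbase, ← hpq]
    calc
      _ = ∑ i, 2 * c * p * ((c * ‖x - x₀‖ ^ 2) ^ (p - 1)
            + (p - 1) * (c * ‖x - x₀‖ ^ 2) ^ (p - 1 - 1) * (2 * c)
              * ((x i - x₀ i) * (x i - x₀ i))) := by
        refine Finset.sum_congr rfl fun i _ => ?_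
        simp [EuclideanSpace.inner_single_right]
        ring
      _ = 2 * c * p * (N * (c * ‖x - x₀‖ ^ 2) ^ (p - 1)
            + 2 * (p - 1) * ((c * ‖x - x₀‖ ^ 2) ^ (p - 1 - 1) * (c * ‖x - x₀‖ ^ 2))) := by
        rw [← Finset.mul_sum, Finset.sum_add_distrib, ← Finset.mul_sum, hnorm, Finset.sum_const,
          Finset.card_univ, Fintype.card_fin, nsmul_eq_mul]
        ring
      _ = m * (c * ‖x - x₀‖ ^ 2) ^ (p - 1) := by
        rw [hstep, ← hcoef]
        ring
end

section
/- (One-dimensional dead-point theorem: solutions vanish where the weight is very negative.) Let q ∈ (0,1), M > 0, R > 0, x₀ ∈ ℝ, and set C_{1,q} := (1−q)²/(2(1+q)). Let a : [x₀−R, x₀+R] → ℝ be continuous with a ≤ 0 on [x₀−R, x₀+R], and let u : [x₀−R, x₀+R] → ℝ be twice continuously differentiable with 0 ≤ u(x) ≤ M and −u''(x) = a(x)·u(x)^q for all x ∈ [x₀−R, x₀+R]. If −a(x) ≥ M^{1−q} / (C_{1,q}·R²) for all x ∈ [x₀−R, x₀+R], then u(x₀) = 0. -/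
open Real Set

/-- The second derivative test for maxima: a function whose derivative has positive
derivative at `x` has no local maximum at `x`. -/
theorem not_isLocalMax_of_hasDerivAt_pos {f f' : ℝ → ℝ} {x c : ℝ}
    (hf : ∀ᶠ y in nhds x, HasDerivAt f (f' y) y) (hf' : HasDerivAt f' c x) (hc : 0 < c) :
    ¬ IsLocalMax f x := by
  intro hmax
  have hderiv : deriv f =ᶠ[nhds x] f' := hf.mono fun y hy => hy.deriv
  have hsecond : deriv (deriv f) x = c := by rw [hderiv.deriv_eq, hf'.deriv]
  have hmin : IsLocalMin f x :=
    isLocalMin_of_deriv_deriv_pos (by rwa [hsecond]) hmax.deriv_eq_zero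
      hf.self_of_nhds.continuousAt
  have hconst : f =ᶠ[nhds x] fun _ => f x := by
    filter_upwards [hmax, hmin] with y h₁ h₂ using le_antisymm h₁ h₂
  have hzero : deriv (deriv f) x = 0 := by
    rw [hconst.deriv.deriv_eq]
    simp
  linarith

theorem hasDerivAt_sq_rpow {m : ℝ} (hm : 1 ≤ m) (y : ℝ) :
    HasDerivAt (fun z : ℝ => (z ^ 2) ^ m) (2 * m * ((y ^ 2) ^ (m - 1) * y)) y := by
  convert (hasDerivAt_pow 2 y).rpow_const (p := m) (Or.inr hm) using 1
  push_cast
  ring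

theorem hasDerivAt_sq_rpow_mul_self {s : ℝ} (hs : 0 < s) (y : ℝ) :
    HasDerivAt (fun z : ℝ => (z ^ 2) ^ s * z) ((2 * s + 1) * (y ^ 2) ^ s) y := by
  rcases eq_or_ne y 0 with rfl | hy
  · have hcont : Continuous fun z : ℝ => (z ^ 2) ^ s :=
      (continuous_pow 2).rpow_const fun _ => Or.inr hs.le
    rw [hasDerivAt_iff_tendsto_slope]
    have hlim : Filter.Tendsto (fun z : ℝ => (z ^ 2) ^ s) (nhdsWithin 0 {0}ᶜ)
        (nhds ((2 * s + 1) * ((0 : ℝ) ^ 2) ^ s)) := by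
      have h := (hcont.tendsto 0).mono_left (nhdsWithin_le_nhds (s := {0}ᶜ))
      simpa [Real.zero_rpow hs.ne'] using h
    refine hlim.congr' ?_
    filter_upwards [self_mem_nhdsWithin] with z hz
    have hz' : z ≠ 0 := hz
    simp [slope_def_field, hz']
  · have hy2 : y ^ 2 ≠ 0 := pow_ne_zero 2 hy
    refine (((hasDerivAt_pow 2 y).rpow_const (p := s) (Or.inl hy2)).mul
      (hasDerivAt_id y)).congr_deriv ?_
    rw [Real.rpow_sub_one hy2]
    push_cast
    simp only [id]
    field_simp

/-- The comparison function `M (|x - x₀| / R) ^ (2 / (1 - q))`. -/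
noncomputable def deadCoreBarrier (q M R x₀ x : ℝ) : ℝ :=
  M * (((x - x₀) / R) ^ 2) ^ (1 / (1 - q))

/-- The derivative of `deadCoreBarrier`. -/
noncomputable def deadCoreBarrierDeriv (q M R x₀ x : ℝ) : ℝ :=
  M * (2 * (1 / (1 - q)) *
    ((((x - x₀) / R) ^ 2) ^ (1 / (1 - q) - 1) * ((x - x₀) / R)) * (1 / R))

section Barrier

variable {q M R : ℝ} (x₀ x : ℝ)

theorem hasDerivAt_deadCoreBarrier (hq : q ∈ Set.Ioo (0 : ℝ) 1) :
    HasDerivAt (deadCoreBarrier q M R x₀) (deadCoreBarrierDeriv q M R x₀ x) x := by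
  have hm : 1 ≤ 1 / (1 - q) := by
    rw [le_div_iff₀ (by linarith [hq.2])]
    linarith [hq.1]
  have haff : HasDerivAt (fun x => (x - x₀) / R) (1 / R) x :=
    ((hasDerivAt_id x).sub_const x₀).div_const R
  exact ((hasDerivAt_sq_rpow hm ((x - x₀) / R)).comp x haff).const_mul M

/-- The barrier solves `w'' = M ^ (1 - q) / (C R²) * w ^ q` with `C = (1 - q)² / (2 (1 + q))`. -/
theorem hasDerivAt_deadCoreBarrierDeriv (hq : q ∈ Set.Ioo (0 : ℝ) 1) (hM : 0 < M) (hR : 0 < R) :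
    HasDerivAt (deadCoreBarrierDeriv q M R x₀)
      (M ^ (1 - q) / ((1 - q) ^ 2 / (2 * (1 + q)) * R ^ 2) * deadCoreBarrier q M R x₀ x ^ q)
      x := by
  have hq' : 0 < 1 - q := by linarith [hq.2]
  have hq1 : 0 < 1 + q := by linarith [hq.1]
  have hexp : 1 / (1 - q) - 1 = 1 / (1 - q) * q := by
    field_simp
    ring
  have hs : 0 < 1 / (1 - q) - 1 := by
    rw [hexp]
    exact mul_pos (one_div_pos.2 hq') hq.1
  have haff : HasDerivAt (fun x => (x - x₀) / R) (1 / R) x :=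
    ((hasDerivAt_id x).sub_const x₀).div_const R
  refine (((((hasDerivAt_sq_rpow_mul_self hs ((x - x₀) / R)).comp x haff).const_mul
    (2 * (1 / (1 - q)))).mul_const (1 / R)).const_mul M).congr_deriv ?_
  have hpow : deadCoreBarrier q M R x₀ x ^ q
      = M ^ q * (((x - x₀) / R) ^ 2) ^ (1 / (1 - q) - 1) := by
    rw [deadCoreBarrier, Real.mul_rpow hM.le (by positivity),
      ← Real.rpow_mul (sq_nonneg _), hexp]
  have hMM : M ^ (1 - q) * M ^ q = M := by
    rw [← Real.rpow_add hM]
    simp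
  rw [hpow]
  generalize (((x - x₀) / R) ^ 2) ^ (1 / (1 - q) - 1) = t
  rw [div_mul_eq_mul_div, ← mul_assoc (M ^ (1 - q)), hMM]
  field_simp
  ring

end Barrier

/-- One-dimensional dead-point theorem: if `0 ≤ u ≤ M` solves `-u'' = a(x) u^q` on
`[x₀ - R, x₀ + R]` with `a ≤ 0` and `-a ≥ M^(1-q)/(C_{1,q} R²)` on that interval, where
`C_{1,q} = (1-q)²/(2(1+q))`, then `u(x₀) = 0`. -/
theorem stmt_13 (q M R x₀ : ℝ) (hq : q ∈ Set.Ioo (0 : ℝ) 1) (hM : 0 < M) (hR : 0 < R)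
    (a u u' u'' : ℝ → ℝ)
    (ha : ContinuousOn a (Set.Icc (x₀ - R) (x₀ + R)))
    (haneg : ∀ x ∈ Set.Icc (x₀ - R) (x₀ + R), a x ≤ 0)
    (hd : ∀ x ∈ Set.Icc (x₀ - R) (x₀ + R),
      HasDerivWithinAt u (u' x) (Set.Icc (x₀ - R) (x₀ + R)) x)
    (hd' : ∀ x ∈ Set.Icc (x₀ - R) (x₀ + R),
      HasDerivWithinAt u' (u'' x) (Set.Icc (x₀ - R) (x₀ + R)) x)
    (hc : ContinuousOn u'' (Set.Icc (x₀ - R) (x₀ + R)))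
    (hnn : ∀ x ∈ Set.Icc (x₀ - R) (x₀ + R), 0 ≤ u x)
    (hub : ∀ x ∈ Set.Icc (x₀ - R) (x₀ + R), u x ≤ M)
    (heq : ∀ x ∈ Set.Icc (x₀ - R) (x₀ + R), -u'' x = a x * u x ^ q)
    (hbig : ∀ x ∈ Set.Icc (x₀ - R) (x₀ + R),
      M ^ (1 - q) / ((1 - q) ^ 2 / (2 * (1 + q)) * R ^ 2) ≤ -a x) :
    u x₀ = 0 := by
  have hsub : ∀ x ∈ Set.Icc (x₀ - R) (x₀ + R), u x ≤ deadCoreBarrier q M R x₀ x := by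
    have hcont : ContinuousOn (fun x => u x - deadCoreBarrier q M R x₀ x)
        (Set.Icc (x₀ - R) (x₀ + R)) := fun x hx =>
      (hd x hx).continuousWithinAt.sub
        (hasDerivAt_deadCoreBarrier x₀ x hq).continuousAt.continuousWithinAt
    obtain ⟨x₁, hx₁, hmax⟩ := isCompact_Icc.exists_isMaxOn
      (Set.nonempty_Icc.2 (by linarith)) hcont
    suffices h : u x₁ ≤ deadCoreBarrier q M R x₀ x₁ by
      intro x hx
      have := isMaxOn_iff.1 hmax x hx
      linarith
    by_contra! hlt
    have hend : ((x₁ - x₀) / R) ^ 2 ≠ 1 := by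
      intro h
      rw [deadCoreBarrier, h, Real.one_rpow, mul_one] at hlt
      exact (hub x₁ hx₁).not_gt hlt
    have hleft : x₁ ≠ x₀ - R := by
      rintro rfl
      apply hend
      field_simp
      ring
    have hright : x₁ ≠ x₀ + R := by
      rintro rfl
      apply hend
      field_simp
      ring
    have hint : x₁ ∈ Set.Ioo (x₀ - R) (x₀ + R) :=
      ⟨lt_of_le_of_ne hx₁.1 hleft.symm, lt_of_le_of_ne hx₁.2 hright⟩
    have hbar_nonneg : 0 ≤ deadCoreBarrier q M R x₀ x₁ := by
      unfold deadCoreBarrier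
      positivity
    have hK : 0 < M ^ (1 - q) / ((1 - q) ^ 2 / (2 * (1 + q)) * R ^ 2) := by
      have h₁ : 0 < 1 - q := by linarith [hq.2]
      have h₂ : 0 < 1 + q := by linarith [hq.1]
      positivity
    have hgap : 0 < u'' x₁ - M ^ (1 - q) / ((1 - q) ^ 2 / (2 * (1 + q)) * R ^ 2)
        * deadCoreBarrier q M R x₀ x₁ ^ q := by
      have h₁ := mul_lt_mul_of_pos_left (Real.rpow_lt_rpow hbar_nonneg hlt hq.1) hK
      have h₂ := mul_le_mul_of_nonneg_right (hbig x₁ hx₁) (Real.rpow_nonneg (hnn x₁ hx₁) q)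
      linarith [heq x₁ hx₁]
    refine not_isLocalMax_of_hasDerivAt_pos
      (f' := fun x => u' x - deadCoreBarrierDeriv q M R x₀ x) ?_ ?_ hgap
      (hmax.isLocalMax (Icc_mem_nhds hint.1 hint.2))
    · filter_upwards [Ioo_mem_nhds hint.1 hint.2] with y hy
      exact ((hd y (Set.Ioo_subset_Icc_self hy)).hasDerivAt (Icc_mem_nhds hy.1 hy.2)).sub
        (hasDerivAt_deadCoreBarrier x₀ y hq)
    · exact ((hd' x₁ hx₁).hasDerivAt (Icc_mem_nhds hint.1 hint.2)).sub
        (hasDerivAt_deadCoreBarrierDeriv x₀ x₁ hq hM hR)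
  have hmem : x₀ ∈ Set.Icc (x₀ - R) (x₀ + R) := ⟨by linarith, by linarith⟩
  have hcenter : deadCoreBarrier q M R x₀ x₀ = 0 := by
    have : (1 - q)⁻¹ ≠ 0 := inv_ne_zero (by linarith [hq.2])
    simp [deadCoreBarrier, Real.zero_rpow this]
  exact le_antisymm (hcenter ▸ hsub x₀ hmem) (hnn x₀ hmem)
end

section
/- (One-dimensional case: positive solutions exist for q close to 1.) Let L > 0 and let a : [0,L] → ℝ be continuous and change sign, and suppose there exist 0 < α < β < L such that a ≥ 0 on [α,β] and a is not identically zero on [α,β]. Then there exists q̄ = q̄(a) ∈ (0,1) such that for every q ∈ (q̄, 1) the Dirichlet problem (P_D) with weight a and exponent q has a positive solution (u > 0 on (0,L)). -/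
open Real Set

open Filter Topology MeasureTheory

/-- Arzelà–Ascoli for a uniformly bounded, equi-Lipschitz sequence on a compact interval. -/
theorem exists_subseq_tendsto_of_lipschitz {L K C : ℝ} (hL : 0 ≤ L) (f : ℕ → ℝ → ℝ)
    (hK : ∀ n, ∀ x ∈ Icc (0 : ℝ) L, ∀ y ∈ Icc (0 : ℝ) L, |f n x - f n y| ≤ K * |x - y|)
    (hC : ∀ n, ∀ x ∈ Icc (0 : ℝ) L, |f n x| ≤ C) :
    ∃ (φ : ℕ → ℕ) (g : ℝ → ℝ), StrictMono φ ∧ Continuous g ∧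
      ∀ x ∈ Icc (0 : ℝ) L, Tendsto (fun n => f (φ n) x) atTop (𝓝 (g x)) := by
  have hLip : ∀ n, LipschitzWith K.toNNReal (fun x : Icc (0 : ℝ) L => f n x) := by
    intro n
    refine LipschitzWith.of_dist_le_mul fun x y => ?_
    rw [Real.dist_eq, Subtype.dist_eq, Real.dist_eq]
    exact (hK n x x.2 y y.2).trans
      (mul_le_mul_of_nonneg_right (Real.le_coe_toNNReal K) (abs_nonneg _))
  let b : ℕ → BoundedContinuousFunction (Icc (0 : ℝ) L) ℝ := fun n =>
    BoundedContinuousFunction.mkOfCompact ⟨fun x => f n x, (hLip n).continuous⟩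
  have hcomp : IsCompact (closure (range b)) := by
    refine BoundedContinuousFunction.arzela_ascoli (Icc (-C) C) isCompact_Icc _ ?_ ?_
    · rintro _ x ⟨n, rfl⟩
      exact abs_le.mp (hC n x x.2)
    · refine (LipschitzWith.uniformEquicontinuous (K := K.toNNReal) _ ?_).equicontinuous
      rintro ⟨_, n, rfl⟩
      exact hLip n
  obtain ⟨g, -, φ, hφ, hg⟩ := hcomp.tendsto_subseq (x := b) fun n => subset_closure ⟨n, rfl⟩
  refine ⟨φ, IccExtend hL g, hφ, g.continuous.Icc_extend', fun x hx => ?_⟩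
  rw [IccExtend_of_mem hL g hx]
  exact (BoundedContinuousFunction.tendsto_iff_tendstoUniformly.mp hg).tendsto_at ⟨x, hx⟩

/-- Iterates of the delayed Volterra map whose fixed points solve the initial value problem
`u'' (x) = -F (x, u (x - δ))`, `u 0 = 0`, `u' 0 = s`. -/
noncomputable def delayedIterate (F : ℝ → ℝ → ℝ) (δ : ℝ) : ℕ → ℝ → ℝ → ℝ
  | 0 => fun _ _ => 0
  | m + 1 => fun s x =>
      ∫ t in (0 : ℝ)..x, (s - ∫ r in (0 : ℝ)..t, F r (delayedIterate F δ m s (max (r - δ) 0)))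

theorem continuous_delayedIterate {F : ℝ → ℝ → ℝ} (hF : Continuous (Function.uncurry F))
    (δ : ℝ) (m : ℕ) : Continuous (Function.uncurry (delayedIterate F δ m)) := by
  induction m with
  | zero => exact continuous_const
  | succ m ih =>
    have h1 : Continuous fun p : ℝ × ℝ =>
        ∫ r in (0 : ℝ)..p.2, F r (delayedIterate F δ m p.1 (max (r - δ) 0)) := by
      refine intervalIntegral.continuous_parametric_intervalIntegral_of_continuous
        (f := fun (p : ℝ × ℝ) r => F r (delayedIterate F δ m p.1 (max (r - δ) 0)))
        ?_ continuous_snd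
      refine hF.comp (continuous_snd.prodMk (ih.comp (f := fun z : (ℝ × ℝ) × ℝ =>
        (z.1.1, max (z.2 - δ) 0)) ?_))
      fun_prop
    refine intervalIntegral.continuous_parametric_intervalIntegral_of_continuous
      (f := fun (p : ℝ × ℝ) t => p.1 - ∫ r in (0 : ℝ)..t,
        F r (delayedIterate F δ m p.1 (max (r - δ) 0))) ?_ continuous_snd
    exact continuous_fst.fst.sub (h1.comp (f := fun z : (ℝ × ℝ) × ℝ => (z.1.1, z.2))
      (by fun_prop))

theorem delayedIterate_succ_eq (F : ℝ → ℝ → ℝ) {δ : ℝ} (hδ : 0 ≤ δ) (s : ℝ) (m : ℕ) :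
    ∀ x ∈ Icc (0 : ℝ) (m * δ), delayedIterate F δ (m + 1) s x = delayedIterate F δ m s x := by
  induction m with
  | zero =>
    intro x hx
    have : x = 0 := by simpa using hx
    simp [this, delayedIterate]
  | succ m ih =>
    intro x hx
    push_cast at hx
    rw [delayedIterate, delayedIterate]
    refine intervalIntegral.integral_congr fun t ht => ?_
    rw [uIcc_of_le hx.1] at ht
    congr 1
    refine intervalIntegral.integral_congr fun r hr => ?_
    rw [uIcc_of_le ht.1] at hr
    beta_reduce
    exact congrArg (F r) (ih (max (r - δ) 0)
      ⟨le_max_right _ _, max_le (by linarith [hr.2, ht.2, hx.2]) (by positivity)⟩)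

theorem abs_integral_le_of_abs_le {f : ℝ → ℝ} {B x L : ℝ} (hB : ∀ r, |f r| ≤ B)
    (hx : x ∈ Icc (0 : ℝ) L) : |∫ r in (0 : ℝ)..x, f r| ≤ B * L := by
  have hB0 : 0 ≤ B := (abs_nonneg _).trans (hB 0)
  refine (intervalIntegral.norm_integral_le_of_norm_le_const (f := f) (C := B)
    fun r _ => hB r).trans ?_
  rw [sub_zero, abs_of_nonneg hx.1]
  exact mul_le_mul_of_nonneg_left hx.2 hB0

/-- Primitive of a function bounded by `K` on `[0, L]`. -/
theorem abs_integral_sub_integral_le {f : ℝ → ℝ} (hf : Continuous f) {K L : ℝ}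
    (hK : ∀ t ∈ Icc (0 : ℝ) L, |f t| ≤ K) {x y : ℝ} (hx : x ∈ Icc (0 : ℝ) L)
    (hy : y ∈ Icc (0 : ℝ) L) :
    |(∫ t in (0 : ℝ)..x, f t) - ∫ t in (0 : ℝ)..y, f t| ≤ K * |x - y| := by
  rw [intervalIntegral.integral_interval_sub_left (hf.intervalIntegrable _ _)
    (hf.intervalIntegrable _ _)]
  refine intervalIntegral.norm_integral_le_of_norm_le_const (f := f) fun t ht => hK t ?_
  exact uIcc_subset_Icc hy hx (uIoc_subset_uIcc ht)

/-- Approximate solutions of the boundary value problem, with a delay `δ` in the right-hand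
side. -/
theorem exists_delayed_solution {L B δ : ℝ} (hL : 0 < L) (hδ : 0 < δ) {F : ℝ → ℝ → ℝ}
    (hF : Continuous (Function.uncurry F)) (hB : ∀ x y, |F x y| ≤ B) :
    ∃ s ∈ Icc (-(B * L)) (B * L), ∃ u : ℝ → ℝ, Continuous u ∧ u L = 0 ∧
      ∀ x ∈ Icc (0 : ℝ) L,
        u x = ∫ t in (0 : ℝ)..x, (s - ∫ r in (0 : ℝ)..t, F r (u (max (r - δ) 0))) := by
  obtain ⟨m, hm⟩ := exists_nat_ge (L / δ)
  rw [div_le_iff₀ hδ] at hm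
  have hcont := continuous_delayedIterate hF δ m
  have hc : ∀ s, Continuous (delayedIterate F δ m s) := fun s =>
    hcont.comp (f := fun x : ℝ => (s, x)) (by fun_prop)
  have heq : ∀ s, ∀ x ∈ Icc (0 : ℝ) L, delayedIterate F δ m s x =
      ∫ t in (0 : ℝ)..x, (s - ∫ r in (0 : ℝ)..t,
        F r (delayedIterate F δ m s (max (r - δ) 0))) := by
    intro s x hx
    rw [← delayedIterate_succ_eq F hδ.le s m x ⟨hx.1, hx.2.trans hm⟩, delayedIterate]
  have hB0 : 0 ≤ B := (abs_nonneg _).trans (hB 0 0)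
  have hsign : ∀ s, |delayedIterate F δ m s L - s * L| ≤ B * L * L := by
    intro s
    have hin : Continuous fun t => ∫ r in (0 : ℝ)..t,
        F r (delayedIterate F δ m s (max (r - δ) 0)) := by
      refine intervalIntegral.continuous_primitive (fun a b => Continuous.intervalIntegrable ?_ a b) 0
      exact hF.comp (continuous_id.prodMk ((hc s).comp (by fun_prop)))
    rw [heq s L ⟨hL.le, le_rfl⟩, intervalIntegral.integral_sub (by simp)
      (hin.intervalIntegrable _ _), intervalIntegral.integral_const, smul_eq_mul, sub_zero,
      show ∀ z : ℝ, L * s - z - s * L = -z by intro z; ring, abs_neg]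
    have := abs_integral_sub_integral_le hin (K := B * L) (L := L)
      (fun t ht => abs_integral_le_of_abs_le (fun r => hB _ _) ht) (x := L) (y := 0)
      ⟨hL.le, le_rfl⟩ ⟨le_rfl, hL.le⟩
    simpa [abs_of_pos hL] using this
  have hivt : (0 : ℝ) ∈ (fun s => delayedIterate F δ m s L) '' Icc (-(B * L)) (B * L) := by
    refine intermediate_value_Icc (by nlinarith [mul_nonneg hB0 hL.le])
      (Continuous.continuousOn (hcont.comp (f := fun s : ℝ => (s, L)) (by fun_prop))) ⟨?_, ?_⟩
    · have := (abs_le.mp (hsign (-(B * L)))).2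
      change delayedIterate F δ m (-(B * L)) L ≤ 0
      linarith
    · have := (abs_le.mp (hsign (B * L))).1
      change 0 ≤ delayedIterate F δ m (B * L) L
      linarith
  obtain ⟨s, hs, hs0⟩ := hivt
  exact ⟨s, hs, delayedIterate F δ m s, hc s, hs0, heq s⟩

/-- Two-point boundary value problem with a bounded continuous right-hand side. -/
theorem exists_dirichlet_solution_of_bounded {L B : ℝ} (hL : 0 < L) {F : ℝ → ℝ → ℝ}
    (hF : Continuous (Function.uncurry F)) (hB : ∀ x y, |F x y| ≤ B) :
    ∃ u v : ℝ → ℝ, (∀ x, HasDerivAt u (v x) x) ∧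
      (∀ x ∈ Icc (0 : ℝ) L, HasDerivAt v (-F x (u x)) x) ∧ u 0 = 0 ∧ u L = 0 ∧
      ∀ x ∈ Icc (0 : ℝ) L, |u x| ≤ 2 * B * L * L := by
  have hB0 : 0 ≤ B := (abs_nonneg _).trans (hB 0 0)
  have h0mem : (0 : ℝ) ∈ Icc (0 : ℝ) L := ⟨le_rfl, hL.le⟩
  have hδ : ∀ n : ℕ, (0 : ℝ) < 1 / ((n : ℝ) + 1) := fun n => Nat.one_div_pos_of_nat
  choose s hs u hu huL heq using fun n : ℕ => exists_delayed_solution hL (hδ n) hF hB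
  set d : ℕ → ℝ := fun n => 1 / ((n : ℝ) + 1) with hd
  have hcF : ∀ n, Continuous fun r => F r (u n (max (r - d n) 0)) := fun n =>
    hF.comp (continuous_id.prodMk ((hu n).comp (by fun_prop)))
  have hcP : ∀ n, Continuous fun t => ∫ r in (0 : ℝ)..t, F r (u n (max (r - d n) 0)) := fun n =>
    intervalIntegral.continuous_primitive (fun a b => (hcF n).intervalIntegrable a b) 0
  have hv : ∀ n, ∀ t ∈ Icc (0 : ℝ) L,
      |s n - ∫ r in (0 : ℝ)..t, F r (u n (max (r - d n) 0))| ≤ 2 * B * L := by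
    intro n t ht
    have h1 := abs_integral_le_of_abs_le (f := fun r => F r (u n (max (r - d n) 0)))
      (fun r => hB _ _) ht
    have h2 := abs_le.mpr (hs n)
    linarith [abs_sub (s n) (∫ r in (0 : ℝ)..t, F r (u n (max (r - d n) 0)))]
  have hLip : ∀ n, ∀ x ∈ Icc (0 : ℝ) L, ∀ y ∈ Icc (0 : ℝ) L,
      |u n x - u n y| ≤ 2 * B * L * |x - y| := by
    intro n x hx y hy
    rw [heq n x hx, heq n y hy]
    exact abs_integral_sub_integral_le (continuous_const.sub (hcP n)) (hv n) hx hy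
  have hu0 : ∀ n, u n 0 = 0 := fun n => by rw [heq n 0 h0mem]; simp
  have hbd : ∀ n, ∀ x ∈ Icc (0 : ℝ) L, |u n x| ≤ 2 * B * L * L := by
    intro n x hx
    have := hLip n x hx 0 h0mem
    rw [hu0, sub_zero, sub_zero, abs_of_nonneg hx.1] at this
    exact this.trans (mul_le_mul_of_nonneg_left hx.2 (by positivity))
  obtain ⟨s0, -, φ₁, hφ₁, hs0⟩ := isCompact_Icc.tendsto_subseq hs
  obtain ⟨φ₂, g, hφ₂, hg, hlim⟩ := exists_subseq_tendsto_of_lipschitz hL.le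
    (fun n => u (φ₁ n)) (fun n => hLip (φ₁ n)) (fun n => hbd (φ₁ n))
  set ψ : ℕ → ℕ := φ₁ ∘ φ₂ with hψ
  have hψt : Tendsto ψ atTop atTop := (hφ₁.comp hφ₂).tendsto_atTop
  have hsψ : Tendsto (fun n => s (ψ n)) atTop (𝓝 s0) := hs0.comp hφ₂.tendsto_atTop
  have hdψ : Tendsto (fun n => d (ψ n)) atTop (𝓝 0) :=
    (tendsto_one_div_add_atTop_nhds_zero_nat (𝕜 := ℝ)).comp hψt
  have hshift : ∀ r ∈ Icc (0 : ℝ) L,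
      Tendsto (fun n => u (ψ n) (max (r - d (ψ n)) 0)) atTop (𝓝 (g r)) := by
    intro r hr
    have hdiff : Tendsto (fun n => u (ψ n) (max (r - d (ψ n)) 0) - u (ψ n) r) atTop (𝓝 0) := by
      refine squeeze_zero_norm (a := fun n => 2 * B * L * d (ψ n)) (fun n => ?_)
        (by simpa using hdψ.const_mul (2 * B * L))
      have hdn : 0 < d (ψ n) := hδ _
      refine (hLip (ψ n) _ ⟨le_max_right _ _, max_le (by linarith [hr.2]) hL.le⟩ r hr).trans ?_
      refine mul_le_mul_of_nonneg_left ?_ (by positivity)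
      rw [abs_le]
      constructor
      · linarith [le_max_left (r - d (ψ n)) 0]
      · linarith [max_le (by linarith : r - d (ψ n) ≤ r) hr.1]
    simpa [hψ] using hdiff.add (hlim r hr)
  have hcFg : Continuous fun r => F r (g r) := hF.comp (continuous_id.prodMk hg)
  have hinner : ∀ t ∈ Icc (0 : ℝ) L,
      Tendsto (fun n => s (ψ n) - ∫ r in (0 : ℝ)..t, F r (u (ψ n) (max (r - d (ψ n)) 0))) atTop
        (𝓝 (s0 - ∫ r in (0 : ℝ)..t, F r (g r))) := by
    intro t ht
    refine hsψ.sub (intervalIntegral.tendsto_integral_filter_of_dominated_convergence (fun _ => B)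
      (Eventually.of_forall fun n => (hcF _).aestronglyMeasurable)
      (Eventually.of_forall fun n => ae_of_all _ fun r _ => hB _ _) intervalIntegrable_const
      (ae_of_all _ fun r hr => ?_))
    have hr' := uIcc_subset_Icc h0mem ht (uIoc_subset_uIcc hr)
    exact (hF.tendsto (r, g r)).comp (tendsto_const_nhds.prodMk_nhds (hshift r hr'))
  have hcv : Continuous fun t => s0 - ∫ r in (0 : ℝ)..t, F r (g r) :=
    continuous_const.sub
      (intervalIntegral.continuous_primitive (fun a b => hcFg.intervalIntegrable a b) 0)
  have hgeq : ∀ x ∈ Icc (0 : ℝ) L,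
      g x = ∫ t in (0 : ℝ)..x, (s0 - ∫ r in (0 : ℝ)..t, F r (g r)) := by
    intro x hx
    refine tendsto_nhds_unique (hlim x hx) ?_
    simp only [fun n => heq (φ₁ (φ₂ n)) x hx]
    refine intervalIntegral.tendsto_integral_filter_of_dominated_convergence (fun _ => 2 * B * L)
      (Eventually.of_forall fun n => (continuous_const.sub (hcP _)).aestronglyMeasurable)
      (Eventually.of_forall fun n => ae_of_all _ fun t ht => hv _ t
        (uIcc_subset_Icc h0mem hx (uIoc_subset_uIcc ht))) intervalIntegrable_const
      (ae_of_all _ fun t ht => hinner t (uIcc_subset_Icc h0mem hx (uIoc_subset_uIcc ht)))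
  refine ⟨fun x => ∫ t in (0 : ℝ)..x, (s0 - ∫ r in (0 : ℝ)..t, F r (g r)),
    fun t => s0 - ∫ r in (0 : ℝ)..t, F r (g r), fun x => ?_, fun x hx => ?_, by simp, ?_,
    fun x hx => ?_⟩
  · exact (hcv.integral_hasStrictDerivAt 0 x).hasDerivAt
  · beta_reduce
    rw [← hgeq x hx]
    exact (hcFg.integral_hasStrictDerivAt 0 x).hasDerivAt.const_sub s0
  · beta_reduce
    rw [← hgeq L ⟨hL.le, le_rfl⟩]
    refine tendsto_nhds_unique (hlim L ⟨hL.le, le_rfl⟩) ?_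
    simp [huL]
  · beta_reduce
    rw [← hgeq x hx]
    exact le_of_tendsto (hlim x hx).abs (Eventually.of_forall fun n => hbd _ x hx)

/-- Necessary second-order condition at a local minimum. -/
theorem IsLocalMin.second_hasDerivAt_nonneg {g g' : ℝ → ℝ} {d x₀ : ℝ} (hmin : IsLocalMin g x₀)
    (hg : ∀ y, HasDerivAt g (g' y) y) (hg' : HasDerivAt g' d x₀) : 0 ≤ d := by
  by_contra! hd
  have hderiv : deriv g = g' := funext fun y => (hg y).deriv
  have hmax : IsLocalMax g x₀ := isLocalMax_of_deriv_deriv_neg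
    (by rwa [hderiv, hg'.deriv]) hmin.deriv_eq_zero (hg x₀).continuousAt
  have hconst : g =ᶠ[𝓝 x₀] fun _ => g x₀ := by
    filter_upwards [hmin, hmax] with y h1 h2 using le_antisymm h2 h1
  have hzero : g' =ᶠ[𝓝 x₀] fun _ => 0 := by
    have := hconst.deriv
    rwa [hderiv, deriv_const'] at this
  have := hzero.deriv_eq
  rw [hg'.deriv, deriv_const] at this
  exact hd.ne this

/-- A strict subsolution which is positive inside the interval lies below a solution. The
subsolution `w` may have corners: it only has to be touched from below by `C²` strict
subsolutions. -/
theorem exists_positive_solution_of_subsolution {L q : ℝ} (hL : 0 < L) (hq0 : 0 < q) (hq1 : q < 1)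
    {a w : ℝ → ℝ} (ha : ContinuousOn a (Icc 0 L)) (hw : Continuous w) (hw0 : w 0 = 0)
    (hwL : w L = 0) (hwpos : ∀ x ∈ Ioo (0 : ℝ) L, 0 < w x)
    (hsub : ∀ x ∈ Ioo (0 : ℝ) L, ∃ (f f' : ℝ → ℝ) (d : ℝ), f x = w x ∧ (∀ᶠ y in 𝓝 x, f y ≤ w y) ∧
      (∀ y, HasDerivAt f (f' y) y) ∧ HasDerivAt f' d x ∧ -d < a x * w x ^ q) :
    ∃ u u' u'' : ℝ → ℝ, DirichletSolution L q a u u' u'' ∧ ∀ x ∈ Ioo (0 : ℝ) L, 0 < u x := by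
  obtain ⟨M, hM⟩ := isCompact_Icc.exists_bound_of_continuousOn ha
  obtain ⟨W, hW⟩ := isCompact_Icc.exists_bound_of_continuousOn (hw.continuousOn (s := Icc 0 L))
  have hw_nonneg : ∀ x ∈ Icc (0 : ℝ) L, 0 ≤ w x := by
    intro x hx
    rcases hx.1.eq_or_lt with h | h
    · rw [← h, hw0]
    rcases hx.2.eq_or_lt with h' | h'
    · rw [h', hwL]
    exact (hwpos x ⟨h, h'⟩).le
  obtain ⟨N, hNW, hN0, hNM⟩ := ((eventually_ge_atTop W).and ((eventually_gt_atTop 0).and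
    ((tendsto_rpow_atTop (sub_pos.mpr hq1)).eventually_ge_atTop (2 * M * L * L)))).exists
  have hM0 : 0 ≤ M := (norm_nonneg _).trans (hM 0 ⟨le_rfl, hL.le⟩)
  set aE : ℝ → ℝ := IccExtend hL.le ((Icc 0 L).domRestrict a) with haE
  have haEc : Continuous aE := (continuousOn_iff_continuous_domRestrict.mp ha).Icc_extend'
  have haEeq : ∀ x ∈ Icc (0 : ℝ) L, aE x = a x := fun x hx => IccExtend_of_mem _ _ hx
  have haEM : ∀ x, |aE x| ≤ M := fun x => hM _ (projIcc 0 L hL.le x).2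
  set F : ℝ → ℝ → ℝ := fun x t => aE x * (max 0 (min N (max t (w x)))) ^ q with hFdef
  have hF : Continuous (Function.uncurry F) := by
    refine (haEc.comp continuous_fst).mul (Continuous.rpow_const ?_ fun _ => Or.inr hq0.le)
    fun_prop
  have hFB : ∀ x t, |F x t| ≤ M * N ^ q := by
    intro x t
    have h0 : 0 ≤ max 0 (min N (max t (w x))) := le_max_left _ _
    rw [hFdef, abs_mul, abs_of_nonneg (rpow_nonneg h0 q)]
    exact mul_le_mul (haEM x) (rpow_le_rpow h0 (max_le hN0.le (min_le_left _ _)) hq0.le)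
      (rpow_nonneg h0 q) hM0
  obtain ⟨u, v, hu, hv, hu0, huL, hbd⟩ := exists_dirichlet_solution_of_bounded hL hF hFB
  have huN : ∀ x ∈ Icc (0 : ℝ) L, u x ≤ N := by
    intro x hx
    refine (le_abs_self _).trans ((hbd x hx).trans ?_)
    calc 2 * (M * N ^ q) * L * L = N ^ q * (2 * M * L * L) := by ring
      _ ≤ N ^ q * N ^ (1 - q) := mul_le_mul_of_nonneg_left hNM (rpow_nonneg hN0.le q)
      _ = N := by rw [← rpow_add hN0]; simp
  have hwN : ∀ x ∈ Icc (0 : ℝ) L, w x ≤ N := fun x hx =>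
    ((le_abs_self _).trans (hW x hx)).trans hNW
  have huw : ∀ x ∈ Icc (0 : ℝ) L, w x ≤ u x := by
    have huc : Continuous u := continuous_iff_continuousAt.mpr fun x => (hu x).continuousAt
    obtain ⟨x₀, hx₀, hmin⟩ := isCompact_Icc.exists_isMinOn (nonempty_Icc.mpr hL.le)
      ((huc.sub hw).continuousOn (s := Icc 0 L))
    suffices h : w x₀ ≤ u x₀ by
      intro x hx
      have := hmin hx
      simp only [mem_ofPred_eq, Pi.sub_apply] at this
      linarith
    by_contra! hlt
    have hx₀' : x₀ ∈ Ioo (0 : ℝ) L := by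
      refine ⟨hx₀.1.lt_of_ne' ?_, hx₀.2.lt_of_ne ?_⟩
      · rintro rfl
        linarith
      · rintro rfl
        linarith
    obtain ⟨f, f', d, hfx, hfw, hf, hf', hd⟩ := hsub x₀ hx₀'
    have hloc : IsLocalMin (u - f) x₀ := by
      filter_upwards [hfw, Icc_mem_nhds hx₀'.1 hx₀'.2] with y hy hyI
      have := hmin hyI
      simp only [mem_ofPred_eq, Pi.sub_apply] at this ⊢
      linarith
    have h2 := hloc.second_hasDerivAt_nonneg (g' := v - f') (fun y => (hu y).sub (hf y))
      ((hv x₀ hx₀).sub hf')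
    have hFx : F x₀ (u x₀) = a x₀ * w x₀ ^ q := by
      simp only [hFdef]
      rw [max_eq_right hlt.le, min_eq_right (hwN _ hx₀), max_eq_right (hw_nonneg _ hx₀),
        haEeq _ hx₀]
    rw [hFx] at h2
    linarith
  have hFu : ∀ x ∈ Icc (0 : ℝ) L, F x (u x) = a x * u x ^ q := by
    intro x hx
    simp only [hFdef]
    rw [max_eq_left (huw x hx), min_eq_right (huN x hx),
      max_eq_right ((hw_nonneg x hx).trans (huw x hx)), haEeq x hx]
  have huc : Continuous u := continuous_iff_continuousAt.mpr fun x => (hu x).continuousAt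
  refine ⟨u, v, fun x => -F x (u x), ⟨fun x _ => (hu x).hasDerivWithinAt,
    fun x hx => (hv x hx).hasDerivWithinAt,
    (hF.comp (continuous_id.prodMk huc)).neg.continuousOn,
    fun x hx => (hw_nonneg x hx).trans (huw x hx), hu0, huL, fun x hx => ?_⟩,
    fun x hx => (hwpos x hx).trans_le (huw x (Ioo_subset_Icc_self hx))⟩
  rw [neg_neg, hFu x hx]

/-- Strict subsolution inequality for the profile `D * (exp (k x) - 1)`, with `E = exp (k x)`. -/
theorem mul_rpow_lt_of_exp_profile {M D k q E : ℝ} (hM : 0 ≤ M) (hD : 0 < D) (hq0 : 0 < q)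
    (hq1 : q < 1) (hE : 1 ≤ E) (hDk : M < D ^ (1 - q) * k ^ 2) :
    M * (D * (E - 1)) ^ q < D * k ^ 2 * E := by
  have hE0 : 0 < E := by linarith
  have hDq : 0 < D ^ q := rpow_pos_of_pos hD q
  have h1 : (D * (E - 1)) ^ q ≤ D ^ q * E := by
    calc (D * (E - 1)) ^ q ≤ (D * E) ^ q :=
          rpow_le_rpow (mul_nonneg hD.le (by linarith))
            (mul_le_mul_of_nonneg_left (by linarith) hD.le) hq0.le
      _ = D ^ q * E ^ q := mul_rpow hD.le hE0.le
      _ ≤ D ^ q * E ^ (1 : ℝ) :=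
          mul_le_mul_of_nonneg_left (rpow_le_rpow_of_exponent_le hE hq1.le) hDq.le
      _ = D ^ q * E := by rw [rpow_one]
  calc M * (D * (E - 1)) ^ q ≤ M * (D ^ q * E) := mul_le_mul_of_nonneg_left h1 hM
    _ = D ^ q * E * M := by ring
    _ < D ^ q * E * (D ^ (1 - q) * k ^ 2) := mul_lt_mul_of_pos_left hDk (mul_pos hDq hE0)
    _ = (D ^ q * D ^ (1 - q)) * k ^ 2 * E := by ring
    _ = D * k ^ 2 * E := by rw [← rpow_add hD]; simp

/-- On the left of `α` the parabola through `(α, 1)` with slope `2 k` lies below the normalized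
exponential profile vanishing at `0`. -/
theorem parabola_le_exp_profile {k l r x : ℝ} (hl : 0 < l) (hr : 0 < r) (hkl : 1 ≤ k * l)
    (hx : x ≤ l) :
    1 + 2 * k / r * ((x - l) * (l + r - x)) ≤ (exp (k * x) - 1) / (exp (k * l) - 1) := by
  have hk : 0 < k := pos_of_mul_pos_left (by linarith) hl.le
  have hE : 2 ≤ exp (k * l) := by linarith [add_one_le_exp (k * l)]
  have h1 : 1 + 2 * k / r * ((x - l) * (l + r - x)) ≤ 1 + 2 * k * (x - l) := by
    have : 2 * k / r * ((x - l) * (l + r - x)) = 2 * k * (x - l) - 2 * k / r * (x - l) ^ 2 := by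
      field_simp
      ring
    have h' : 0 ≤ 2 * k / r * (x - l) ^ 2 := by positivity
    linarith
  refine h1.trans ?_
  rw [le_div_iff₀ (by linarith)]
  have h2 : exp (k * l) * (1 + k * (x - l)) ≤ exp (k * x) := by
    have : exp (k * x) = exp (k * l) * exp (k * (x - l)) := by rw [← exp_add]; ring_nf
    rw [this]
    exact mul_le_mul_of_nonneg_left (by linarith [add_one_le_exp (k * (x - l))]) (exp_pos _).le
  nlinarith [mul_nonneg (mul_nonneg hk.le (sub_nonneg.mpr hx)) (sub_nonneg.mpr hE)]

theorem exists_forall_half_lt_rpow_one_sub {A B : ℝ} (hA : 0 < A) (hB : 0 < B) :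
    ∃ qbar ∈ Ioo (0 : ℝ) 1, ∀ q, qbar < q → q < 1 →
      1 / 2 < A ^ (1 - q) ∧ 1 / 2 < B ^ (1 - q) := by
  have key : ∀ {C : ℝ}, 0 < C → ∀ᶠ q in 𝓝[<] (1 : ℝ), 1 / 2 < C ^ (1 - q) := by
    intro C hC
    have hc : ContinuousAt (fun q : ℝ => C ^ (1 - q)) 1 :=
      (continuousAt_const_rpow hC.ne').comp (by fun_prop : ContinuousAt (fun q : ℝ => 1 - q) 1)
    refine (hc.eventually (lt_mem_nhds ?_)).filter_mono nhdsWithin_le_nhds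
    norm_num
  obtain ⟨l, hl, hsub⟩ := mem_nhdsLT_iff_exists_Ioo_subset.mp ((key hA).and (key hB))
  refine ⟨max l (1 / 2), ⟨by positivity, max_lt hl (by norm_num)⟩, fun q h1 h2 => ?_⟩
  exact hsub ⟨(le_max_left _ _).trans_lt h1, h2⟩

/-- Existence for `q` close to `1`, when the weight is bounded below by a positive constant on
`[α, β]`. -/
theorem exists_positive_solution_of_lower_bound {L α β a₀ : ℝ} (hα : 0 < α) (hαβ : α < β)
    (hβL : β < L) (ha₀ : 0 < a₀) {a : ℝ → ℝ} (ha : ContinuousOn a (Icc 0 L))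
    (hlow : ∀ x ∈ Icc α β, a₀ ≤ a x) :
    ∃ qbar ∈ Ioo (0 : ℝ) 1, ∀ q, qbar < q → q < 1 →
      ∃ u u' u'' : ℝ → ℝ, DirichletSolution L q a u u' u'' ∧ ∀ x ∈ Ioo (0 : ℝ) L, 0 < u x := by
  have hL : 0 < L := by linarith
  have hr : 0 < β - α := by linarith
  have hγ : 0 < L - β := by linarith
  obtain ⟨M, hM⟩ := isCompact_Icc.exists_bound_of_continuousOn ha
  have hM0 : 0 < M := ha₀.trans_le ((hlow α ⟨le_rfl, hαβ.le⟩).trans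
    ((le_abs_self _).trans (hM α ⟨hα.le, by linarith⟩)))
  have haM : ∀ x ∈ Icc (0 : ℝ) L, -M ≤ a x := fun x hx => (abs_le.mp (hM x hx)).1
  obtain ⟨k, hk0, hkα, hkγ, hkr⟩ : ∃ k : ℝ, 0 < k ∧ 1 ≤ k * α ∧ 1 ≤ k * (L - β) ∧
      8 * M < a₀ * (k * (β - α)) := by
    refine ⟨1 / α + 1 / (L - β) + 8 * M / (a₀ * (β - α)), by positivity, ?_, ?_, ?_⟩
    · have : 0 ≤ (1 / (L - β) + 8 * M / (a₀ * (β - α))) * α := by positivity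
      have h1 : 1 / α * α = 1 := by field_simp
      linarith
    · have : 0 ≤ (1 / α + 8 * M / (a₀ * (β - α))) * (L - β) := by positivity
      have h1 : 1 / (L - β) * (L - β) = 1 := by field_simp
      linarith
    · have : 0 < (1 / α + 1 / (L - β)) * (a₀ * (β - α)) := by positivity
      have h1 : 8 * M / (a₀ * (β - α)) * (a₀ * (β - α)) = 8 * M := by field_simp
      linarith
  have hEα : 0 < exp (k * α) - 1 := by linarith [add_one_le_exp (k * α)]
  have hEγ : 0 < exp (k * (L - β)) - 1 := by linarith [add_one_le_exp (k * (L - β))]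
  obtain ⟨qbar, hqbar, hq⟩ := exists_forall_half_lt_rpow_one_sub (inv_pos.mpr hEα)
    (inv_pos.mpr hEγ)
  refine ⟨qbar, hqbar, fun q hq1 hq2 => ?_⟩
  obtain ⟨hA, hB⟩ := hq q hq1 hq2
  have hq0 : 0 < q := hqbar.1.trans hq1
  obtain ⟨c, hc0, hc⟩ : ∃ c : ℝ, 0 < c ∧ c ^ (1 - q) = 2 * M / k ^ 2 := by
    refine ⟨(2 * M / k ^ 2) ^ (1 - q)⁻¹, by positivity, ?_⟩
    rw [← rpow_mul (by positivity), inv_mul_cancel₀ (by linarith), rpow_one]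
  have hcA : ∀ {A : ℝ}, 0 < A → 1 / 2 < A ^ (1 - q) → M < (c * A) ^ (1 - q) * k ^ 2 := by
    intro A hA0 hA
    rw [mul_rpow hc0.le hA0.le, hc]
    have : 2 * M / k ^ 2 * A ^ (1 - q) * k ^ 2 = 2 * M * A ^ (1 - q) := by field_simp
    rw [this]
    nlinarith
  set A : ℝ := (exp (k * α) - 1)⁻¹ with hAdef
  set B : ℝ := (exp (k * (L - β)) - 1)⁻¹ with hBdef
  have hA0 : 0 < A := inv_pos.mpr hEα
  have hB0 : 0 < B := inv_pos.mpr hEγ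
  set f₁ : ℝ → ℝ := fun x => c * A * (exp (k * x) - 1) with hf₁
  set f₂ : ℝ → ℝ := fun x => c * B * (exp (k * (L - x)) - 1) with hf₂
  set f₃ : ℝ → ℝ := fun x => c * (1 + 2 * k / (β - α) * ((x - α) * (β - x))) with hf₃
  have h₁α : f₁ α = f₃ α := by
    simp only [hf₁, hf₃, hAdef]
    field_simp
    ring
  have h₂β : f₂ β = f₃ β := by
    simp only [hf₂, hf₃, hBdef]
    field_simp
    ring
  have h₃₁ : ∀ x ≤ α, f₃ x ≤ f₁ x := by
    intro x hx
    have := mul_le_mul_of_nonneg_left (parabola_le_exp_profile hα hr hkα hx) hc0.le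
    simp only [hf₁, hf₃, hAdef]
    rw [show α + (β - α) - x = β - x by ring] at this
    rwa [mul_assoc, mul_comm (exp (k * α) - 1)⁻¹, ← div_eq_mul_inv]
  have h₃₂ : ∀ x, β ≤ x → f₃ x ≤ f₂ x := by
    intro x hx
    have := mul_le_mul_of_nonneg_left (parabola_le_exp_profile hγ hr hkγ
      (by linarith : L - x ≤ L - β)) hc0.le
    simp only [hf₂, hf₃, hBdef]
    rw [show (L - x - (L - β)) * (L - β + (β - α) - (L - x)) = (x - α) * (β - x) by ring] at this
    rwa [mul_assoc, mul_comm (exp (k * (L - β)) - 1)⁻¹, ← div_eq_mul_inv]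
  have h₃c : ∀ x ∈ Icc α β, c ≤ f₃ x := by
    intro x hx
    have : 0 ≤ 2 * k / (β - α) * ((x - α) * (β - x)) :=
      mul_nonneg (by positivity) (mul_nonneg (by linarith [hx.1]) (by linarith [hx.2]))
    simp only [hf₃]
    nlinarith
  set w : ℝ → ℝ := fun x => if x ≤ α then f₁ x else if x ≤ β then f₃ x else f₂ x with hwdef
  have hw : Continuous w := by
    refine Continuous.if_le (by fun_prop) (Continuous.if_le (by fun_prop) (by fun_prop)
      continuous_id continuous_const ?_) continuous_id continuous_const ?_
    · rintro x rfl
      exact h₂β.symm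
    · rintro x rfl
      simp only [hαβ.le, if_true]
      exact h₁α
  have hw₁ : ∀ x ≤ α, w x = f₁ x := fun x hx => if_pos hx
  have hw₂ : ∀ x, β < x → w x = f₂ x := fun x hx => by
    simp only [hwdef, if_neg (hαβ.trans hx).not_ge, if_neg hx.not_ge]
  have hw₃ : ∀ x ∈ Icc α β, w x = f₃ x := by
    intro x hx
    rcases hx.1.eq_or_lt with h | h
    · rw [← h, hw₁ α le_rfl, h₁α]
    · simp only [hwdef, if_neg h.not_ge, if_pos hx.2]
  refine exists_positive_solution_of_subsolution hL hq0 hq2 ha hw ?_ ?_ ?_ ?_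
  · rw [hw₁ 0 hα.le]
    simp [hf₁]
  · rw [hw₂ L hβL]
    simp [hf₂]
  · intro x hx
    rcases le_or_gt x α with h | h
    · rw [hw₁ x h]
      have : 0 < exp (k * x) - 1 := by linarith [one_lt_exp_iff.mpr (mul_pos hk0 hx.1)]
      simp only [hf₁]
      positivity
    rcases le_or_gt x β with h' | h'
    · rw [hw₃ x ⟨h.le, h'⟩]
      exact hc0.trans_le (h₃c x ⟨h.le, h'⟩)
    · rw [hw₂ x h']
      have : 0 < exp (k * (L - x)) - 1 := by
        linarith [one_lt_exp_iff.mpr (mul_pos hk0 (sub_pos.mpr hx.2))]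
      simp only [hf₂]
      positivity
  · intro x hx
    have hxI := Ioo_subset_Icc_self hx
    rcases lt_or_ge x α with h | h
    · refine ⟨f₁, fun y => c * A * (exp (k * y) * k), c * A * (exp (k * x) * k * k),
        (hw₁ x h.le).symm, ?_, fun y => ?_, ?_, ?_⟩
      · filter_upwards [Iio_mem_nhds h] with y hy using (hw₁ y (le_of_lt hy)).ge
      · have := ((hasDerivAt_id y).const_mul k).exp
        simpa [hf₁] using (this.sub_const 1).const_mul (c * A)
      · have := ((hasDerivAt_id x).const_mul k).exp
        simpa using (this.mul_const k).const_mul (c * A)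
      · have h1 : 1 ≤ exp (k * x) := one_le_exp (mul_nonneg hk0.le hxI.1)
        have := mul_rpow_lt_of_exp_profile hM0.le (mul_pos hc0 hA0) hq0 hq2 h1 (hcA hA0 hA)
        rw [hw₁ x h.le]
        have h2 : 0 ≤ f₁ x ^ q := rpow_nonneg
          (mul_nonneg (mul_pos hc0 hA0).le (by linarith)) q
        have h3 := mul_le_mul_of_nonneg_right (haM x hxI) h2
        simp only [hf₁] at h3 ⊢
        linarith
    rcases le_or_gt x β with h' | h'
    · refine ⟨f₃, fun y => c * (2 * k / (β - α) * (α + β - 2 * y)),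
        c * (2 * k / (β - α) * (-2)), (hw₃ x ⟨h, h'⟩).symm, ?_, fun y => ?_, ?_, ?_⟩
      · refine Eventually.of_forall fun y => ?_
        rcases le_or_gt y α with hy | hy
        · exact (h₃₁ y hy).trans (hw₁ y hy).ge
        rcases le_or_gt y β with hy' | hy'
        · exact (hw₃ y ⟨hy.le, hy'⟩).ge
        · exact (h₃₂ y hy'.le).trans (hw₂ y hy').ge
      · have := ((((hasDerivAt_id y).sub_const α).mul ((hasDerivAt_id y).const_sub β)).const_mul
          (2 * k / (β - α))).const_add 1 |>.const_mul c
        convert! this using 1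
        simp only [id]
        ring
      · have := ((((hasDerivAt_id x).const_mul 2).const_sub (α + β)).const_mul
          (2 * k / (β - α))).const_mul c
        simpa using this
      · rw [hw₃ x ⟨h, h'⟩]
        have hcq : 0 < c ^ q := rpow_pos_of_pos hc0 q
        have hcc : c = c ^ q * (2 * M / k ^ 2) := by
          rw [← hc, ← rpow_add hc0]
          simp
        calc -(c * (2 * k / (β - α) * (-2)))
            = c ^ q * (2 * M / k ^ 2) * (4 * k / (β - α)) := by rw [← hcc]; ring
          _ = c ^ q * (8 * M / (k * (β - α))) := by field_simp; ring
          _ < c ^ q * a₀ := by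
              refine mul_lt_mul_of_pos_left ?_ hcq
              rwa [div_lt_iff₀ (mul_pos hk0 hr)]
          _ = a₀ * c ^ q := mul_comm _ _
          _ ≤ a x * f₃ x ^ q := mul_le_mul (hlow x ⟨h, h'⟩)
              (rpow_le_rpow hc0.le (h₃c x ⟨h, h'⟩) hq0.le) hcq.le
              (ha₀.le.trans (hlow x ⟨h, h'⟩))
    · refine ⟨f₂, fun y => c * B * (exp (k * (L - y)) * -k), c * B * (exp (k * (L - x)) * k * k),
        (hw₂ x h').symm, ?_, fun y => ?_, ?_, ?_⟩
      · filter_upwards [Ioi_mem_nhds h'] with y hy using (hw₂ y hy).ge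
      · have := (((hasDerivAt_id y).const_sub L).const_mul k).exp
        simpa [hf₂] using (this.sub_const 1).const_mul (c * B)
      · have := (((hasDerivAt_id x).const_sub L).const_mul k).exp
        simpa using (this.mul_const (-k)).const_mul (c * B)
      · have h1 : 1 ≤ exp (k * (L - x)) := one_le_exp (mul_nonneg hk0.le (by linarith [hxI.2]))
        have := mul_rpow_lt_of_exp_profile hM0.le (mul_pos hc0 hB0) hq0 hq2 h1 (hcA hB0 hB)
        rw [hw₂ x h']
        have h2 : 0 ≤ f₂ x ^ q := rpow_nonneg
          (mul_nonneg (mul_pos hc0 hB0).le (by linarith)) q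
        have h3 := mul_le_mul_of_nonneg_right (haM x hxI) h2
        simp only [hf₂] at h3 ⊢
        linarith

/-- One-dimensional case: positive solutions exist for `q` close to `1`. If the
sign-changing continuous weight `a` is nonnegative and not identically zero on some
subinterval `[α, β] ⊆ (0, L)`, then there is `q̄ ∈ (0, 1)` such that for every
`q ∈ (q̄, 1)` the Dirichlet problem has a positive solution. -/
theorem stmt_14 (L : ℝ) (hL : 0 < L)
    (a : ℝ → ℝ) (ha : ContinuousOn a (Set.Icc 0 L)) (hsign : ChangesSign L a)
    (hsub : ∃ α β : ℝ, 0 < α ∧ α < β ∧ β < L ∧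
      (∀ x ∈ Set.Icc α β, 0 ≤ a x) ∧ (∃ x ∈ Set.Icc α β, a x ≠ 0)) :
    ∃ qbar : ℝ, qbar ∈ Set.Ioo (0 : ℝ) 1 ∧
      ∀ q : ℝ, qbar < q → q < 1 →
        ∃ u u' u'' : ℝ → ℝ,
          DirichletSolution L q a u u' u'' ∧ ∀ x ∈ Set.Ioo (0 : ℝ) L, 0 < u x := by
  obtain ⟨α, β, hα, -, hβ, hnn, x₁, hx₁, hne⟩ := hsub
  have hpos : 0 < a x₁ := lt_of_le_of_ne (hnn x₁ hx₁) hne.symm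
  have hx0 : 0 < x₁ := hα.trans_le hx₁.1
  have hxL : x₁ < L := hx₁.2.trans_lt hβ
  have hcont : ContinuousAt a x₁ := ha.continuousAt (Icc_mem_nhds hx0 hxL)
  obtain ⟨δ, hδ, hball⟩ := Metric.eventually_nhds_iff.mp
    (hcont.eventually (lt_mem_nhds (half_lt_self hpos)))
  obtain ⟨η, hη0, hη⟩ := exists_between (lt_min hδ (lt_min hx0 (sub_pos.mpr hxL)))
  obtain ⟨h1, h2, h3⟩ : η < δ ∧ η < x₁ ∧ η < L - x₁ := by simpa using hη
  refine exists_positive_solution_of_lower_bound (α := x₁ - η) (β := x₁ + η) (by linarith)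
    (by linarith) (by linarith) (half_pos hpos) ha fun x hx => (hball ?_).le
  rw [Real.dist_eq, abs_lt]
  exact ⟨by linarith [hx.1], by linarith [hx.2]⟩
end

section
/- (One-dimensional positivity property for small negative part.) Let L > 0, q ∈ (0,1), and let b : [0,L] → ℝ be continuous, nonnegative, not identically zero, such that the open set {x ∈ (0,L) : b(x) > 0} has finitely many connected components. Then there exists δ > 0 such that for every continuous a : [0,L] → ℝ whose positive part max(a,0) equals b and whose negative part satisfies max_{x ∈ [0,L]} max(−a(x),0) < δ, every nontrivial solution of the Dirichlet problem (P_D) with weight a and exponent q is strongly positive. -/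
open Real Set

/-- Second-order Taylor upper bound under a one-sided bound on the second derivative. -/
theorem taylor_le_of_second_deriv_le {L K z x : ℝ} {f f' f'' : ℝ → ℝ}
    (hf : ∀ t ∈ Set.Icc (0 : ℝ) L, HasDerivWithinAt f (f' t) (Set.Icc 0 L) t)
    (hf' : ∀ t ∈ Set.Icc (0 : ℝ) L, HasDerivWithinAt f' (f'' t) (Set.Icc 0 L) t)
    (hz : z ∈ Set.Icc (0 : ℝ) L) (hx : x ∈ Set.Icc (0 : ℝ) L)
    (hK : ∀ t ∈ Set.uIcc z x, f'' t ≤ K) :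
    f x ≤ f z + f' z * (x - z) + K * (x - z) ^ 2 / 2 := by
  have hsub : Set.uIcc z x ⊆ Set.Icc 0 L := Set.uIcc_subset_Icc hz hx
  have hanti : AntitoneOn (fun t => f' t - K * t) (Set.uIcc z x) := by
    have hd : ∀ t ∈ Set.uIcc z x,
        HasDerivWithinAt (fun t => f' t - K * t) (f'' t - K) (Set.uIcc z x) t := fun t ht =>
      (((hf' t (hsub ht)).mono hsub).sub ((hasDerivWithinAt_id t _).const_mul K)).congr_deriv
        (by rw [mul_one])
    refine antitoneOn_of_hasDerivWithinAt_nonpos (convex_uIcc z x)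
      (fun t ht => (hd t ht).continuousWithinAt)
      (fun t ht => (hd t (interior_subset ht)).mono interior_subset)
      (fun t ht => sub_nonpos.2 (hK t (interior_subset ht)))
  have hg : ∀ t ∈ Set.uIcc z x,
      HasDerivWithinAt (fun t => f t - f' z * (t - z) - K * (t - z) ^ 2 / 2)
        ((f' t - K * t) - (f' z - K * z)) (Set.uIcc z x) t := fun t ht => by
    have h1 : HasDerivWithinAt (fun t : ℝ => t - z) 1 (Set.uIcc z x) t :=
      (hasDerivWithinAt_id t _).sub_const z
    have h2 := (((hf t (hsub ht)).mono hsub).sub (h1.const_mul (f' z))).sub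
      (((h1.pow 2).const_mul K).div_const 2)
    refine h2.congr_deriv ?_
    norm_num
    ring
  have hgc : ContinuousOn (fun t => f t - f' z * (t - z) - K * (t - z) ^ 2 / 2)
      (Set.uIcc z x) := fun t ht => (hg t ht).continuousWithinAt
  have hgi := fun t (ht : t ∈ interior (Set.uIcc z x)) =>
    (hg t (interior_subset ht)).mono interior_subset
  have hle : f x - f' z * (x - z) - K * (x - z) ^ 2 / 2
      ≤ f z - f' z * (z - z) - K * (z - z) ^ 2 / 2 := by
    rcases le_total z x with hzx | hxz
    · refine antitoneOn_of_hasDerivWithinAt_nonpos (convex_uIcc z x) hgc hgi (fun t ht => ?_)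
        Set.left_mem_uIcc Set.right_mem_uIcc hzx
      have ht' := interior_subset ht
      have := hanti Set.left_mem_uIcc ht' (by rw [Set.uIcc_of_le hzx] at ht'; exact ht'.1)
      exact sub_nonpos.2 this
    · refine monotoneOn_of_hasDerivWithinAt_nonneg (convex_uIcc z x) hgc hgi (fun t ht => ?_)
        Set.right_mem_uIcc Set.left_mem_uIcc hxz
      have ht' := interior_subset ht
      have := hanti ht' Set.left_mem_uIcc (by rw [Set.uIcc_of_ge hxz] at ht'; exact ht'.2)
      exact sub_nonneg.2 this
  simp only [sub_self] at hle
  linarith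

/-- A nonnegative function vanishing at an interior point has zero derivative there. -/
theorem deriv_eq_zero_of_nonneg_of_eq_zero {L z : ℝ} {f f' : ℝ → ℝ}
    (hf : ∀ t ∈ Set.Icc (0 : ℝ) L, HasDerivWithinAt f (f' t) (Set.Icc 0 L) t)
    (hnn : ∀ t ∈ Set.Icc (0 : ℝ) L, 0 ≤ f t) (hz : z ∈ Set.Ioo (0 : ℝ) L) (hfz : f z = 0) :
    f' z = 0 := by
  have hmem : Set.Icc 0 L ∈ nhds z := Icc_mem_nhds hz.1 hz.2
  have hmin : IsLocalMin f z := by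
    filter_upwards [hmem] with t ht
    rw [hfz]
    exact hnn t ht
  exact hmin.hasDerivAt_eq_zero ((hf z (Set.Ioo_subset_Icc_self hz)).hasDerivAt hmem)

/-- A nonnegative function that is concave near `c`, with `-f'' ≥ β f ^ q` there, satisfies
a lower bound at `c`. -/
theorem mul_rpow_le_of_second_deriv_le {L q β h c : ℝ} {f f' f'' : ℝ → ℝ} (hq : 0 ≤ q)
    (hβ : 0 ≤ β) (hh : 0 < h) (hJ : Set.Icc (c - 2 * h) (c + 2 * h) ⊆ Set.Icc 0 L)
    (hf : ∀ t ∈ Set.Icc (0 : ℝ) L, HasDerivWithinAt f (f' t) (Set.Icc 0 L) t)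
    (hf' : ∀ t ∈ Set.Icc (0 : ℝ) L, HasDerivWithinAt f' (f'' t) (Set.Icc 0 L) t)
    (hnn : ∀ t ∈ Set.Icc (0 : ℝ) L, 0 ≤ f t)
    (hf'' : ∀ t ∈ Set.Icc (c - 2 * h) (c + 2 * h), f'' t ≤ -(β * f t ^ q)) :
    β * (1 / 2) ^ q * h ^ 2 / 2 * f c ^ q ≤ f c := by
  have hc : c ∈ Set.Icc (c - 2 * h) (c + 2 * h) := ⟨by linarith, by linarith⟩
  have hconc : ∀ y ∈ Set.Icc (c - 2 * h) (c + 2 * h), ∀ w ∈ Set.Icc (c - 2 * h) (c + 2 * h),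
      f w ≤ f y + f' y * (w - y) := fun y hy w hw => by
    have := taylor_le_of_second_deriv_le (K := 0) hf hf' (hJ hy) (hJ hw) fun t ht => by
      have htJ := Set.uIcc_subset_Icc hy hw ht
      have := mul_nonneg hβ (Real.rpow_nonneg (hnn t (hJ htJ)) q)
      linarith [hf'' t htJ]
    linarith
  have hhalf : ∀ y ∈ Set.Icc (c - h) (c + h), f c / 2 ≤ f y := fun y hy => by
    have hyJ : y ∈ Set.Icc (c - 2 * h) (c + 2 * h) := ⟨by linarith [hy.1], by linarith [hy.2]⟩
    have hwJ : 2 * y - c ∈ Set.Icc (c - 2 * h) (c + 2 * h) :=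
      ⟨by linarith [hy.1], by linarith [hy.2]⟩
    have h1 := hconc y hyJ c hc
    have h2 := hconc y hyJ _ hwJ
    have h3 := hnn _ (hJ hwJ)
    linarith
  have hfc := hnn c (hJ hc)
  have hsecond : ∀ t ∈ Set.Icc (c - h) (c + h), f'' t ≤ -(β * (f c / 2) ^ q) := fun t ht => by
    have h1 := hf'' t ⟨by linarith [ht.1], by linarith [ht.2]⟩
    have h2 := mul_le_mul_of_nonneg_left
      (Real.rpow_le_rpow (by linarith) (hhalf t ht) hq) hβ
    linarith
  have hcI : c ∈ Set.Icc (c - h) (c + h) := ⟨by linarith, by linarith⟩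
  have hlJ : c - h ∈ Set.Icc (c - 2 * h) (c + 2 * h) := ⟨by linarith, by linarith⟩
  have hrJ : c + h ∈ Set.Icc (c - 2 * h) (c + 2 * h) := ⟨by linarith, by linarith⟩
  have hl := taylor_le_of_second_deriv_le hf hf' (hJ hc) (hJ hlJ)
    fun t ht => hsecond t (Set.uIcc_subset_Icc hcI ⟨le_rfl, by linarith⟩ ht)
  have hr := taylor_le_of_second_deriv_le hf hf' (hJ hc) (hJ hrJ)
    fun t ht => hsecond t (Set.uIcc_subset_Icc hcI ⟨by linarith, le_rfl⟩ ht)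
  have hl0 := hnn _ (hJ hlJ)
  have hr0 := hnn _ (hJ hrJ)
  have hpow : (f c / 2) ^ q = (1 / 2) ^ q * f c ^ q := by
    rw [← Real.mul_rpow (by norm_num) hfc]
    congr 1
    ring
  rw [hpow] at hl hr
  nlinarith

/-- Around an interior point where the continuous weight `b` is positive, a solution is
either zero or bounded below, uniformly over all weights with positive part `b`. -/
theorem exists_forall_mul_rpow_le {L q c : ℝ} (hq : q ∈ Set.Ioo (0 : ℝ) 1) {b : ℝ → ℝ}
    (hb : ContinuousOn b (Set.Icc 0 L)) (hc : c ∈ Set.Ioo (0 : ℝ) L) (hbc : 0 < b c) :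
    ∃ C > (0 : ℝ), ∀ a u u' u'' : ℝ → ℝ,
      (∀ x ∈ Set.Icc (0 : ℝ) L, max (a x) 0 = b x) →
      DirichletSolution L q a u u' u'' → C * u c ^ q ≤ u c := by
  have hmem : Set.Icc 0 L ∈ nhds c := Icc_mem_nhds hc.1 hc.2
  have hev : ∀ᶠ t in nhds c, b c / 2 < b t :=
    (hb.continuousAt hmem).eventually (lt_mem_nhds (by linarith))
  obtain ⟨ε, hε, hball⟩ := Metric.eventually_nhds_iff_ball.1 (hev.and hmem)
  have hJ : ∀ t ∈ Set.Icc (c - 2 * (ε / 4)) (c + 2 * (ε / 4)),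
      b c / 2 < b t ∧ t ∈ Set.Icc 0 L := fun t ht => hball t <| by
    rw [Metric.mem_ball, Real.dist_eq, abs_lt]
    exact ⟨by linarith [ht.1], by linarith [ht.2]⟩
  refine ⟨b c / 2 * (1 / 2) ^ q * (ε / 4) ^ 2 / 2, by positivity, ?_⟩
  rintro a u u' u'' hab ⟨hu, hu', -, hnn, -, -, heq⟩
  refine mul_rpow_le_of_second_deriv_le hq.1.le (by linarith) (by linarith)
    (fun t ht => (hJ t ht).2) hu hu' hnn fun t ht => ?_
  obtain ⟨hbt, htI⟩ := hJ t ht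
  have ha : b c / 2 ≤ a t := by
    have := hab t htI
    rcases max_choice (a t) 0 with h | h <;> rw [h] at this <;> linarith
  have := mul_le_mul_of_nonneg_right ha (Real.rpow_nonneg (hnn t htI) q)
  linarith [heq t htI]

/-- If a solution vanishes at a point of a segment on which the weight is nonnegative, then
it vanishes at the other end of the segment. -/
theorem DirichletSolution.eq_zero_of_uIcc {L q c x : ℝ} {a u u' u'' : ℝ → ℝ}
    (hsol : DirichletSolution L q a u u' u'') (hc : c ∈ Set.Ioo (0 : ℝ) L)
    (hx : x ∈ Set.Icc (0 : ℝ) L) (ha : ∀ t ∈ Set.uIcc c x, 0 ≤ a t) (huc : u c = 0) :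
    u x = 0 := by
  obtain ⟨hu, hu', -, hnn, -, -, heq⟩ := hsol
  have hcI := Set.Ioo_subset_Icc_self hc
  have hle := taylor_le_of_second_deriv_le (K := 0) hu hu' hcI hx fun t ht => by
    have htI := Set.uIcc_subset_Icc hcI hx ht
    have := mul_nonneg (ha t ht) (Real.rpow_nonneg (hnn t htI) q)
    linarith [heq t htI]
  rw [huc, deriv_eq_zero_of_nonneg_of_eq_zero hu hnn hc huc] at hle
  exact le_antisymm (by linarith) (hnn x hx)

/-- A solution that vanishes wherever the weight is positive is trivial. -/
theorem DirichletSolution.eq_zero_of_eq_zero_on_pos {L q x : ℝ} {a u u' u'' : ℝ → ℝ}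
    (hsol : DirichletSolution L q a u u' u'') (hL : 0 < L) (hq : 0 < q)
    (hpos : ∀ t ∈ Set.Ioo (0 : ℝ) L, 0 < a t → u t = 0) (hx : x ∈ Set.Icc (0 : ℝ) L) :
    u x = 0 := by
  obtain ⟨hu, hu', -, hnn, hu0, huL, heq⟩ := hsol
  have hconv : ∀ t ∈ Set.Icc (0 : ℝ) L, -u'' t ≤ 0 := fun t ht => by
    rw [heq t ht]
    rcases (hnn t ht).eq_or_lt with h | h
    · simp [← h, Real.zero_rpow hq.ne']
    · refine mul_nonpos_of_nonpos_of_nonneg (not_lt.1 fun hat => h.ne' (hpos t ?_ hat))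
        (Real.rpow_nonneg h.le q)
      refine ⟨ht.1.lt_of_ne ?_, ht.2.lt_of_ne ?_⟩
      · rintro rfl
        exact h.ne' hu0
      · rintro rfl
        exact h.ne' huL
  have h0L : (0 : ℝ) ∈ Set.Icc 0 L := ⟨le_rfl, hL.le⟩
  have hLL : L ∈ Set.Icc 0 L := ⟨hL.le, le_rfl⟩
  have key : ∀ w ∈ Set.Icc (0 : ℝ) L, -u w ≤ -u x + -u' x * (w - x) + 0 * (w - x) ^ 2 / 2 :=
    fun w hw => taylor_le_of_second_deriv_le (f := fun t => -u t) (f' := fun t => -u' t)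
      (f'' := fun t => -u'' t) (fun t ht => (hu t ht).neg) (fun t ht => (hu' t ht).neg) hx hw
      fun t ht => hconv t (Set.uIcc_subset_Icc hx hw ht)
  have k0 := key 0 h0L
  have kL := key L hLL
  rw [hu0] at k0
  rw [huL] at kL
  refine le_antisymm ?_ (hnn x hx)
  have h1 := mul_le_mul_of_nonneg_left k0 (sub_nonneg.2 hx.2)
  have h2 := mul_le_mul_of_nonneg_left kL hx.1
  have h3 : L * u x ≤ 0 := by nlinarith
  exact nonpos_of_mul_nonpos_right h3 hL

/-- A solution vanishing at a point `z`, with derivative there not pointing into `[0, L]`,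
is bounded in terms of the size of the negative part of the weight. -/
theorem DirichletSolution.exists_le_mul_rpow {L q δ z : ℝ} {a u u' u'' : ℝ → ℝ}
    (hsol : DirichletSolution L q a u u' u'') (hq : 0 ≤ q) (hδ : 0 ≤ δ)
    (ha : ∀ x ∈ Set.Icc (0 : ℝ) L, -a x ≤ δ) (hz : z ∈ Set.Icc (0 : ℝ) L) (huz : u z = 0)
    (hu'z : ∀ x ∈ Set.Icc (0 : ℝ) L, u' z * (x - z) ≤ 0) :
    ∃ M, (∀ x ∈ Set.Icc (0 : ℝ) L, u x ≤ M) ∧ M ≤ δ * L ^ 2 / 2 * M ^ q := by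
  obtain ⟨hu, hu', -, hnn, -, -, heq⟩ := hsol
  have hcont : ContinuousOn u (Set.Icc 0 L) := fun t ht => (hu t ht).continuousWithinAt
  obtain ⟨y, hy, hmax⟩ := isCompact_Icc.exists_isMaxOn ⟨z, hz⟩ hcont
  refine ⟨u y, fun x hx => hmax hx, ?_⟩
  have hM : 0 ≤ u y ^ q := Real.rpow_nonneg (hnn y hy) q
  have hle := taylor_le_of_second_deriv_le (K := δ * u y ^ q) hu hu' hz hy fun t ht => by
    have htI := Set.uIcc_subset_Icc hz hy ht
    have h1 := mul_le_mul_of_nonneg_right (ha t htI) (Real.rpow_nonneg (hnn t htI) q)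
    have h2 := mul_le_mul_of_nonneg_left
      (Real.rpow_le_rpow (hnn t htI) (hmax htI) hq) hδ
    linarith [heq t htI]
  have hsq : (y - z) ^ 2 ≤ L ^ 2 :=
    sq_le_sq' (by linarith [hy.1, hz.2]) (by linarith [hy.2, hz.1])
  have h3 := mul_le_mul_of_nonneg_left hsq (mul_nonneg hδ hM)
  linarith [hu'z y hy]

/-- For `q < 1`, a lower bound `C s ^ q ≤ s` with `s > 0` and an upper bound
`M ≤ D M ^ q` with `s ≤ M` force `C ≤ D`. -/
theorem le_of_mul_rpow_le_of_le_mul_rpow {q s M C D : ℝ} (hq : q ≤ 1) (hs : 0 < s)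
    (hsM : s ≤ M) (hC : C * s ^ q ≤ s) (hD : M ≤ D * M ^ q) : C ≤ D := by
  have hM := hs.trans_le hsM
  have hsplit : ∀ t : ℝ, 0 < t → t / t ^ q = t ^ (1 - q) := fun t ht => by
    rw [Real.rpow_sub ht, Real.rpow_one]
  calc C ≤ s / s ^ q := (le_div_iff₀ (Real.rpow_pos_of_pos hs q)).2 hC
    _ = s ^ (1 - q) := hsplit s hs
    _ ≤ M ^ (1 - q) := Real.rpow_le_rpow hs.le hsM (by linarith)
    _ = M / M ^ q := (hsplit M hM).symm
    _ ≤ D := (div_le_iff₀ (Real.rpow_pos_of_pos hM q)).2 hD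

/-- Points of a subtype of `ℝ` in the same connected component are joined by a segment inside
the subtype. -/
theorem uIcc_subset_of_connectedComponents_eq {p : ℝ → Prop} {x y : {t : ℝ // p t}}
    (h : (x : ConnectedComponents {t : ℝ // p t}) = y) :
    ∀ t ∈ Set.uIcc (x : ℝ) y, p t := by
  have hpre : IsPreconnected (Set.image Subtype.val (connectedComponent x)) :=
    isPreconnected_connectedComponent.image _ continuous_subtype_val.continuousOn
  have hx : (x : ℝ) ∈ (Set.image Subtype.val (connectedComponent x)) :=
    ⟨x, mem_connectedComponent, rfl⟩
  have hy : (y : ℝ) ∈ (Set.image Subtype.val (connectedComponent x)) :=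
    ⟨y, by rw [ConnectedComponents.coe_eq_coe.1 h]; exact mem_connectedComponent, rfl⟩
  intro t ht
  obtain ⟨w, -, rfl⟩ := hpre.ordConnected.uIcc_subset hx hy ht
  exact w.2

/-- One-dimensional positivity property for small negative part: given a nonnegative,
not identically zero, continuous `b` whose positivity set in `(0, L)` has finitely many
connected components, there is `δ > 0` such that every continuous weight `a` with
`a⁺ = b` and `‖a⁻‖_∞ < δ` has the property that every nontrivial solution of the
Dirichlet problem is strongly positive. -/
theorem stmt_15 (L q : ℝ) (hL : 0 < L) (hq : q ∈ Set.Ioo (0 : ℝ) 1)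
    (b : ℝ → ℝ) (hb : ContinuousOn b (Set.Icc 0 L))
    (hbnn : ∀ x ∈ Set.Icc (0 : ℝ) L, 0 ≤ b x)
    (hbne : ∃ x ∈ Set.Icc (0 : ℝ) L, b x ≠ 0)
    (hfin : Finite (ConnectedComponents {x : ℝ // x ∈ Set.Ioo (0 : ℝ) L ∧ 0 < b x})) :
    ∃ δ > (0 : ℝ), ∀ a : ℝ → ℝ, ContinuousOn a (Set.Icc 0 L) →
      (∀ x ∈ Set.Icc (0 : ℝ) L, max (a x) 0 = b x) →
      (∀ x ∈ Set.Icc (0 : ℝ) L, max (-a x) 0 < δ) →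
      ∀ u u' u'' : ℝ → ℝ, DirichletSolution L q a u u' u'' →
        (∃ x ∈ Set.Icc (0 : ℝ) L, u x ≠ 0) →
        ((∀ x ∈ Set.Ioo (0 : ℝ) L, 0 < u x) ∧ 0 < u' 0 ∧ u' L < 0) := by
  have hrep : ∀ i : ConnectedComponents {x : ℝ // x ∈ Set.Ioo (0 : ℝ) L ∧ 0 < b x},
      ∃ c : {x : ℝ // x ∈ Set.Ioo (0 : ℝ) L ∧ 0 < b x}, (c : ConnectedComponents _) = i :=
    ConnectedComponents.surjective_coe
  choose c hc using hrep
  choose C hCpos hC using fun i => exists_forall_mul_rpow_le hq hb (c i).2.1 (c i).2.2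
  obtain ⟨δ, hδC, hδ⟩ : ∃ δ : ℝ, (∀ i, δ * L ^ 2 / 2 < C i) ∧ 0 < δ := by
    have hev : ∀ᶠ δ : ℝ in nhdsWithin 0 (Set.Ioi 0), ∀ i, δ * L ^ 2 / 2 < C i := by
      refine Filter.eventually_all.2 fun i => nhdsWithin_le_nhds ?_
      have hcont : ContinuousAt (fun δ : ℝ => δ * L ^ 2 / 2) 0 := by fun_prop
      exact hcont.eventually (gt_mem_nhds (by simpa using hCpos i))
    exact (hev.and self_mem_nhdsWithin).exists
  refine ⟨δ, hδ, fun a _ hab hneg u u' u'' hsol ⟨x₀, hx₀, hux₀⟩ => ?_⟩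
  have no_flat_zero : ∀ z ∈ Set.Icc (0 : ℝ) L, u z = 0 →
      ¬ ∀ x ∈ Set.Icc (0 : ℝ) L, u' z * (x - z) ≤ 0 := by
    intro z hz huz hu'z
    obtain ⟨M, huM, hM⟩ := hsol.exists_le_mul_rpow hq.1.le hδ.le
      (fun x hx => (le_max_left _ _).trans (hneg x hx).le) hz huz hu'z
    have huc : ∀ i, u (c i) = 0 := fun i => by
      have hcI := Set.Ioo_subset_Icc_self (c i).2.1
      by_contra hne
      exact (hδC i).not_ge (le_of_mul_rpow_le_of_le_mul_rpow hq.2.le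
        ((hsol.2.2.2.1 _ hcI).lt_of_ne' hne) (huM _ hcI) (hC i a u u' u'' hab hsol) hM)
    refine hux₀ (hsol.eq_zero_of_eq_zero_on_pos hL hq.1 (fun t ht hat => ?_) hx₀)
    have hbt : 0 < b t := by
      rw [← hab t (Set.Ioo_subset_Icc_self ht)]
      exact lt_max_of_lt_left hat
    let i : ConnectedComponents {x : ℝ // x ∈ Set.Ioo (0 : ℝ) L ∧ 0 < b x} :=
      ((⟨t, ht, hbt⟩ : {x : ℝ // x ∈ Set.Ioo (0 : ℝ) L ∧ 0 < b x}) : ConnectedComponents _)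
    refine hsol.eq_zero_of_uIcc (c i).2.1 (Set.Ioo_subset_Icc_self ht) (fun s hs => ?_) (huc i)
    obtain ⟨hsI, hbs⟩ := uIcc_subset_of_connectedComponents_eq (hc i) s hs
    rw [← hab s (Set.Ioo_subset_Icc_self hsI)] at hbs
    exact (lt_max_iff.1 hbs).elim le_of_lt fun h => absurd h (lt_irrefl 0)
  obtain ⟨hu, -, -, hnn, hu0, huL, -⟩ := hsol
  refine ⟨fun x hx => ?_, ?_, ?_⟩
  · have hxI := Set.Ioo_subset_Icc_self hx
    refine (hnn x hxI).lt_of_ne' fun hux => no_flat_zero x hxI hux fun y _ => ?_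
    rw [deriv_eq_zero_of_nonneg_of_eq_zero hu hnn hx hux, zero_mul]
  · by_contra h
    refine no_flat_zero 0 ⟨le_rfl, hL.le⟩ hu0 fun x hx => ?_
    exact mul_nonpos_of_nonpos_of_nonneg (not_lt.1 h) (sub_nonneg.2 hx.1)
  · by_contra h
    refine no_flat_zero L ⟨hL.le, le_rfl⟩ huL fun x hx => ?_
    exact mul_nonpos_of_nonneg_of_nonpos (not_lt.1 h) (sub_nonpos.2 hx.2)
end
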